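/- For each q ∈ (0,1), γ ≥ 1 and s ∈ ℝ, lim_{N→∞} ℙ[(G(⌊γN⌋, N) − N·ω(γ,q)) / (σ(γ,q)·N^{1/3}) ≤ s] = F(s), where σ(γ,q) = q^{1/6} γ^{−1/6} (1−q)^{−1} (√γ+√q)^{2/3} (1+√(qγ))^{2/3} and F is the Tracy–Widom distribution function. -/

import Mathlib

open MeasureTheory Filter

/-- An up/right path from `(1,1)` to `(M,N)`: a sequence of `M+N-1` lattice sites starting at
`(1,1)`, ending at `(M,N)`, each step increasing one coordinate by one. -/
def UpRightPath (M N : ℕ) (π : ℕ → ℕ × ℕ) : Prop :=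
  π 0 = (1, 1) ∧ π (M + N - 2) = (M, N) ∧
    ∀ k, k < M + N - 2 →
      π (k + 1) = ((π k).1 + 1, (π k).2) ∨ π (k + 1) = ((π k).1, (π k).2 + 1)

/-- `G(M,N)`: the maximum over up/right paths from `(1,1)` to `(M,N)` of the sum of the
site weights `w` along the path. -/
noncomputable def lppSup (w : ℕ × ℕ → ℕ) (M N : ℕ) : ℕ :=
  sSup {s | ∃ π : ℕ → ℕ × ℕ, UpRightPath M N π ∧
    s = ∑ k ∈ Finset.range (M + N - 1), w (π k)}


/-- The Airy function `Ai(x) = (1/2π) ∫_ℝ exp(i(t+is)³/3 + ix(t+is)) dt` (with `s = 1`). -/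
noncomputable def Ai (x : ℝ) : ℝ :=
  (1 / (2 * Real.pi)) *
    (∫ t : ℝ, Complex.exp (Complex.I * ((t : ℂ) + Complex.I) ^ 3 / 3
        + Complex.I * (x : ℂ) * ((t : ℂ) + Complex.I))).re

/-- The Airy kernel `A(x,y) = (Ai(x)Ai′(y) − Ai′(x)Ai(y))/(x−y)`, extended continuously
to the diagonal. -/
noncomputable def airyKernel (x y : ℝ) : ℝ :=
  if x = y then deriv Ai x ^ 2 - Ai x * deriv (deriv Ai) x
  else (Ai x * deriv Ai y - deriv Ai x * Ai y) / (x - y)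

/-- The Tracy–Widom (GUE) distribution function, as a Fredholm determinant of the
Airy kernel on `L²[s,∞)`. -/
noncomputable def TW (s : ℝ) : ℝ :=
  ∑' k : ℕ, ((-1 : ℝ) ^ k / (Nat.factorial k)) *
    ∫ ξ : Fin k → ℝ in {ξ | ∀ i, s ≤ ξ i},
      Matrix.det (Matrix.of fun i j => airyKernel (ξ i) (ξ j))

open Matrix in
theorem det_one_add_eq_sum_minors {n : Type*} [Fintype n] [DecidableEq n] (M : Matrix n n ℝ) :
    (1 + M).det = ∑ s : Finset n, (M.submatrix (Subtype.val : s → n) Subtype.val).det := by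
  have h := (detRowAlternating : (n → ℝ) [⋀^n]→ₗ[ℝ] ℝ).map_add_univ M (1 : Matrix n n ℝ)
  rw [add_comm]
  refine Eq.trans h (Finset.sum_congr rfl fun s _ => ?_)
  exact det_piecewise_one_eq_submatrix_det M s

open Matrix in
theorem sum_det_submatrix_tuple {n : Type*} [Fintype n] [DecidableEq n] (M : Matrix n n ℝ) (k : ℕ) :
    ∑ f : Fin k → n, (M.submatrix f f).det =
      k.factorial * ∑ s ∈ Finset.univ.powersetCard k,
        (M.submatrix (Subtype.val : s → n) Subtype.val).det := by
  classical
  have h0 : ∑ f : Fin k → n, (M.submatrix f f).det =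
      ∑ f ∈ Finset.univ.filter (fun f : Fin k → n => Function.Injective f), (M.submatrix f f).det := by
    rw [Finset.sum_filter_of_ne]
    intro f _ hf a b hab
    by_contra hne
    exact hf (det_zero_of_row_eq hne (by ext j; simp [hab]))
  rw [h0, ← Finset.sum_fiberwise_of_maps_to (t := Finset.univ.powersetCard k)
    (g := fun f => Finset.univ.image f), Finset.mul_sum]
  · refine Finset.sum_congr rfl fun s hs => ?_
    have hs' : s.card = k := (Finset.mem_powersetCard.mp hs).2
    have : ∑ f ∈ (Finset.univ.filter (fun f : Fin k → n => Function.Injective f)).filter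
        (fun f => Finset.univ.image f = s), (M.submatrix f f).det =
        ∑ e : Fin k ≃ s, (M.submatrix (Subtype.val : s → n) Subtype.val).det := by
      symm
      refine Finset.sum_bij (fun e _ => fun i => (e i : n)) ?_ ?_ ?_ ?_
      · intro e _
        simp only [Finset.mem_filter, Finset.mem_univ, true_and]
        refine ⟨fun a b h => e.injective (Subtype.ext h), ?_⟩
        ext x
        simp only [Finset.mem_image, Finset.mem_univ, true_and]
        constructor
        · rintro ⟨i, rfl⟩; exact (e i).2
        · intro hx; exact ⟨e.symm ⟨x, hx⟩, by simp⟩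
      · intro e _ e' _ h
        ext i
        exact congrFun h i
      · intro f hf
        simp only [Finset.mem_filter, Finset.mem_univ, true_and] at hf
        obtain ⟨hf, rfl⟩ := hf
        refine ⟨Equiv.ofBijective (fun i => ⟨f i, Finset.mem_image_of_mem f (Finset.mem_univ i)⟩)
          ⟨fun a b h => hf (congrArg Subtype.val h), ?_⟩, Finset.mem_univ _, rfl⟩
        rintro ⟨x, hx⟩
        obtain ⟨i, _, rfl⟩ := Finset.mem_image.mp hx
        exact ⟨i, rfl⟩
      · intro e _
        rw [← det_submatrix_equiv_self e]
        rfl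
    rw [this, Finset.sum_const, Finset.card_univ, nsmul_eq_mul,
      Fintype.card_equiv (Fintype.equivOfCardEq (by simp [hs'])), Fintype.card_fin]
  · intro f hf
    simp only [Finset.mem_filter, Finset.mem_univ, true_and] at hf
    simp [Finset.mem_powersetCard, Finset.card_image_of_injective _ hf]

open Matrix in
/-- The Fredholm expansion of a finite determinant. -/
theorem det_one_sub_eq_tsum {n : Type*} [Fintype n] [DecidableEq n] (M : Matrix n n ℝ) :
    (1 - M).det = ∑' k : ℕ, ((-1 : ℝ) ^ k / k.factorial) *
      ∑ f : Fin k → n, (M.submatrix f f).det := by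
  rw [sub_eq_add_neg, det_one_add_eq_sum_minors]
  have key : ∀ k : ℕ, ((-1 : ℝ) ^ k / k.factorial) * ∑ f : Fin k → n, (M.submatrix f f).det =
      ∑ s ∈ Finset.univ.powersetCard k,
        ((-M).submatrix (Subtype.val : s → n) Subtype.val).det := by
    intro k
    rw [sum_det_submatrix_tuple, ← mul_assoc, div_mul_cancel₀ _ (by positivity), Finset.mul_sum]
    refine Finset.sum_congr rfl fun s hs => ?_
    have : ((-M).submatrix (Subtype.val : s → n) (Subtype.val : s → n)) =
      -(M.submatrix (Subtype.val : s → n) (Subtype.val : s → n)) := rfl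
    rw [this, det_neg, Fintype.card_coe, (Finset.mem_powersetCard.mp hs).2]
  simp_rw [key]
  rw [tsum_eq_sum (s := Finset.range (Fintype.card n + 1))]
  · rw [← Finset.powerset_univ, Finset.sum_powerset, Finset.card_univ]
  · intro k hk
    rw [Finset.powersetCard_eq_empty.mpr (by simpa using hk), Finset.sum_empty]

open Matrix in
/-- Hadamard's inequality for a matrix with uniformly bounded entries, in squared form. -/
theorem det_sq_le_of_abs_entry_le {k : ℕ} (A : Matrix (Fin k) (Fin k) ℝ) {c : ℝ}
    (hA : ∀ i j, |A i j| ≤ c) : A.det ^ 2 ≤ ((k : ℝ) * c ^ 2) ^ k := by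
  rcases Nat.eq_zero_or_pos k with rfl | hk
  · simp
  have hk' : (0 : ℝ) < k := by exact_mod_cast hk
  have hP : (Aᴴ * A).PosSemidef := posSemidef_conjTranspose_mul_self A
  have hdet : A.det ^ 2 = ∏ i, hP.1.eigenvalues i := by
    have := hP.1.det_eq_prod_eigenvalues
    simp only [det_mul, det_conjTranspose, star_trivial] at this
    rw [sq, this]; rfl
  have htr : ∑ i, hP.1.eigenvalues i ≤ k * (k * c ^ 2) := by
    have h1 := hP.1.trace_eq_sum_eigenvalues
    have h2 : (Aᴴ * A).trace = ∑ i, ∑ j, A j i ^ 2 := by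
      simp [trace, mul_apply, sq]
    have h3 : ∑ i, hP.1.eigenvalues i = (Aᴴ * A).trace := by rw [h1]; rfl
    rw [h3, h2]
    calc ∑ i, ∑ j, A j i ^ 2 ≤ ∑ i : Fin k, ∑ j : Fin k, c ^ 2 :=
          Finset.sum_le_sum fun i _ => Finset.sum_le_sum fun j _ => sq_le_sq' (by
            linarith [neg_abs_le (A j i), hA j i]) (le_trans (le_abs_self _) (hA j i))
      _ = k * (k * c ^ 2) := by simp
  have h0 := fun i => hP.eigenvalues_nonneg i
  have hamgm := Real.geom_mean_le_arith_mean Finset.univ (fun _ : Fin k => (1 : ℝ))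
    hP.1.eigenvalues (fun _ _ => zero_le_one) (by simpa using hk') (fun i _ => h0 i)
  simp only [Real.rpow_one, Finset.sum_const, Finset.card_univ, Fintype.card_fin, nsmul_eq_mul,
    mul_one, one_mul] at hamgm
  have h4 : (∏ i, hP.1.eigenvalues i) ^ ((k : ℝ)⁻¹) ≤ k * c ^ 2 := by
    refine hamgm.trans ?_
    rw [div_le_iff₀ hk']
    linarith
  have h5 : 0 ≤ ∏ i, hP.1.eigenvalues i := Finset.prod_nonneg fun i _ => h0 i
  rw [hdet]
  calc ∏ i, hP.1.eigenvalues i = ((∏ i, hP.1.eigenvalues i) ^ ((k : ℝ)⁻¹)) ^ k := by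
        rw [← Real.rpow_natCast, ← Real.rpow_mul h5, inv_mul_cancel₀ hk'.ne', Real.rpow_one]
    _ ≤ _ := pow_le_pow_left₀ (Real.rpow_nonneg h5 _) h4 k

/-- Last-passage times by the one-step recursion, with value `0` on the axes. -/
def lppRec (w : ℕ × ℕ → ℕ) : ℕ → ℕ → ℕ
  | 0, _ => 0
  | _ + 1, 0 => 0
  | m + 1, k + 1 => max (lppRec w m (k + 1)) (lppRec w (m + 1) k) + w (m + 1, k + 1)

theorem lppRec_zero_right (w : ℕ × ℕ → ℕ) (m : ℕ) : lppRec w m 0 = 0 := by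
  cases m <;> simp [lppRec]

theorem UpRightPath.sum_le_lppRec {w : ℕ × ℕ → ℕ} {M N : ℕ} {π : ℕ → ℕ × ℕ}
    (h : UpRightPath M N π) (k : ℕ) (hk : k ≤ M + N - 2) :
    (∃ a b, π k = (a + 1, b + 1)) ∧
      ∑ i ∈ Finset.range (k + 1), w (π i) ≤ lppRec w (π k).1 (π k).2 := by
  induction k with
  | zero => exact ⟨⟨0, 0, h.1⟩, by simp [h.1, lppRec]⟩
  | succ k ih =>
    obtain ⟨⟨a, b, hab⟩, hs⟩ := ih (by omega)
    rw [Finset.sum_range_succ]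
    rcases h.2.2 k (by omega) with h1 | h1
    · rw [hab] at h1 hs
      refine ⟨⟨a + 1, b, h1⟩, ?_⟩
      rw [h1]
      simp only [lppRec] at hs ⊢
      exact Nat.add_le_add_right (hs.trans (le_max_left _ _)) _
    · rw [hab] at h1 hs
      refine ⟨⟨a, b + 1, h1⟩, ?_⟩
      rw [h1]
      simp only [lppRec] at hs ⊢
      exact Nat.add_le_add_right (hs.trans (le_max_right _ _)) _

theorem UpRightPath.exists_extend (w : ℕ × ℕ → ℕ) {M N M' N' : ℕ} {π : ℕ → ℕ × ℕ} (hM : 1 ≤ M)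
    (hN : 1 ≤ N) (h : UpRightPath M N π)
    (h' : (M', N') = (M + 1, N) ∨ (M', N') = (M, N + 1)) :
    ∃ π', UpRightPath M' N' π' ∧ ∑ k ∈ Finset.range (M' + N' - 1), w (π' k) =
      ∑ k ∈ Finset.range (M + N - 1), w (π k) + w (M', N') := by
  have hlen : M' + N' - 2 = M + N - 2 + 1 ∧ M' + N' - 1 = M + N - 1 + 1 ∧
      M + N - 1 = M + N - 2 + 1 := by
    rcases h' with h' | h' <;> (simp only [Prod.mk.injEq] at h'; omega)
  obtain ⟨h1, h2, h3⟩ := hlen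
  refine ⟨Function.update π (M + N - 1) (M', N'), ⟨?_, ?_, ?_⟩, ?_⟩
  · rw [Function.update_of_ne (by omega)]; exact h.1
  · rw [h1, ← h3, Function.update_self]
  · intro k hk
    rw [Function.update_of_ne (by omega : k ≠ _)]
    rcases Nat.lt_or_ge k (M + N - 2) with hk' | hk'
    · rw [Function.update_of_ne (by omega)]
      exact h.2.2 k hk'
    · have : k = M + N - 2 := by omega
      subst this
      rw [← h3, Function.update_self, h.2.1]
      exact h'
  · rw [h2, Finset.sum_range_succ, Function.update_self]
    congr 1
    refine Finset.sum_congr rfl fun k hk => ?_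
    rw [Function.update_of_ne (Finset.mem_range.mp hk).ne]

theorem exists_upRightPath_sum_eq (w : ℕ × ℕ → ℕ) (m k : ℕ) :
    ∃ π, UpRightPath (m + 1) (k + 1) π ∧
      ∑ i ∈ Finset.range (m + 1 + (k + 1) - 1), w (π i) = lppRec w (m + 1) (k + 1) := by
  induction hn : m + k generalizing m k with
  | zero =>
    obtain ⟨rfl, rfl⟩ : m = 0 ∧ k = 0 := by omega
    exact ⟨fun _ => (1, 1), ⟨rfl, rfl, fun k hk => by omega⟩, by simp [lppRec]⟩
  | succ n ih =>
    have hleft : ∀ m', m = m' + 1 → lppRec w (m + 1) k ≤ lppRec w m (k + 1) →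
        ∃ π, UpRightPath (m + 1) (k + 1) π ∧
          ∑ i ∈ Finset.range (m + 1 + (k + 1) - 1), w (π i) = lppRec w (m + 1) (k + 1) := by
      rintro m' rfl hle
      obtain ⟨π, hπ, hs⟩ := ih m' k (by omega)
      obtain ⟨π', hπ', hs'⟩ := hπ.exists_extend w (by omega) (by omega) (Or.inl rfl)
      exact ⟨π', hπ', by rw [hs', hs, lppRec.eq_3 w (m' + 1) k, max_eq_left hle]⟩
    have hright : ∀ k', k = k' + 1 → lppRec w m (k + 1) ≤ lppRec w (m + 1) k →
        ∃ π, UpRightPath (m + 1) (k + 1) π ∧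
          ∑ i ∈ Finset.range (m + 1 + (k + 1) - 1), w (π i) = lppRec w (m + 1) (k + 1) := by
      rintro k' rfl hle
      obtain ⟨π, hπ, hs⟩ := ih m k' (by omega)
      obtain ⟨π', hπ', hs'⟩ := hπ.exists_extend w (by omega) (by omega) (Or.inr rfl)
      exact ⟨π', hπ', by rw [hs', hs, lppRec.eq_3 w m (k' + 1), max_eq_right hle]⟩
    rcases m with - | m
    · rcases k with - | k
      · omega
      · exact hright k rfl (by simp [lppRec])
    · rcases k with - | k
      · exact hleft m rfl (by simp [lppRec])
      · rcases le_total (lppRec w (m + 1 + 1) (k + 1)) (lppRec w (m + 1) (k + 1 + 1)) with h | h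
        · exact hleft m rfl h
        · exact hright k rfl h

theorem lppSup_eq_lppRec (w : ℕ × ℕ → ℕ) {M N : ℕ} (hM : 1 ≤ M) (hN : 1 ≤ N) :
    lppSup w M N = lppRec w M N := by
  obtain ⟨m, rfl⟩ := Nat.exists_eq_add_of_le' hM
  obtain ⟨k, rfl⟩ := Nat.exists_eq_add_of_le' hN
  refine IsGreatest.csSup_eq ⟨?_, ?_⟩
  · obtain ⟨π, hπ, hs⟩ := exists_upRightPath_sum_eq w m k
    exact ⟨π, hπ, hs.symm⟩
  · rintro s ⟨π, hπ, rfl⟩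
    have := (hπ.sum_le_lppRec (w := w) (m + 1 + (k + 1) - 2) le_rfl).2
    rw [hπ.2.1] at this
    rwa [show m + 1 + (k + 1) - 2 + 1 = m + 1 + (k + 1) - 1 by omega] at this

theorem lppRec_congr {w w' : ℕ × ℕ → ℕ} (m k : ℕ)
    (h : ∀ a b, a ≤ m → b ≤ k → w (a, b) = w' (a, b)) : lppRec w m k = lppRec w' m k := by
  induction m generalizing k with
  | zero => simp [lppRec]
  | succ m ihm =>
    induction k with
    | zero => simp [lppRec]
    | succ k ihk =>
      rw [lppRec, lppRec, ihm (k + 1) fun a b ha hb => h a b (by omega) hb,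
        ihk fun a b ha hb => h a b ha (by omega), h _ _ le_rfl le_rfl]

theorem lppRec_mono_right (w : ℕ × ℕ → ℕ) (m : ℕ) : Monotone (lppRec w m) := by
  refine monotone_nat_of_le_succ fun k => ?_
  cases m with
  | zero => simp [lppRec]
  | succ m =>
    rw [lppRec]
    exact (le_max_right _ _).trans (Nat.le_add_right _ _)

/-- Adding an independent geometric variable: recursion for the distribution function. -/
theorem measureReal_add_geom_le {Ω T : Type*} [MeasurableSpace Ω] {ℙ : Measure Ω}
    [IsProbabilityMeasure ℙ] [MeasurableSpace T] [Countable T] [MeasurableSingletonClass T]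
    {q : ℝ} (hq0 : 0 < q) (hq1 : q < 1) {τ : Ω → T} {W : Ω → ℕ} (hτ : Measurable τ)
    (hW : Measurable W) (hind : ProbabilityTheory.IndepFun τ W ℙ)
    (hgeom : ∀ k, ℙ {ω | W ω = k} = ENNReal.ofReal ((1 - q) * q ^ k))
    (A : Set T) (U : T → ℕ) (y : ℤ) :
    ℙ.real {ω | τ ω ∈ A ∧ (U (τ ω) + W ω : ℤ) ≤ y} =
      (1 - q) * ℙ.real {ω | τ ω ∈ A ∧ (U (τ ω) : ℤ) ≤ y} +
        q * ℙ.real {ω | τ ω ∈ A ∧ (U (τ ω) + W ω : ℤ) ≤ y - 1} := by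
  have hsum : ∀ y : ℤ, HasSum (fun l : ℕ => (1 - q) * q ^ l *
      ℙ.real {ω | τ ω ∈ A ∧ (U (τ ω) : ℤ) ≤ y - l})
      (ℙ.real {ω | τ ω ∈ A ∧ (U (τ ω) + W ω : ℤ) ≤ y}) := by
    intro y
    have hmB : ∀ B : Set T, MeasurableSet (τ ⁻¹' B) := fun B =>
      hτ B.to_countable.measurableSet
    have hset : {ω | τ ω ∈ A ∧ (U (τ ω) + W ω : ℤ) ≤ y} =
        ⋃ l : ℕ, (τ ⁻¹' {t | t ∈ A ∧ (U t : ℤ) ≤ y - l} ∩ W ⁻¹' {l}) := by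
      ext ω
      simp only [Set.mem_ofPred_eq, Set.mem_iUnion, Set.mem_inter_iff, Set.mem_preimage,
        Set.mem_singleton_iff]
      constructor
      · rintro ⟨h1, h2⟩; exact ⟨W ω, ⟨h1, by omega⟩, rfl⟩
      · rintro ⟨l, ⟨h1, h2⟩, rfl⟩; exact ⟨h1, by omega⟩
    have hterm : ∀ l : ℕ, ℙ (τ ⁻¹' {t | t ∈ A ∧ (U t : ℤ) ≤ y - l} ∩ W ⁻¹' {l}) =
        ENNReal.ofReal ((1 - q) * q ^ l * ℙ.real {ω | τ ω ∈ A ∧ (U (τ ω) : ℤ) ≤ y - l}) := by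
      intro l
      rw [hind.measure_inter_preimage_eq_mul _ _ (Set.to_countable _).measurableSet
        (measurableSet_singleton l)]
      have h1 : ℙ (W ⁻¹' {l}) = ENNReal.ofReal ((1 - q) * q ^ l) := hgeom l
      rw [h1, mul_comm, ENNReal.ofReal_mul
        (mul_nonneg (by linarith) (pow_nonneg hq0.le _)), ofReal_measureReal]
      rfl
    have hnn : ∀ l : ℕ, 0 ≤ (1 - q) * q ^ l * ℙ.real {ω | τ ω ∈ A ∧ (U (τ ω) : ℤ) ≤ y - l} :=
      fun l => mul_nonneg (mul_nonneg (by linarith) (pow_nonneg hq0.le _)) measureReal_nonneg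
    have hmeas : ℙ {ω | τ ω ∈ A ∧ (U (τ ω) + W ω : ℤ) ≤ y} =
        ∑' l : ℕ, ENNReal.ofReal
          ((1 - q) * q ^ l * ℙ.real {ω | τ ω ∈ A ∧ (U (τ ω) : ℤ) ≤ y - l}) := by
      rw [hset, measure_iUnion]
      · exact tsum_congr hterm
      · intro a b hab
        refine Set.disjoint_left.mpr fun ω h1 h2 => hab ?_
        exact h1.2.symm.trans h2.2
      · exact fun l => (hmB _).inter (hW (measurableSet_singleton l))
    have hs : Summable fun l : ℕ =>
        (1 - q) * q ^ l * ℙ.real {ω | τ ω ∈ A ∧ (U (τ ω) : ℤ) ≤ y - l} := by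
      refine Summable.of_nonneg_of_le hnn (fun l => ?_)
        ((summable_geometric_of_lt_one hq0.le hq1).mul_left (1 - q))
      exact mul_le_of_le_one_right (mul_nonneg (by linarith) (pow_nonneg hq0.le _))
        measureReal_le_one
    rw [hs.hasSum_iff, Measure.real, hmeas, ← ENNReal.ofReal_tsum_of_nonneg hnn hs,
      ENNReal.toReal_ofReal (tsum_nonneg hnn)]
  have h1 := hsum y
  rw [← hasSum_nat_add_iff' 1] at h1
  have h2 := (hsum (y - 1)).mul_left q
  have he : (fun n : ℕ => (1 - q) * q ^ (n + 1) *
      ℙ.real {ω | τ ω ∈ A ∧ (U (τ ω) : ℤ) ≤ y - ((n + 1 : ℕ) : ℤ)}) =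
      fun n : ℕ => q * ((1 - q) * q ^ n *
        ℙ.real {ω | τ ω ∈ A ∧ (U (τ ω) : ℤ) ≤ y - 1 - (n : ℤ)}) := by
    funext l
    have : y - ((l + 1 : ℕ) : ℤ) = y - 1 - l := by push_cast; ring
    rw [this]
    ring
  rw [he] at h1
  have h3 := h1.unique h2
  simp only [Finset.range_one, Finset.sum_singleton, pow_zero, mul_one, Nat.cast_zero,
    sub_zero] at h3
  linarith

/-- Coefficient of a power series at an integer index, zero at negative indices. -/
noncomputable def coefZ (P : PowerSeries ℝ) (k : ℤ) : ℝ :=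
  if 0 ≤ k then PowerSeries.coeff k.toNat P else 0

theorem coefZ_of_neg (P : PowerSeries ℝ) {k : ℤ} (hk : k < 0) : coefZ P k = 0 := by
  simp [coefZ, not_le.mpr hk]

theorem coefZ_natCast (P : PowerSeries ℝ) (k : ℕ) : coefZ P k = PowerSeries.coeff k P := by
  simp [coefZ]

theorem coefZ_C_mul (c : ℝ) (P : PowerSeries ℝ) (k : ℤ) :
    coefZ (PowerSeries.C c * P) k = c * coefZ P k := by
  unfold coefZ
  split_ifs <;> simp

theorem coefZ_sub (P Q : PowerSeries ℝ) (k : ℤ) : coefZ (P - Q) k = coefZ P k - coefZ Q k := by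
  unfold coefZ
  split_ifs <;> simp

theorem coefZ_X_mul (P : PowerSeries ℝ) (k : ℤ) :
    coefZ (PowerSeries.X * P) k = coefZ P (k - 1) := by
  rcases lt_or_ge k 0 with hk | hk
  · rw [coefZ_of_neg _ hk, coefZ_of_neg _ (by omega)]
  · lift k to ℕ using hk
    rw [coefZ_natCast]
    cases k with
    | zero => rw [coefZ_of_neg _ (by norm_num)]; simp
    | succ k =>
      rw [PowerSeries.coeff_succ_X_mul, show (((k + 1 : ℕ) : ℤ) - 1) = (k : ℕ) by push_cast; ring,
        coefZ_natCast]

theorem coefZ_one_sub_mul (c : ℝ) (P : PowerSeries ℝ) (k : ℤ) :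
    coefZ ((1 - PowerSeries.C c * PowerSeries.X) * P) k = coefZ P k - c * coefZ P (k - 1) := by
  rw [sub_mul, one_mul, coefZ_sub, mul_assoc, coefZ_C_mul, coefZ_X_mul]

/-- The geometric series `1 / (1 - c X)`. -/
noncomputable def geomS (c : ℝ) : PowerSeries ℝ := PowerSeries.mk fun n => c ^ n

theorem one_sub_mul_geomS (c : ℝ) :
    (1 - PowerSeries.C c * PowerSeries.X) * geomS c = 1 := by
  ext n
  cases n with
  | zero => simp [geomS, sub_mul]
  | succ n =>
    rw [sub_mul, one_mul, map_sub, mul_assoc, PowerSeries.coeff_C_mul,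
      PowerSeries.coeff_succ_X_mul]
    simp [geomS, PowerSeries.coeff_one, pow_succ']

/-- Generating series of the entries of the determinant for the joint distribution function. -/
noncomputable def colS (q : ℝ) (m i j : ℕ) : PowerSeries ℝ :=
  (PowerSeries.C (1 - q) * geomS q) ^ m * (1 - PowerSeries.C 1 * PowerSeries.X) ^ j *
    geomS 1 ^ (i + 1)

/-- Entries of the determinant for the joint distribution function of last-passage times. -/
noncomputable def cdfEntry (q : ℝ) (m i j : ℕ) (x : ℤ) : ℝ := coefZ (colS q m i j) (x + j - i)

theorem cdfEntry_sub_shift (q : ℝ) (m i j : ℕ) (x : ℤ) :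
    cdfEntry q m i j x - cdfEntry q m i j (x - 1) = cdfEntry q m i (j + 1) (x - 1) := by
  have h : colS q m i (j + 1) = (1 - PowerSeries.C 1 * PowerSeries.X) * colS q m i j := by
    unfold colS; ring
  unfold cdfEntry
  rw [h, coefZ_one_sub_mul]
  push_cast
  ring_nf

theorem cdfEntry_succ (q : ℝ) (m i j : ℕ) (x : ℤ) :
    cdfEntry q (m + 1) i j x =
      (1 - q) * cdfEntry q m i j x + q * cdfEntry q (m + 1) i j (x - 1) := by
  have h : (1 - PowerSeries.C q * PowerSeries.X) * colS q (m + 1) i j =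
      PowerSeries.C (1 - q) * colS q m i j := by
    unfold colS
    linear_combination (PowerSeries.C (1 - q) * (PowerSeries.C (1 - q) * geomS q) ^ m *
      (1 - PowerSeries.C 1 * PowerSeries.X) ^ j * geomS 1 ^ (i + 1)) * one_sub_mul_geomS q
  have h2 := congrArg (fun P => coefZ P (x + j - i)) h
  simp only [coefZ_one_sub_mul, coefZ_C_mul] at h2
  unfold cdfEntry
  rw [show x - 1 + (j : ℤ) - i = x + j - i - 1 by ring]
  linarith

theorem cdfEntry_of_neg (q : ℝ) (m i : ℕ) {x : ℤ} (hx : x < 0) : cdfEntry q m i 0 x = 0 :=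
  coefZ_of_neg _ (by push_cast; omega)

theorem cdfEntry_zero_of_lt (q : ℝ) {i j : ℕ} (hij : i < j) {x : ℤ} (hx : 0 ≤ x) :
    cdfEntry q 0 i j x = 0 := by
  have h : colS q 0 i j =
      ((1 - Polynomial.X : Polynomial ℝ) ^ (j - i - 1) : Polynomial ℝ) := by
    obtain ⟨d, rfl⟩ := Nat.exists_eq_add_of_lt hij
    have := one_sub_mul_geomS 1
    have h2 : ((1 - Polynomial.X : Polynomial ℝ) : PowerSeries ℝ) =
      1 - PowerSeries.C 1 * PowerSeries.X := by simp
    rw [Polynomial.coe_pow, h2, show i + d + 1 - i - 1 = d by omega]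
    unfold colS
    rw [pow_zero, one_mul, show i + d + 1 = d + (i + 1) by ring, pow_add, mul_assoc, ← mul_pow,
      this, one_pow, mul_one]
  unfold cdfEntry
  lift x to ℕ using hx
  rw [h, show (x : ℤ) + j - i = ((x + (j - i) : ℕ) : ℤ) by omega, coefZ_natCast,
    Polynomial.coeff_coe]
  refine Polynomial.coeff_eq_zero_of_natDegree_lt ?_
  have : ((1 - Polynomial.X : Polynomial ℝ) ^ (j - i - 1)).natDegree ≤ (j - i - 1) * 1 :=
    Polynomial.natDegree_pow_le_of_le _ (by
      refine (Polynomial.natDegree_sub_le _ _).trans ?_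
      simp)
  omega

theorem cdfEntry_zero_self (q : ℝ) (i : ℕ) {x : ℤ} (hx : 0 ≤ x) : cdfEntry q 0 i i x = 1 := by
  have h : colS q 0 i i = geomS 1 := by
    unfold colS
    rw [pow_zero, one_mul, pow_succ, ← mul_assoc, ← mul_pow, one_sub_mul_geomS, one_pow, one_mul]
  unfold cdfEntry
  lift x to ℕ using hx
  rw [h, show (x : ℤ) + i - i = (x : ℕ) by ring, coefZ_natCast]
  simp [geomS]

/-- Row state of the growth process: the first `k` sites of row `m + 1` have been filled. -/
def rowState (w : ℕ × ℕ → ℕ) (m k j : ℕ) : ℕ :=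
  if j < k then lppRec w (m + 1) (j + 1) else lppRec w m (j + 1)

/-- The determinant giving the joint distribution function of `rowState`. -/
noncomputable def cdfDet (q : ℝ) (N m k : ℕ) (y : ℕ → ℤ) : ℝ :=
  Matrix.det (Matrix.of fun i j : Fin N =>
    cdfEntry q (if (j : ℕ) < k then m + 1 else m) i j (y j))

theorem cdfDet_of_neg (q : ℝ) {N : ℕ} (hN : 0 < N) (m k : ℕ) {y : ℕ → ℤ} (hy : y 0 < 0) :
    cdfDet q N m k y = 0 :=
  Matrix.det_eq_zero_of_column_eq_zero ⟨0, hN⟩ fun _ => cdfEntry_of_neg q _ _ hy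

theorem cdfDet_zero (q : ℝ) (N : ℕ) {y : ℕ → ℤ} (hy : ∀ j, 0 ≤ y j) : cdfDet q N 0 0 y = 1 := by
  unfold cdfDet
  rw [Matrix.det_of_isLowerTriangular]
  · simp [cdfEntry_zero_self q _ (hy _)]
  · intro i j hij
    have : (i : ℕ) < j := by simpa using hij
    simp [cdfEntry_zero_of_lt q this (hy _)]

theorem cdfDet_update_shift (q : ℝ) {N : ℕ} (m k l : ℕ) (hl : l < k) (hk : k < N) (y : ℕ → ℤ)
    (hyl : y l - 1 = y (l + 1)) :
    cdfDet q N m (k + 1) (Function.update y l (y l - 1)) = cdfDet q N m (k + 1) y := by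
  have hlN : l < N := by omega
  set M : Matrix (Fin N) (Fin N) ℝ := Matrix.of fun i j : Fin N =>
    cdfEntry q (if (j : ℕ) < k + 1 then m + 1 else m) i j (y j) with hM
  have h1 : M = M.updateCol ⟨l, hlN⟩ ((fun i : Fin N => cdfEntry q (m + 1) i l (y l - 1)) +
      fun i : Fin N => cdfEntry q (m + 1) i (l + 1) (y l - 1)) := by
    ext i j
    by_cases hj : j = ⟨l, hlN⟩
    · subst hj
      simp only [Matrix.updateCol_self, Pi.add_apply, hM, Matrix.of_apply,
        if_pos (show l < k + 1 by omega)]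
      linarith [cdfEntry_sub_shift q (m + 1) i l (y l)]
    · rw [Matrix.updateCol_ne hj]
  have h2 : (M.updateCol ⟨l, hlN⟩
      (fun i : Fin N => cdfEntry q (m + 1) i (l + 1) (y l - 1))).det = 0 := by
    refine Matrix.det_zero_of_column_eq (i := ⟨l, hlN⟩) (j := ⟨l + 1, by omega⟩)
      (by simp [Fin.ext_iff]) fun i => ?_
    rw [Matrix.updateCol_self, Matrix.updateCol_ne (by simp [Fin.ext_iff])]
    simp [hM, hl, hyl]
  have h3 : cdfDet q N m (k + 1) y = M.det := rfl
  rw [h3, h1, Matrix.det_updateCol_add, h2, add_zero]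
  unfold cdfDet
  congr 1
  ext i j
  by_cases hj : j = ⟨l, hlN⟩
  · subst hj
    simp [hl.le]
  · rw [Matrix.updateCol_ne hj, Matrix.of_apply, Function.update_of_ne (by
      intro h; exact hj (Fin.ext h))]
    rfl

/-- Cap the coordinates between `l` and `k` at `y k - 1`. -/
def capAt (y : ℕ → ℤ) (l k : ℕ) : ℕ → ℤ :=
  fun j => if l ≤ j ∧ j ≤ k then min (y j) (y k - 1) else y j

theorem cdfDet_capAt (q : ℝ) {N : ℕ} (m k : ℕ) (hk : k < N) {y : ℕ → ℤ} (hy : Monotone y) :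
    cdfDet q N m (k + 1) (capAt y 0 k) =
      cdfDet q N m (k + 1) (Function.update y k (y k - 1)) := by
  have h0 : capAt y k k = Function.update y k (y k - 1) := by
    funext j
    by_cases hj : j = k
    · subst hj; simp [capAt]
    · rw [Function.update_of_ne hj, capAt, if_neg (by omega)]
  rw [← h0]
  have key : ∀ t ≤ k, cdfDet q N m (k + 1) (capAt y (k - t) k) =
      cdfDet q N m (k + 1) (capAt y k k) := by
    intro t ht
    induction t with
    | zero => rfl
    | succ t ih =>
      rw [← ih (by omega)]
      set l := k - (t + 1) with hl
      have hl1 : k - t = l + 1 := by omega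
      rw [hl1]
      have hlk : y l ≤ y k := hy (by omega)
      rcases lt_or_eq_of_le hlk with h | h
      · congr 1
        funext j
        simp only [capAt]
        by_cases hj : j = l
        · subst hj
          rw [if_pos (by omega), if_neg (by omega), min_eq_left (by omega)]
        · congr 1
          simp only [eq_iff_iff]
          omega
      · have e1 : capAt y (l + 1) k l = y k := by
          simp [capAt, h]
        have e2 : capAt y (l + 1) k (l + 1) = y k - 1 := by
          have : y l ≤ y (l + 1) := hy (by omega)
          simp only [capAt]
          rw [if_pos (by omega), min_eq_right (by omega)]
        rw [← cdfDet_update_shift q m k l (by omega) hk (capAt y (l + 1) k) (by rw [e1, e2])]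
        congr 1
        funext j
        by_cases hj : j = l
        · subst hj
          rw [Function.update_self, e1, capAt, if_pos (by omega), h, min_eq_right (by omega)]
        · rw [Function.update_of_ne hj]
          simp only [capAt]
          congr 1
          simp only [eq_iff_iff]
          omega
  simpa using key k le_rfl

theorem cdfDet_succ (q : ℝ) {N : ℕ} (m k : ℕ) (hk : k < N) (y : ℕ → ℤ) :
    cdfDet q N m (k + 1) y = (1 - q) * cdfDet q N m k y +
      q * cdfDet q N m (k + 1) (Function.update y k (y k - 1)) := by
  set M : Matrix (Fin N) (Fin N) ℝ := Matrix.of fun i j : Fin N =>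
    cdfEntry q (if (j : ℕ) < k + 1 then m + 1 else m) i j (y j) with hM
  have e1 : cdfDet q N m (k + 1) y = (M.updateCol ⟨k, hk⟩
      ((1 - q) • (fun i : Fin N => cdfEntry q m i k (y k)) +
        q • fun i : Fin N => cdfEntry q (m + 1) i k (y k - 1))).det := by
    unfold cdfDet
    congr 1
    ext i j
    by_cases hj : j = ⟨k, hk⟩
    · subst hj
      simp [cdfEntry_succ q m i k (y k)]
    · rw [Matrix.updateCol_ne hj]
  rw [e1, Matrix.det_updateCol_add, Matrix.det_updateCol_smul, Matrix.det_updateCol_smul]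
  congr 2
  · unfold cdfDet
    congr 1
    ext i j
    by_cases hj : j = ⟨k, hk⟩
    · subst hj
      simp
    · have : (j : ℕ) ≠ k := fun h => hj (Fin.ext h)
      rw [Matrix.updateCol_ne hj]
      simp only [hM, Matrix.of_apply]
      congr 2
      simp only [eq_iff_iff]; omega
  · unfold cdfDet
    congr 1
    ext i j
    by_cases hj : j = ⟨k, hk⟩
    · subst hj
      simp
    · have : (j : ℕ) ≠ k := fun h => hj (Fin.ext h)
      rw [Matrix.updateCol_ne hj]
      simp [hM, Function.update_of_ne this]

theorem capAt_monotone {y : ℕ → ℤ} (hy : Monotone y) (k : ℕ) : Monotone (capAt y 0 k) := by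
  intro a b hab
  have h1 := hy hab
  simp only [capAt]
  split_ifs with h2 h3
  · exact min_le_min_right _ h1
  · exact (min_le_left _ _).trans h1
  · omega
  · exact h1

section

variable {Ω : Type*} [MeasurableSpace Ω] {ℙ : Measure Ω} [IsProbabilityMeasure ℙ] {q : ℝ}
  {w : ℕ × ℕ → Ω → ℕ}

theorem measureReal_rowState_succ (hq0 : 0 < q) (hq1 : q < 1) (hmeas : ∀ p, Measurable (w p))
    (hindep : ProbabilityTheory.iIndepFun w ℙ)
    (hgeom : ∀ p k, ℙ {ω | w p ω = k} = ENNReal.ofReal ((1 - q) * q ^ k))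
    {N m k : ℕ} (hk : k < N) {y : ℕ → ℤ} (hy : Monotone y) (hyk : 0 ≤ y k) :
    ℙ.real {ω | ∀ j < N, (rowState (fun p => w p ω) m (k + 1) j : ℤ) ≤ y j} =
      (1 - q) * ℙ.real {ω | ∀ j < N, (rowState (fun p => w p ω) m k j : ℤ) ≤ y j} +
      q * ℙ.real {ω | ∀ j < N, (rowState (fun p => w p ω) m (k + 1) j : ℤ) ≤
        Function.update y k (y k - 1) j} := by
  classical
  set S : Finset (ℕ × ℕ) :=
    (Finset.range (m + 2) ×ˢ Finset.range (N + 1)).erase (m + 1, k + 1) with hS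
  let ext0 : (S → ℕ) → ℕ × ℕ → ℕ := fun t p => if h : p ∈ S then t ⟨p, h⟩ else 0
  let τ : Ω → (S → ℕ) := fun ω p => w p ω
  have hτ : Measurable τ := measurable_pi_lambda _ fun p => hmeas p
  have hind : ProbabilityTheory.IndepFun τ (w (m + 1, k + 1)) ℙ := by
    have h := hindep.indepFun_finset S {(m + 1, k + 1)}
      (Finset.disjoint_singleton_right.mpr (Finset.notMem_erase _ _)) hmeas
    exact h.comp (φ := id) (ψ := fun t : (({(m + 1, k + 1)} : Finset (ℕ × ℕ)) → ℕ) =>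
      t ⟨(m + 1, k + 1), Finset.mem_singleton_self _⟩) measurable_id (measurable_pi_apply _)
  have hagree : ∀ ω a b, a ≤ m + 1 → b ≤ N → (a, b) ≠ (m + 1, k + 1) →
      ext0 (τ ω) (a, b) = w (a, b) ω := by
    intro ω a b ha hb hab
    have : (a, b) ∈ S := by
      simp only [hS, Finset.mem_erase, Finset.mem_product, Finset.mem_range]
      exact ⟨hab, by omega, by omega⟩
    simp [ext0, τ, this]
  have h1 : ∀ ω j, j < N → lppRec (ext0 (τ ω)) m (j + 1) = lppRec (fun p => w p ω) m (j + 1) :=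
    fun ω j hj => lppRec_congr _ _ fun a b ha hb => hagree ω a b (by omega) (by omega)
      (by simp only [ne_eq, Prod.mk.injEq]; omega)
  have h2 : ∀ ω j, j ≤ k → lppRec (ext0 (τ ω)) (m + 1) j = lppRec (fun p => w p ω) (m + 1) j :=
    fun ω j hj => lppRec_congr _ _ fun a b ha hb => hagree ω a b (by omega) (by omega)
      (by simp only [ne_eq, Prod.mk.injEq]; omega)
  have hrow : ∀ ω j, j < N → j ≠ k →
      rowState (ext0 (τ ω)) m (k + 1) j = rowState (fun p => w p ω) m (k + 1) j := by
    intro ω j hj hjk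
    unfold rowState
    split_ifs with h
    · exact h2 ω _ (by omega)
    · exact h1 ω j hj
  let A : Set (S → ℕ) := {t | ∀ j < N, j ≠ k → (rowState (ext0 t) m (k + 1) j : ℤ) ≤ y j}
  let U : (S → ℕ) → ℕ := fun t => max (lppRec (ext0 t) m (k + 1)) (lppRec (ext0 t) (m + 1) k)
  have hA : ∀ ω, τ ω ∈ A ↔
      ∀ j < N, j ≠ k → (rowState (fun p => w p ω) m (k + 1) j : ℤ) ≤ y j := by
    intro ω
    refine forall_congr' fun j => forall_congr' fun hj => forall_congr' fun hjk => ?_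
    rw [hrow ω j hj hjk]
  have hU : ∀ ω, U (τ ω) = max (lppRec (fun p => w p ω) m (k + 1))
      (lppRec (fun p => w p ω) (m + 1) k) := by
    intro ω
    simp only [U]
    rw [h1 ω k hk, h2 ω k le_rfl]
  have hsucc : ∀ ω, (rowState (fun p => w p ω) m (k + 1) k) = U (τ ω) + w (m + 1, k + 1) ω := by
    intro ω
    rw [hU, rowState, if_pos (Nat.lt_succ_self k), lppRec]
  have key := measureReal_add_geom_le hq0 hq1 hτ (hmeas _) hind (hgeom _) A U (y k)
  have s1 : ∀ z : ℤ, {ω | τ ω ∈ A ∧ (U (τ ω) + w (m + 1, k + 1) ω : ℤ) ≤ z} =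
      {ω | ∀ j < N, (rowState (fun p => w p ω) m (k + 1) j : ℤ) ≤ Function.update y k z j} := by
    intro z
    ext ω
    simp only [Set.mem_ofPred_eq, hA]
    constructor
    · rintro ⟨ha, hb⟩ j hj
      by_cases hjk : j = k
      · subst hjk
        rw [Function.update_self, hsucc]
        exact_mod_cast hb
      · rw [Function.update_of_ne hjk]
        exact ha j hj hjk
    · intro h
      refine ⟨fun j hj hjk => ?_, ?_⟩
      · have := h j hj
        rwa [Function.update_of_ne hjk] at this
      · have := h k hk
        rw [Function.update_self, hsucc] at this
        exact_mod_cast this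
  have s2 : {ω | τ ω ∈ A ∧ (U (τ ω) : ℤ) ≤ y k} =
      {ω | ∀ j < N, (rowState (fun p => w p ω) m k j : ℤ) ≤ y j} := by
    ext ω
    simp only [Set.mem_ofPred_eq, hA, hU]
    push_cast
    rw [max_le_iff]
    have hne : ∀ j, j ≠ k → rowState (fun p => w p ω) m (k + 1) j =
        rowState (fun p => w p ω) m k j := by
      intro j hj
      unfold rowState
      congr 1
      simp only [eq_iff_iff]; omega
    constructor
    · rintro ⟨ha, hb, hc⟩ j hj
      by_cases hjk : j = k
      · subst hjk; simpa [rowState] using hb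
      · rw [← hne j hjk]; exact ha j hj hjk
    · intro h
      refine ⟨fun j hj hjk => by rw [hne j hjk]; exact h j hj, ?_, ?_⟩
      · simpa [rowState] using h k hk
      · cases k with
        | zero => simpa [lppRec_zero_right] using hyk
        | succ k =>
          have := h k (by omega)
          rw [rowState, if_pos (Nat.lt_succ_self k)] at this
          exact this.trans (hy (Nat.le_succ k))
  rw [s1, s1, s2, Function.update_eq_self] at key
  exact key

theorem rowState_le_capAt_iff (v : ℕ × ℕ → ℕ) {N m k : ℕ} (hk : k < N) (y : ℕ → ℤ) :
    (∀ j < N, (rowState v m (k + 1) j : ℤ) ≤ Function.update y k (y k - 1) j) ↔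
      ∀ j < N, (rowState v m (k + 1) j : ℤ) ≤ capAt y 0 k j := by
  constructor
  · intro h j hj
    have hjj := h j hj
    by_cases hjk : j ≤ k
    · have hkk := h k hk
      rw [Function.update_self] at hkk
      rw [capAt, if_pos ⟨Nat.zero_le _, hjk⟩, le_min_iff]
      have hmono : rowState v m (k + 1) j ≤ rowState v m (k + 1) k := by
        simp only [rowState, if_pos (show j < k + 1 by omega), if_pos (Nat.lt_succ_self k)]
        exact lppRec_mono_right v (m + 1) (by omega)
      have hle : (rowState v m (k + 1) j : ℤ) ≤ y k - 1 :=
        le_trans (by exact_mod_cast hmono) hkk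
      refine ⟨?_, hle⟩
      by_cases e : j = k
      · subst e; omega
      · rwa [Function.update_of_ne e] at hjj
    · rw [capAt, if_neg (by omega)]
      rwa [Function.update_of_ne (by omega)] at hjj
  · intro h j hj
    refine (h j hj).trans ?_
    by_cases e : j = k
    · subst e
      simp [capAt]
    · rw [Function.update_of_ne e]
      unfold capAt
      split_ifs
      · exact min_le_left _ _
      · exact le_rfl

/-- The joint distribution function of the last-passage times is a determinant. -/
theorem measureReal_rowState_le (hq0 : 0 < q) (hq1 : q < 1) (hmeas : ∀ p, Measurable (w p))
    (hindep : ProbabilityTheory.iIndepFun w ℙ)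
    (hgeom : ∀ p k, ℙ {ω | w p ω = k} = ENNReal.ofReal ((1 - q) * q ^ k))
    {N : ℕ} (hN : 0 < N) (m k : ℕ) (hkN : k ≤ N) (y : ℕ → ℤ) (hy : Monotone y) :
    ℙ.real {ω | ∀ j < N, (rowState (fun p => w p ω) m k j : ℤ) ≤ y j} = cdfDet q N m k y := by
  have hneg : ∀ m k (y : ℕ → ℤ), y 0 < 0 →
      ℙ.real {ω | ∀ j < N, (rowState (fun p => w p ω) m k j : ℤ) ≤ y j} = cdfDet q N m k y := by
    intro m k y h0
    rw [cdfDet_of_neg q hN m k h0]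
    convert measureReal_empty (μ := ℙ)
    refine Set.eq_empty_of_forall_notMem fun ω hω => ?_
    have := hω 0 hN
    omega
  have hstep : ∀ m k, k < N →
      (∀ y : ℕ → ℤ, Monotone y → ℙ.real {ω | ∀ j < N,
        (rowState (fun p => w p ω) m k j : ℤ) ≤ y j} = cdfDet q N m k y) →
      ∀ y : ℕ → ℤ, Monotone y → ℙ.real {ω | ∀ j < N,
        (rowState (fun p => w p ω) m (k + 1) j : ℤ) ≤ y j} = cdfDet q N m (k + 1) y := by
    intro m k hk ih
    have hn : ∀ (n : ℕ) (y : ℕ → ℤ), Monotone y → y k < n → ℙ.real {ω | ∀ j < N,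
        (rowState (fun p => w p ω) m (k + 1) j : ℤ) ≤ y j} = cdfDet q N m (k + 1) y := by
      intro n
      induction n with
      | zero => exact fun y hy h => hneg _ _ _ ((hy (Nat.zero_le k)).trans_lt h)
      | succ n ihn =>
        intro y hy h
        rcases lt_or_ge (y k) 0 with h0 | h0
        · exact hneg _ _ _ ((hy (Nat.zero_le k)).trans_lt h0)
        rw [measureReal_rowState_succ hq0 hq1 hmeas hindep hgeom hk hy h0, ih y hy,
          cdfDet_succ q m k hk y, ← cdfDet_capAt q m k hk hy]
        simp only [rowState_le_capAt_iff _ hk y]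
        rw [ihn _ (capAt_monotone hy k) (by simp [capAt]; omega)]
    exact fun y hy => hn (y k + 1).toNat y hy (by omega)
  have hall : ∀ m, (∀ y : ℕ → ℤ, Monotone y → ℙ.real {ω | ∀ j < N,
        (rowState (fun p => w p ω) m 0 j : ℤ) ≤ y j} = cdfDet q N m 0 y) →
      ∀ k ≤ N, ∀ y : ℕ → ℤ, Monotone y → ℙ.real {ω | ∀ j < N,
        (rowState (fun p => w p ω) m k j : ℤ) ≤ y j} = cdfDet q N m k y := by
    intro m h0 k
    induction k with
    | zero => exact fun _ => h0
    | succ k ih => exact fun hk => hstep m k hk (ih (by omega))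
  have hrow : ∀ m (y : ℕ → ℤ), Monotone y → ℙ.real {ω | ∀ j < N,
      (rowState (fun p => w p ω) m 0 j : ℤ) ≤ y j} = cdfDet q N m 0 y := by
    intro m
    induction m with
    | zero =>
      intro y hy
      rcases lt_or_ge (y 0) 0 with h0 | h0
      · exact hneg _ _ _ h0
      have hy0 : ∀ j, 0 ≤ y j := fun j => h0.trans (hy (Nat.zero_le j))
      rw [cdfDet_zero q N hy0]
      simp [rowState, lppRec, hy0]
    | succ m ihm =>
      intro y hy
      have h := hall m ihm N le_rfl y hy
      have e : cdfDet q N m N y = cdfDet q N (m + 1) 0 y := by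
        simp [cdfDet]
      rw [← e, ← h]
      congr 1
      ext ω
      refine forall_congr' fun j => forall_congr' fun hj => ?_
      simp [rowState, hj]
  exact hall m (hrow m) k hkN y hy

end

/-- The distribution function of the last-passage time is a determinant. -/
theorem measureReal_lppSup_le {Ω : Type*} [MeasurableSpace Ω] {ℙ : Measure Ω}
    [IsProbabilityMeasure ℙ] {q : ℝ} {w : ℕ × ℕ → Ω → ℕ}
    (hq0 : 0 < q) (hq1 : q < 1) (hmeas : ∀ p, Measurable (w p))
    (hindep : ProbabilityTheory.iIndepFun w ℙ)
    (hgeom : ∀ p k, ℙ {ω | w p ω = k} = ENNReal.ofReal ((1 - q) * q ^ k))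
    {M N : ℕ} (hM : 0 < M) (hN : 0 < N) (n : ℤ) :
    ℙ.real {ω | (lppSup (fun p => w p ω) M N : ℤ) ≤ n} =
      Matrix.det (Matrix.of fun i j : Fin N => cdfEntry q M i j n) := by
  have h := measureReal_rowState_le hq0 hq1 hmeas hindep hgeom hN M 0 (Nat.zero_le N)
    (fun _ => n) monotone_const
  have e : cdfDet q N M 0 (fun _ => n) =
      Matrix.det (Matrix.of fun i j : Fin N => cdfEntry q M i j n) := by
    simp [cdfDet]
  rw [← e, ← h]
  congr 1
  ext ω
  simp only [Set.mem_ofPred_eq, lppSup_eq_lppRec (fun p => w p ω) hM hN, rowState, not_lt_zero,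
    if_false]
  constructor
  · intro h j hj
    have : lppRec (fun p => w p ω) M (j + 1) ≤ lppRec (fun p => w p ω) M N :=
      lppRec_mono_right _ _ (by omega)
    exact le_trans (by exact_mod_cast this) h
  · intro h
    have := h (N - 1) (by omega)
    rwa [Nat.sub_add_cancel hN] at this

/-- The polynomials biorthogonal to `phiFun`. -/
noncomputable def polP (q : ℝ) (M i x : ℕ) : ℝ :=
  (-1) ^ i * PowerSeries.coeff i
    ((1 + PowerSeries.X) ^ (x + i - 1) * (1 - PowerSeries.C (q / (1 - q)) * PowerSeries.X) ^ M)

/-- The functions biorthogonal to `polP`. -/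
noncomputable def phiFun (q : ℝ) (M j : ℕ) (x : ℤ) : ℝ :=
  coefZ ((PowerSeries.C (1 - q) * geomS q) ^ M * (1 - PowerSeries.C 1 * PowerSeries.X) ^ j) (x + j)

theorem polP_zero (q : ℝ) (M x : ℕ) : polP q M 0 x = 1 := by
  simp [polP]

theorem polP_succ (q : ℝ) (M i x : ℕ) :
    polP q M (i + 1) x = polP q M (i + 1) (x + 1) + polP q M i (x + 1) := by
  unfold polP
  set B := (1 - PowerSeries.C (q / (1 - q)) * PowerSeries.X : PowerSeries ℝ) ^ M
  have h : (1 + PowerSeries.X : PowerSeries ℝ) ^ (x + 1 + (i + 1) - 1) * B =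
      (1 + PowerSeries.X) ^ (x + i) * B + PowerSeries.X * ((1 + PowerSeries.X) ^ (x + i) * B) := by
    rw [show x + 1 + (i + 1) - 1 = x + i + 1 by omega]; ring
  rw [h, map_add, PowerSeries.coeff_succ_X_mul, show x + (i + 1) - 1 = x + i by omega,
    show x + 1 + i - 1 = x + i by omega]
  ring

theorem polP_succ_left {q : ℝ} (hq1 : q < 1) (M i x : ℕ) :
    (1 - q) * polP q (M + 1) i x = polP q M i x - q * polP q M i (x + 1) := by
  cases i with
  | zero => simp [polP_zero]
  | succ i =>
    have hq : 1 - q ≠ 0 := by linarith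
    have hc : PowerSeries.C (1 - q) * PowerSeries.C (q / (1 - q)) =
        (PowerSeries.C q : PowerSeries ℝ) := by
      rw [← map_mul, mul_div_cancel₀ _ hq]
    have hc' : (PowerSeries.C (1 - q) : PowerSeries ℝ) = 1 - PowerSeries.C q := by simp
    unfold polP
    set B := (1 - PowerSeries.C (q / (1 - q)) * PowerSeries.X : PowerSeries ℝ) with hB
    have h : PowerSeries.C (1 - q) * ((1 + PowerSeries.X) ^ (x + i) * B ^ (M + 1)) =
        (1 + PowerSeries.X) ^ (x + i) * B ^ M -
          PowerSeries.C q * ((1 + PowerSeries.X) ^ (x + 1 + i) * B ^ M) := by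
      have : PowerSeries.C (1 - q) * B = 1 - PowerSeries.C q * (1 + PowerSeries.X) := by
        rw [hB, mul_sub, ← mul_assoc, hc, hc']; ring
      linear_combination ((1 + PowerSeries.X) ^ (x + i) * B ^ M) * this
    have h2 := congrArg (PowerSeries.coeff (i + 1)) h
    rw [PowerSeries.coeff_C_mul, map_sub, PowerSeries.coeff_C_mul] at h2
    rw [show x + (i + 1) - 1 = x + i by omega, show x + 1 + (i + 1) - 1 = x + 1 + i by omega]
    linear_combination (-1) ^ (i + 1) * h2

theorem polP_zero_zero (q : ℝ) (i : ℕ) : polP q 0 (i + 1) 0 = 0 := by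
  have h : (1 + PowerSeries.X : PowerSeries ℝ) ^ i =
      ((1 + Polynomial.X : Polynomial ℝ) ^ i : Polynomial ℝ) := by simp
  unfold polP
  rw [pow_zero, mul_one, show 0 + (i + 1) - 1 = i by omega, h, Polynomial.coeff_coe,
    Polynomial.coeff_eq_zero_of_natDegree_lt, mul_zero]
  have : ((1 + Polynomial.X : Polynomial ℝ) ^ i).natDegree ≤ i * 1 :=
    Polynomial.natDegree_pow_le_of_le _ (by
      refine (Polynomial.natDegree_add_le _ _).trans ?_
      simp)
  omega

theorem cdfEntry_succ_sub (q : ℝ) (M l j : ℕ) (x : ℤ) :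
    cdfEntry q M (l + 1) j x - cdfEntry q M (l + 1) j (x - 1) = cdfEntry q M l j (x - 1) := by
  have h : (1 - PowerSeries.C 1 * PowerSeries.X) * colS q M (l + 1) j = colS q M l j := by
    unfold colS
    linear_combination ((PowerSeries.C (1 - q) * geomS q) ^ M *
      (1 - PowerSeries.C 1 * PowerSeries.X) ^ j * geomS 1 ^ (l + 1)) * one_sub_mul_geomS 1
  unfold cdfEntry
  rw [← h, coefZ_one_sub_mul]
  push_cast
  ring_nf

theorem cdfEntry_zero_sub (q : ℝ) (M j : ℕ) (x : ℤ) :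
    cdfEntry q M 0 j x - cdfEntry q M 0 j (x - 1) = phiFun q M j x := by
  have h : (1 - PowerSeries.C 1 * PowerSeries.X) * colS q M 0 j =
      (PowerSeries.C (1 - q) * geomS q) ^ M * (1 - PowerSeries.C 1 * PowerSeries.X) ^ j := by
    unfold colS
    linear_combination ((PowerSeries.C (1 - q) * geomS q) ^ M *
      (1 - PowerSeries.C 1 * PowerSeries.X) ^ j) * one_sub_mul_geomS 1
  unfold cdfEntry phiFun
  rw [← h, coefZ_one_sub_mul]
  push_cast
  ring_nf

theorem phiFun_succ (q : ℝ) (M j : ℕ) (x : ℤ) :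
    phiFun q M (j + 1) x = phiFun q M j (x + 1) - phiFun q M j x := by
  unfold phiFun
  have := coefZ_one_sub_mul 1 ((PowerSeries.C (1 - q) * geomS q) ^ M *
    (1 - PowerSeries.C 1 * PowerSeries.X) ^ j) (x + 1 + j)
  rw [show (1 - PowerSeries.C 1 * PowerSeries.X) * ((PowerSeries.C (1 - q) * geomS q) ^ M *
    (1 - PowerSeries.C 1 * PowerSeries.X) ^ j) = (PowerSeries.C (1 - q) * geomS q) ^ M *
    (1 - PowerSeries.C 1 * PowerSeries.X) ^ (j + 1) by ring] at this
  rw [show x + ((j + 1 : ℕ) : ℤ) = x + 1 + j by push_cast; ring, this]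
  ring_nf

/-- Summation by parts of `polP` against the distribution function entries. -/
theorem sum_polP_mul_cdfEntry_sub (q : ℝ) (M M' i j x : ℕ) (z : ℤ) :
    ∑ l ∈ Finset.range (i + 1), polP q M (i - l) (x + 1) * cdfEntry q M' l j z -
      ∑ l ∈ Finset.range (i + 1), polP q M (i - l) x * cdfEntry q M' l j (z - 1) =
    polP q M i (x + 1) * phiFun q M' j z := by
  rw [Finset.sum_range_succ' (fun l => polP q M (i - l) (x + 1) * cdfEntry q M' l j z),
    Finset.sum_range_succ (fun l => polP q M (i - l) x * cdfEntry q M' l j (z - 1))]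
  have h1 : ∀ l ∈ Finset.range i, polP q M (i - l) x * cdfEntry q M' l j (z - 1) =
      (polP q M (i - l) (x + 1) + polP q M (i - (l + 1)) (x + 1)) *
        cdfEntry q M' l j (z - 1) := by
    intro l hl
    rw [Finset.mem_range] at hl
    obtain ⟨d, rfl⟩ := Nat.exists_eq_add_of_lt hl
    rw [show l + d + 1 - l = d + 1 by omega, show l + d + 1 - (l + 1) = d by omega, polP_succ]
  have h2 : ∀ l ∈ Finset.range i, polP q M (i - (l + 1)) (x + 1) * cdfEntry q M' (l + 1) j z =
      polP q M (i - (l + 1)) (x + 1) * cdfEntry q M' (l + 1) j (z - 1) +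
      polP q M (i - (l + 1)) (x + 1) * cdfEntry q M' l j (z - 1) := by
    intro l _
    linear_combination polP q M (i - (l + 1)) (x + 1) * cdfEntry_succ_sub q M' l j z
  rw [Finset.sum_congr rfl h1, Finset.sum_congr rfl h2]
  simp only [add_mul, Finset.sum_add_distrib]
  have h3 := Finset.sum_range_succ' (fun l => polP q M (i - l) (x + 1) *
    cdfEntry q M' l j (z - 1)) i
  rw [Finset.sum_range_succ] at h3
  simp only [Nat.sub_self, polP_zero, one_mul, Nat.sub_zero] at h3 ⊢
  linear_combination polP q M i (x + 1) * cdfEntry_zero_sub q M' j z - h3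

/-- The Gram matrix of `polP` and `phiFun` over `(-∞, n]`. -/
noncomputable def gramE (q : ℝ) (M i j n : ℕ) : ℝ :=
  ∑ l ∈ Finset.range (i + 1), polP q M (i - l) n * cdfEntry q M l j n

theorem gramE_succ (q : ℝ) (M i j n : ℕ) :
    gramE q M i j (n + 1) = gramE q M i j n + polP q M i (n + 1) * phiFun q M j (n + 1 : ℕ) := by
  have := sum_polP_mul_cdfEntry_sub q M M i j n ((n + 1 : ℕ) : ℤ)
  rw [show ((n + 1 : ℕ) : ℤ) - 1 = n by push_cast; ring] at this
  unfold gramE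
  linarith

theorem gramE_succ_left {q : ℝ} (hq1 : q < 1) (M i j n : ℕ) :
    gramE q (M + 1) i j n =
      gramE q M i j n - q / (1 - q) * (polP q M i (n + 1) * phiFun q (M + 1) j n) := by
  have hq : 1 - q ≠ 0 := by linarith
  rw [← sum_polP_mul_cdfEntry_sub]
  unfold gramE
  have key : (1 - q) * ∑ l ∈ Finset.range (i + 1), polP q (M + 1) (i - l) n *
        cdfEntry q (M + 1) l j n =
      (1 - q) * ∑ l ∈ Finset.range (i + 1), polP q M (i - l) n * cdfEntry q M l j n -
      q * (∑ l ∈ Finset.range (i + 1), polP q M (i - l) (n + 1) * cdfEntry q (M + 1) l j n -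
        ∑ l ∈ Finset.range (i + 1), polP q M (i - l) n * cdfEntry q (M + 1) l j (n - 1)) := by
    simp only [Finset.mul_sum, ← Finset.sum_sub_distrib]
    refine Finset.sum_congr rfl fun l _ => ?_
    linear_combination cdfEntry q (M + 1) l j n * polP_succ_left hq1 M (i - l) n +
      polP q M (i - l) n * cdfEntry_succ q M l j n
  field_simp
  linarith

theorem gramE_zero_left (q : ℝ) (i j n : ℕ) : gramE q 0 i j n = if i = j then 1 else 0 := by
  induction n with
  | zero =>
    unfold gramE
    rw [Finset.sum_range_succ, Finset.sum_eq_zero]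
    · simp only [Nat.sub_self, polP_zero, one_mul, zero_add]
      split_ifs with h
      · rw [h]; exact cdfEntry_zero_self q j (by simp)
      · rcases lt_or_gt_of_ne h with h | h
        · exact cdfEntry_zero_of_lt q h (by simp)
        · exact coefZ_of_neg _ (by push_cast; omega)
    · intro l hl
      rw [Finset.mem_range] at hl
      rw [show i - l = i - l - 1 + 1 by omega, polP_zero_zero, zero_mul]
  | succ n ih =>
    have : phiFun q 0 j (n + 1 : ℕ) = 0 := by
      have h : ((PowerSeries.C (1 - q) * geomS q) ^ 0 *
          (1 - PowerSeries.C 1 * PowerSeries.X) ^ j : PowerSeries ℝ) =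
          ((1 - Polynomial.X : Polynomial ℝ) ^ j : Polynomial ℝ) := by simp
      unfold phiFun
      rw [h, show ((n + 1 : ℕ) : ℤ) + j = ((n + 1 + j : ℕ) : ℤ) by push_cast; ring, coefZ_natCast,
        Polynomial.coeff_coe]
      refine Polynomial.coeff_eq_zero_of_natDegree_lt ?_
      have : ((1 - Polynomial.X : Polynomial ℝ) ^ j).natDegree ≤ j * 1 :=
        Polynomial.natDegree_pow_le_of_le _ (by
          refine (Polynomial.natDegree_sub_le _ _).trans ?_
          simp)
      omega
    rw [gramE_succ, ih, this, mul_zero, add_zero]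

theorem exists_abs_coeff_geomS_mul_le {q r : ℝ} (hq0 : 0 < q) (hqr : q < r) {P : PowerSeries ℝ}
    (hP : ∃ C, ∀ n, |PowerSeries.coeff n P| ≤ C * r ^ n) :
    ∃ C, ∀ n, |PowerSeries.coeff n (geomS q * P)| ≤ C * r ^ n := by
  obtain ⟨C, hC⟩ := hP
  have hr : 0 < r := hq0.trans hqr
  have hd : 0 < r - q := by linarith
  have hC0 : 0 ≤ C := by simpa using (abs_nonneg _).trans (hC 0)
  refine ⟨C * (r / (r - q)), fun n => ?_⟩
  have hE : C * (r / (r - q)) * (r - q) = C * r := by field_simp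
  have hCE : C ≤ C * (r / (r - q)) :=
    le_mul_of_one_le_right hC0 ((one_le_div hd).mpr (by linarith))
  induction n with
  | zero =>
    have := hC 0
    simp [PowerSeries.coeff_mul, geomS] at this ⊢
    linarith
  | succ n ih =>
    have h : PowerSeries.coeff (n + 1) (geomS q * P) =
        q * PowerSeries.coeff n (geomS q * P) + PowerSeries.coeff (n + 1) P := by
      have h1 := congrArg (fun S => coefZ S ((n + 1 : ℕ) : ℤ))
        (show (1 - PowerSeries.C q * PowerSeries.X) * (geomS q * P) = P by
          rw [← mul_assoc, one_sub_mul_geomS, one_mul])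
      simp only [coefZ_one_sub_mul] at h1
      rw [show ((n + 1 : ℕ) : ℤ) - 1 = n by push_cast; ring] at h1
      simp only [coefZ_natCast] at h1
      linarith
    rw [h]
    calc _ ≤ |q * PowerSeries.coeff n (geomS q * P)| + |PowerSeries.coeff (n + 1) P| :=
          abs_add_le _ _
      _ ≤ q * (C * (r / (r - q)) * r ^ n) + C * r ^ (n + 1) := by
          rw [abs_mul, abs_of_pos hq0]
          gcongr
          exact hC _
      _ = C * (r / (r - q)) * r ^ (n + 1) := by
          linear_combination -(r ^ n) * hE

theorem exists_abs_coeff_one_sub_mul_le {r : ℝ} (hr : 0 < r) {P : PowerSeries ℝ}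
    (hP : ∃ C, ∀ n, |PowerSeries.coeff n P| ≤ C * r ^ n) :
    ∃ C, ∀ n, |PowerSeries.coeff n ((1 - PowerSeries.C 1 * PowerSeries.X) * P)| ≤ C * r ^ n := by
  obtain ⟨C, hC⟩ := hP
  have hC0 : 0 ≤ C := by simpa using (abs_nonneg _).trans (hC 0)
  refine ⟨C + C / r, fun n => ?_⟩
  rw [← coefZ_natCast, coefZ_one_sub_mul, one_mul]
  refine (abs_sub _ _).trans ?_
  rw [add_mul, coefZ_natCast]
  refine add_le_add (hC n) ?_
  cases n with
  | zero =>
    rw [coefZ_of_neg _ (by norm_num), abs_zero]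
    positivity
  | succ n =>
    rw [show ((n + 1 : ℕ) : ℤ) - 1 = n by push_cast; ring, coefZ_natCast]
    refine (hC n).trans_eq ?_
    rw [pow_succ, div_mul_eq_mul_div, ← mul_assoc, mul_div_cancel_right₀ _ hr.ne']

theorem exists_abs_phiFun_le {q r : ℝ} (hq0 : 0 < q) (hqr : q < r) (hr1 : r < 1) (M j : ℕ) :
    ∃ C, ∀ n : ℕ, |phiFun q M j n| ≤ C * r ^ n := by
  have hr : 0 < r := hq0.trans hqr
  have key : ∃ C, ∀ n, |PowerSeries.coeff n ((PowerSeries.C (1 - q) * geomS q) ^ M *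
      (1 - PowerSeries.C 1 * PowerSeries.X) ^ j)| ≤ C * r ^ n := by
    induction j with
    | zero =>
      induction M with
      | zero =>
        refine ⟨1, fun n => ?_⟩
        rw [pow_zero, pow_zero, one_mul, PowerSeries.coeff_one]
        split_ifs with h
        · simp [h]
        · rw [abs_zero]; positivity
      | succ M ih =>
        rw [pow_zero, mul_one] at ih ⊢
        obtain ⟨C, hC⟩ := exists_abs_coeff_geomS_mul_le hq0 hqr ih
        refine ⟨|1 - q| * C, fun n => ?_⟩
        rw [pow_succ', mul_assoc, PowerSeries.coeff_C_mul, abs_mul, mul_assoc]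
        exact mul_le_mul_of_nonneg_left (hC n) (abs_nonneg _)
    | succ j ih =>
      rw [pow_succ' _ j, mul_left_comm]
      exact exists_abs_coeff_one_sub_mul_le hr ih
  obtain ⟨C, hC⟩ := key
  have hC0 : 0 ≤ C := by simpa using (abs_nonneg _).trans (hC 0)
  refine ⟨C, fun n => ?_⟩
  unfold phiFun
  rw [show (n : ℤ) + j = ((n + j : ℕ) : ℤ) by push_cast; ring, coefZ_natCast]
  refine (hC _).trans (mul_le_mul_of_nonneg_left ?_ hC0)
  exact pow_le_pow_of_le_one hr.le hr1.le (Nat.le_add_right _ _)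

theorem exists_abs_polP_le {ρ : ℝ} (hρ : 1 < ρ) (q : ℝ) (M i : ℕ) :
    ∃ C, ∀ n : ℕ, |polP q M i n| ≤ C * ρ ^ n := by
  have hρ0 : 0 < ρ := by linarith
  have hd : 0 < ρ - 1 := by linarith
  induction i with
  | zero => exact ⟨1, fun n => by simpa [polP_zero] using one_le_pow₀ hρ.le⟩
  | succ i ih =>
    obtain ⟨C, hC⟩ := ih
    have hC0 : 0 ≤ C := by simpa using (abs_nonneg _).trans (hC 0)
    set D := max |polP q M (i + 1) 0| (C * ρ / (ρ - 1)) with hD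
    have hD2 : C * ρ ≤ D * (ρ - 1) := (div_le_iff₀ hd).mp (le_max_right _ _)
    refine ⟨D, fun n => ?_⟩
    induction n with
    | zero => rw [pow_zero, mul_one]; exact le_max_left _ _
    | succ n ihn =>
      have h : polP q M (i + 1) (n + 1) = polP q M (i + 1) n - polP q M i (n + 1) := by
        linarith [polP_succ q M i n]
      rw [h]
      calc _ ≤ |polP q M (i + 1) n| + |polP q M i (n + 1)| := abs_sub _ _
        _ ≤ D * ρ ^ n + C * ρ ^ (n + 1) := add_le_add ihn (hC _)
        _ ≤ D * ρ ^ n + ρ ^ n * (D * (ρ - 1)) := by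
            rw [pow_succ]
            nlinarith [pow_pos hρ0 n]
        _ = D * ρ ^ (n + 1) := by ring

theorem exists_polP_mul_phiFun_le {q : ℝ} (hq0 : 0 < q) (hq1 : q < 1) (M M' i j : ℕ) :
    ∃ C t, 0 < t ∧ t < 1 ∧ ∀ a b n : ℕ,
      |polP q M i (a + n) * phiFun q M' j (b + n : ℕ)| ≤ C * 2 ^ a * t ^ n := by
  set r := (1 + q) / 2 with hr
  set ρ := 2 / (1 + r) with hρ
  have hr1 : r < 1 := by linarith
  have hr0 : 0 < r := by linarith
  have hρ1 : 1 < ρ := by rw [hρ, lt_div_iff₀ (by linarith)]; linarith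
  have hρ2 : ρ ≤ 2 := by rw [hρ, div_le_iff₀ (by linarith)]; linarith
  have hρr : ρ * r < 1 := by
    rw [hρ, div_mul_eq_mul_div, div_lt_one (by linarith)]; linarith
  obtain ⟨C, hC⟩ := exists_abs_polP_le hρ1 q M i
  obtain ⟨D, hD⟩ := exists_abs_phiFun_le hq0 (show q < r by linarith) hr1 M' j
  have hC0 : 0 ≤ C := by simpa using (abs_nonneg _).trans (hC 0)
  have hD0 : 0 ≤ D := by simpa using (abs_nonneg _).trans (hD 0)
  refine ⟨C * D, ρ * r, by positivity, hρr, fun a b n => ?_⟩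
  rw [abs_mul]
  calc _ ≤ (C * ρ ^ (a + n)) * (D * r ^ (b + n)) :=
        mul_le_mul (hC _) (hD _) (abs_nonneg _) (by positivity)
    _ = C * D * (ρ ^ a * r ^ b) * (ρ * r) ^ n := by rw [pow_add, pow_add, mul_pow]; ring
    _ ≤ C * D * (2 ^ a * 1) * (ρ * r) ^ n := by
        gcongr
        exact pow_le_one₀ hr0.le hr1.le
    _ = _ := by rw [mul_one]

theorem det_cdfEntry_eq_det_gramE (q : ℝ) (M N n : ℕ) :
    Matrix.det (Matrix.of fun i j : Fin N => cdfEntry q M i j n) =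
      Matrix.det (Matrix.of fun i j : Fin N => gramE q M i j n) := by
  set A : Matrix (Fin N) (Fin N) ℝ := Matrix.of fun i l : Fin N =>
    if (l : ℕ) ≤ i then polP q M (i - l) n else 0 with hA
  have h : (Matrix.of fun i j : Fin N => gramE q M i j n) =
      A * (Matrix.of fun i j : Fin N => cdfEntry q M i j n) := by
    ext i j
    simp only [Matrix.of_apply, Matrix.mul_apply, gramE, hA]
    rw [Fin.sum_univ_eq_sum_range (fun l => (if l ≤ (i : ℕ) then polP q M (i - l) n else 0) *
      cdfEntry q M l j n), ← Finset.sum_subset (s₁ := Finset.range ((i : ℕ) + 1))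
      (s₂ := Finset.range N) (Finset.range_subset_range.mpr i.2)]
    · refine Finset.sum_congr rfl fun l hl => ?_
      rw [if_pos (Nat.lt_succ_iff.mp (Finset.mem_range.mp hl))]
    · intro l _ hl
      rw [if_neg (by simpa [Nat.lt_succ_iff] using hl), zero_mul]
  have hdet : A.det = 1 := by
    rw [Matrix.det_of_isLowerTriangular]
    · simp [hA, polP_zero]
    · intro i j hij
      have : ¬ ((j : ℕ) ≤ i) := by simpa using hij
      rw [hA, Matrix.of_apply, if_neg this]
  rw [h, Matrix.det_mul, hdet, one_mul]

theorem tendsto_polP_mul_phiFun {q : ℝ} (hq0 : 0 < q) (hq1 : q < 1) (M M' i j a b : ℕ) :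
    Tendsto (fun n : ℕ => polP q M i (a + n) * phiFun q M' j (b + n : ℕ)) atTop (nhds 0) := by
  obtain ⟨C, t, ht0, ht1, h⟩ := exists_polP_mul_phiFun_le hq0 hq1 M M' i j
  refine squeeze_zero_norm (h a b) ?_
  simpa using (tendsto_pow_atTop_nhds_zero_of_lt_one ht0.le ht1).const_mul (C * 2 ^ a)

theorem tendsto_gramE {q : ℝ} (hq0 : 0 < q) (hq1 : q < 1) (M i j : ℕ) :
    Tendsto (fun n : ℕ => gramE q M i j n) atTop (nhds (if i = j then 1 else 0)) := by
  induction M with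
  | zero => simp [gramE_zero_left]
  | succ M ih =>
    simp only [gramE_succ_left hq1]
    have := (tendsto_polP_mul_phiFun hq0 hq1 M (M + 1) i j 1 0).const_mul (q / (1 - q))
    simpa [add_comm] using ih.sub this

theorem gramE_add (q : ℝ) (M i j n L : ℕ) :
    gramE q M i j (n + L) = gramE q M i j n +
      ∑ a ∈ Finset.range L, polP q M i (n + 1 + a) * phiFun q M j (n + 1 + a : ℕ) := by
  induction L with
  | zero => simp
  | succ L ih =>
    rw [Finset.sum_range_succ, ← add_assoc (gramE q M i j n), ← ih, ← add_assoc n L 1, gramE_succ,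
      show n + L + 1 = n + 1 + L by ring]

/-- The correlation kernel. -/
noncomputable def corK (q : ℝ) (M N x y : ℕ) : ℝ :=
  ∑ i ∈ Finset.range N, phiFun q M i x * polP q M i y

theorem tendsto_det_one_sub_corK {q : ℝ} (hq0 : 0 < q) (hq1 : q < 1) (M N n : ℕ) :
    Tendsto (fun L : ℕ => Matrix.det (1 - Matrix.of fun a b : Fin L =>
        corK q M N (n + 1 + a) (n + 1 + b))) atTop
      (nhds (Matrix.det (Matrix.of fun i j : Fin N => cdfEntry q M i j n))) := by
  rw [det_cdfEntry_eq_det_gramE]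
  have h1 : ∀ L : ℕ, Matrix.det (1 - Matrix.of fun a b : Fin L =>
      corK q M N (n + 1 + a) (n + 1 + b)) = Matrix.det (Matrix.of fun i j : Fin N =>
        (if i = j then 1 else 0) + (gramE q M i j n - gramE q M i j (n + L))) := by
    intro L
    set A : Matrix (Fin L) (Fin N) ℝ := Matrix.of fun a i => phiFun q M i (n + 1 + a : ℕ)
    set B : Matrix (Fin N) (Fin L) ℝ := Matrix.of fun i a => polP q M i (n + 1 + a)
    have e1 : (Matrix.of fun a b : Fin L => corK q M N (n + 1 + a) (n + 1 + b)) = A * B := by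
      ext a b
      simp only [Matrix.of_apply, Matrix.mul_apply, A, B, corK]
      exact (Fin.sum_univ_eq_sum_range (fun i => phiFun q M i (n + 1 + a : ℕ) *
        polP q M i (n + 1 + b)) N).symm
    rw [e1, Matrix.det_one_sub_mul_comm]
    congr 1
    ext i j
    rw [Matrix.sub_apply, Matrix.one_apply, Matrix.of_apply, gramE_add, Matrix.mul_apply]
    simp only [A, B, Matrix.of_apply]
    rw [Fin.sum_univ_eq_sum_range (fun a => polP q M i (n + 1 + a) *
      phiFun q M j (n + 1 + a : ℕ))]
    simp [sub_eq_add_neg]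
  simp only [h1]
  refine (Continuous.matrix_det continuous_id).continuousAt.tendsto.comp
    (f := fun L : ℕ => Matrix.of fun i j : Fin N =>
        (if i = j then (1 : ℝ) else 0) + (gramE q M i j n - gramE q M i j (n + L))) ?_
  refine tendsto_pi_nhds.mpr fun i => tendsto_pi_nhds.mpr fun j => ?_
  have h := (tendsto_gramE hq0 hq1 M i j).comp (tendsto_add_atTop_nat n)
  have h2 := (h.const_sub (gramE q M i j n)).const_add (if i = j then (1 : ℝ) else 0)
  simp only [Function.comp_def, add_comm _ n] at h2
  convert h2 using 2
  · rcases eq_or_ne i j with rfl | h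
    · simp
    · simp [h]
  · rcases eq_or_ne i j with rfl | h
    · simp
    · simp [h, Fin.val_ne_of_ne h]

/-- The factor of the correlation kernel with exponential decay. -/
noncomputable def aCoef (q : ℝ) (M N x : ℕ) : ℝ :=
  (-1) ^ N * phiFun q M N x

/-- The factor of the correlation kernel with polynomial growth. -/
noncomputable def bCoef (q : ℝ) (M N y : ℕ) : ℝ :=
  (-1) ^ (N - 1) * polP q M (N - 1) (y + 1)

theorem corK_sub (q : ℝ) (M : ℕ) {N : ℕ} (hN : 0 < N) (x y : ℕ) :
    corK q M N x y - corK q M N (x + 1) (y + 1) = aCoef q M N x * bCoef q M N y := by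
  have key : ∀ N, corK q M (N + 1) x y - corK q M (N + 1) (x + 1) (y + 1) =
      -(phiFun q M (N + 1) x * polP q M N (y + 1)) := by
    intro N
    have hx : ((x + 1 : ℕ) : ℤ) = (x : ℤ) + 1 := by push_cast; ring
    induction N with
    | zero => simp [corK, polP_zero, phiFun_succ]
    | succ N ih =>
      unfold corK at ih ⊢
      rw [Finset.sum_range_succ, Finset.sum_range_succ _ (N + 1)]
      rw [polP_succ, phiFun_succ q M (N + 1)]
      rw [hx] at ih ⊢
      linear_combination ih
  obtain ⟨N, rfl⟩ := Nat.exists_eq_add_of_le' hN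
  rw [key, aCoef, bCoef, Nat.add_sub_cancel]
  have h : ((-1 : ℝ) ^ (N + 1)) * (-1) ^ N = -1 := by
    rw [← pow_add, show N + 1 + N = 2 * N + 1 by ring, pow_succ, pow_mul]; simp
  linear_combination -(phiFun q M (N + 1) x * polP q M N (y + 1)) * h

theorem hasSum_corK {q : ℝ} (hq0 : 0 < q) (hq1 : q < 1) (M : ℕ) {N : ℕ} (hN : 0 < N) (x y : ℕ) :
    HasSum (fun l : ℕ => aCoef q M N (x + l) * bCoef q M N (y + l)) (corK q M N x y) := by
  have hs : Summable fun l : ℕ => aCoef q M N (x + l) * bCoef q M N (y + l) := by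
    obtain ⟨C, t, ht0, ht1, h⟩ := exists_polP_mul_phiFun_le hq0 hq1 M M (N - 1) N
    refine Summable.of_norm_bounded
      ((summable_geometric_of_lt_one ht0.le ht1).mul_left (C * 2 ^ (y + 1))) fun l => ?_
    refine le_trans (le_of_eq ?_) (h (y + 1) x l)
    rw [Real.norm_eq_abs, aCoef, bCoef]
    simp only [abs_mul, abs_pow, abs_neg, abs_one, one_pow, one_mul]
    rw [mul_comm, add_right_comm y l 1]
  have hlim : Tendsto (fun L : ℕ => corK q M N (x + L) (y + L)) atTop (nhds 0) := by
    unfold corK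
    rw [← Finset.sum_const_zero (s := Finset.range N)]
    refine tendsto_finsetSum _ fun i _ => ?_
    simpa only [mul_comm] using tendsto_polP_mul_phiFun hq0 hq1 M M i i y x
  have hpart : ∀ L : ℕ, ∑ l ∈ Finset.range L, aCoef q M N (x + l) * bCoef q M N (y + l) =
      corK q M N x y - corK q M N (x + L) (y + L) := by
    intro L
    induction L with
    | zero => simp
    | succ L ih =>
      rw [Finset.sum_range_succ, ih, ← corK_sub q M hN]
      ring_nf
  refine hs.hasSum_iff_tendsto_nat.mpr ?_
  simp only [hpart]
  simpa using hlim.const_sub (corK q M N x y)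

/-- Integrand `p ^ k * exp (p ^ 3 / 3 - x * p)`, `p = 1 - I * t`, of the Airy moments. -/
noncomputable def airyIntegrand (k : ℕ) (x t : ℝ) : ℂ :=
  (1 - Complex.I * t) ^ k *
    Complex.exp ((1 - Complex.I * t) ^ 3 / 3 - x * (1 - Complex.I * t))

theorem norm_one_sub_I_mul_pow_le {k : ℕ} (hk : 0 < k) (t : ℝ) :
    ‖(1 - Complex.I * t : ℂ)‖ ^ k ≤ (2 * k) ^ k * Real.exp (t ^ 2 / 2) := by
  have hk' : (0 : ℝ) < 2 * k := by positivity
  have hk1 : (1 : ℝ) ≤ 2 * k := by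
    have : (1 : ℝ) ≤ k := by exact_mod_cast hk
    linarith
  have h1 : ‖(1 - Complex.I * t : ℂ)‖ ^ 2 = 1 + t ^ 2 := by
    rw [Complex.sq_norm, Complex.normSq_apply]; simp; ring
  have h2 : ‖(1 - Complex.I * t : ℂ)‖ ≤ 1 + t ^ 2 := by
    nlinarith [norm_nonneg (1 - Complex.I * t : ℂ), sq_nonneg t,
      sq_nonneg (‖(1 - Complex.I * t : ℂ)‖ - 1)]
  have h3 : 1 + t ^ 2 ≤ (2 * k) * Real.exp (t ^ 2 / (2 * k)) := by
    have h := mul_le_mul_of_nonneg_left (Real.add_one_le_exp (t ^ 2 / (2 * k))) hk'.le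
    have h4 : (2 * k : ℝ) * (t ^ 2 / (2 * k) + 1) = t ^ 2 + 2 * k := by field_simp
    linarith
  calc _ ≤ ((2 * k) * Real.exp (t ^ 2 / (2 * k))) ^ k :=
        pow_le_pow_left₀ (norm_nonneg _) (h2.trans h3) k
    _ = _ := by
        rw [mul_pow, ← Real.exp_nat_mul]
        congr 2
        field_simp

theorem norm_airyIntegrand (k : ℕ) (x t : ℝ) :
    ‖airyIntegrand k x t‖ = ‖(1 - Complex.I * t : ℂ)‖ ^ k * Real.exp (1 / 3 - t ^ 2 - x) := by
  rw [airyIntegrand, norm_mul, norm_pow, Complex.norm_exp]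
  congr 2
  simp [pow_succ]
  ring

theorem norm_airyIntegrand_le (k : ℕ) (x t : ℝ) :
    ‖airyIntegrand k x t‖ ≤
      ((2 * (k + 1 : ℕ)) ^ (k + 1) * Real.exp (1 / 3 - x)) * Real.exp (-(1 / 2) * t ^ 2) := by
  have h1 : 1 ≤ ‖(1 - Complex.I * t : ℂ)‖ := by
    have := Complex.abs_re_le_norm (1 - Complex.I * t : ℂ)
    simpa using this
  rw [norm_airyIntegrand]
  have h2 := norm_one_sub_I_mul_pow_le (Nat.succ_pos k) t
  calc _ ≤ ((2 * (k + 1 : ℕ)) ^ (k + 1) * Real.exp (t ^ 2 / 2)) *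
        Real.exp (1 / 3 - t ^ 2 - x) := by
        gcongr
        exact (pow_le_pow_right₀ h1 (Nat.le_succ k)).trans h2
    _ = _ := by
        rw [mul_assoc, mul_assoc, ← Real.exp_add, ← Real.exp_add]
        ring_nf

theorem continuous_airyIntegrand (k : ℕ) (x : ℝ) : Continuous (airyIntegrand k x) := by
  unfold airyIntegrand; fun_prop

theorem integrable_airyIntegrand (k : ℕ) (x : ℝ) : Integrable (airyIntegrand k x) :=
  ((integrable_exp_neg_mul_sq (by norm_num : (0 : ℝ) < 1 / 2)).const_mul _).mono'
    (continuous_airyIntegrand k x).aestronglyMeasurable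
    (Eventually.of_forall (norm_airyIntegrand_le k x))

/-- The (complex) Airy moments. -/
noncomputable def airyMoment (k : ℕ) (x : ℝ) : ℂ := ∫ t : ℝ, airyIntegrand k x t

theorem exists_norm_airyMoment_le (k : ℕ) :
    ∃ C, 0 ≤ C ∧ ∀ x, ‖airyMoment k x‖ ≤ C * Real.exp (-x) := by
  refine ⟨∫ t : ℝ, ((2 * (k + 1 : ℕ)) ^ (k + 1) * Real.exp (1 / 3)) *
    Real.exp (-(1 / 2) * t ^ 2), integral_nonneg fun t => by positivity, fun x => ?_⟩
  rw [← integral_mul_const]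
  refine norm_integral_le_of_norm_le
    (((integrable_exp_neg_mul_sq (by norm_num : (0 : ℝ) < 1 / 2)).const_mul _).mul_const _)
    (Eventually.of_forall fun t => (norm_airyIntegrand_le k x t).trans_eq ?_)
  rw [sub_eq_add_neg, Real.exp_add]
  ring

theorem hasDerivAt_airyMoment (k : ℕ) (x : ℝ) :
    HasDerivAt (airyMoment k) (-airyMoment (k + 1) x) x := by
  have h := hasDerivAt_integral_of_dominated_loc_of_deriv_le (μ := volume) (𝕜 := ℝ)
    (F := fun x t => airyIntegrand k x t) (F' := fun x t => -airyIntegrand (k + 1) x t) (x₀ := x)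
    (s := Metric.ball x 1)
    (bound := fun t => ((2 * (k + 1 + 1 : ℕ)) ^ (k + 1 + 1) * Real.exp (1 / 3 - (x - 1))) *
      Real.exp (-(1 / 2) * t ^ 2))
    (Metric.ball_mem_nhds x one_pos)
    (Eventually.of_forall fun y => (continuous_airyIntegrand k y).aestronglyMeasurable)
    (integrable_airyIntegrand k x)
    (continuous_airyIntegrand (k + 1) x).neg.aestronglyMeasurable
    (Eventually.of_forall fun t y hy => ?_)
    ((integrable_exp_neg_mul_sq (by norm_num : (0 : ℝ) < 1 / 2)).const_mul _)
    (Eventually.of_forall fun t y _ => ?_)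
  · have := h.2
    rwa [integral_neg] at this
  · rw [norm_neg]
    refine (norm_airyIntegrand_le (k + 1) y t).trans ?_
    rw [Metric.mem_ball, Real.dist_eq, abs_lt] at hy
    gcongr
    linarith
  · have h1 : HasDerivAt (fun y : ℝ => ((1 - Complex.I * t) ^ 3 / 3 - y * (1 - Complex.I * t) : ℂ))
        (-(1 * (1 - Complex.I * t))) y :=
      ((Complex.ofRealCLM.hasDerivAt (x := y)).mul_const _).const_sub _
    have h2 := h1.cexp.const_mul ((1 - Complex.I * t : ℂ) ^ k)
    refine h2.congr_deriv ?_
    simp only [airyIntegrand]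
    ring

theorem airyMoment_two (x : ℝ) : airyMoment 2 x = x * airyMoment 0 x := by
  have hd : ∀ t : ℝ, HasDerivAt (fun t => airyIntegrand 0 x t)
      (-Complex.I * (airyIntegrand 2 x t - x * airyIntegrand 0 x t)) t := by
    intro t
    have h0 : HasDerivAt (fun t : ℝ => (1 - Complex.I * t : ℂ)) (-(Complex.I * 1)) t :=
      ((Complex.ofRealCLM.hasDerivAt (x := t)).const_mul _).const_sub _
    have h1 := ((((h0.pow 3).div_const 3).sub (h0.const_mul (x : ℂ))).cexp).const_mul
      ((1 : ℂ))
    simp only [airyIntegrand, pow_zero]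
    refine h1.congr_deriv ?_
    simp
    ring
  have hi : Integrable fun t => -Complex.I * (airyIntegrand 2 x t - x * airyIntegrand 0 x t) :=
    ((integrable_airyIntegrand 2 x).sub ((integrable_airyIntegrand 0 x).const_mul _)).const_mul _
  have h := integral_eq_zero_of_hasDerivAt_of_integrable hd hi (integrable_airyIntegrand 0 x)
  rw [integral_const_mul, integral_sub (integrable_airyIntegrand 2 x)
    ((integrable_airyIntegrand 0 x).const_mul _), integral_const_mul] at h
  have h2 := (mul_eq_zero.mp h).resolve_left (by simp)
  exact sub_eq_zero.mp h2

theorem Ai_eq (x : ℝ) : Ai x = 1 / (2 * Real.pi) * (airyMoment 0 x).re := by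
  unfold Ai airyMoment
  congr 3
  funext t
  rw [airyIntegrand, pow_zero, one_mul]
  congr 1
  have : (Complex.I) ^ 2 = -1 := Complex.I_sq
  linear_combination (x + Complex.I * t + Complex.I * t ^ 3 / 3 + (Complex.I ^ 2 - 1) / 3) * this

/-- Real Airy moments: `Ai`, `Ai'` up to sign, and `Ai''`. -/
noncomputable def aiMoment (k : ℕ) (x : ℝ) : ℝ := 1 / (2 * Real.pi) * (airyMoment k x).re

theorem hasDerivAt_aiMoment (k : ℕ) (x : ℝ) :
    HasDerivAt (aiMoment k) (-aiMoment (k + 1) x) x := by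
  have h := (Complex.reCLM.hasFDerivAt.comp_hasDerivAt x (hasDerivAt_airyMoment k x)).const_mul
    (1 / (2 * Real.pi))
  refine h.congr_deriv ?_
  simp [aiMoment]

theorem continuous_aiMoment (k : ℕ) : Continuous (aiMoment k) :=
  continuous_iff_continuousAt.mpr fun x => (hasDerivAt_aiMoment k x).continuousAt

theorem exists_abs_aiMoment_le (k : ℕ) :
    ∃ C, 0 ≤ C ∧ ∀ x, |aiMoment k x| ≤ C * Real.exp (-x) := by
  obtain ⟨C, hC0, hC⟩ := exists_norm_airyMoment_le k
  refine ⟨1 / (2 * Real.pi) * C, by positivity, fun x => ?_⟩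
  rw [aiMoment, abs_mul, abs_of_pos (by positivity), mul_assoc]
  gcongr
  exact (Complex.abs_re_le_norm _).trans (hC x)

theorem Ai_eq_aiMoment : Ai = aiMoment 0 := funext Ai_eq

theorem deriv_Ai : deriv Ai = fun x => -aiMoment 1 x := by
  rw [Ai_eq_aiMoment]; exact funext fun x => (hasDerivAt_aiMoment 0 x).deriv

theorem deriv_deriv_Ai : deriv (deriv Ai) = aiMoment 2 := by
  rw [deriv_Ai]; funext x
  simpa using (hasDerivAt_aiMoment 1 x).neg.deriv

theorem aiMoment_two (x : ℝ) : aiMoment 2 x = x * aiMoment 0 x := by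
  simp [aiMoment, airyMoment_two]; ring

theorem tendsto_aiMoment_mul (j k : ℕ) (x y : ℝ) :
    Tendsto (fun u => aiMoment j (x + u) * aiMoment k (y + u)) atTop (nhds 0) := by
  have h : ∀ k x, Tendsto (fun u => aiMoment k (x + u)) atTop (nhds 0) := by
    intro k x
    obtain ⟨C, hC0, hC⟩ := exists_abs_aiMoment_le k
    refine squeeze_zero_norm (fun u => hC (x + u)) ?_
    have : Tendsto (fun u : ℝ => Real.exp (-(x + u))) atTop (nhds 0) :=
      Real.tendsto_exp_neg_atTop_nhds_zero.comp (tendsto_atTop_add_const_left _ _ tendsto_id)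
    simpa using this.const_mul C
  simpa using (h j x).mul (h k y)

theorem integrableOn_Ai_mul (x y : ℝ) :
    IntegrableOn (fun u => Ai (x + u) * Ai (y + u)) (Set.Ioi 0) := by
  obtain ⟨C, hC0, hC⟩ := exists_abs_aiMoment_le 0
  rw [Ai_eq_aiMoment]
  refine Integrable.mono' (g := fun u => C * C * Real.exp (-x - y) * Real.exp (-2 * u)) ?_ ?_ ?_
  · exact (integrableOn_exp_mul_Ioi (by norm_num) 0).const_mul _
  · exact (((continuous_aiMoment 0).comp (continuous_const_add x)).mul
      ((continuous_aiMoment 0).comp (continuous_const_add y))).aestronglyMeasurable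
  · refine Eventually.of_forall fun u => ?_
    rw [Real.norm_eq_abs, abs_mul]
    calc _ ≤ (C * Real.exp (-(x + u))) * (C * Real.exp (-(y + u))) :=
          mul_le_mul (hC _) (hC _) (abs_nonneg _) (by positivity)
      _ = C * C * (Real.exp (-(x + u)) * Real.exp (-(y + u))) := by ring
      _ = _ := by
        rw [mul_assoc (C * C), ← Real.exp_add, ← Real.exp_add]
        ring_nf

theorem airyKernel_eq_integral (x y : ℝ) :
    airyKernel x y = ∫ u in Set.Ioi (0 : ℝ), Ai (x + u) * Ai (y + u) := by
  have hint := integrableOn_Ai_mul x y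
  have hd : ∀ k x u, HasDerivAt (fun u => aiMoment k (x + u)) (-aiMoment (k + 1) (x + u)) u :=
    fun k x u => (hasDerivAt_aiMoment k (x + u)).comp_const_add x u
  unfold airyKernel
  split_ifs with h
  · subst h
    have hF : ∀ u ∈ Set.Ici (0 : ℝ), HasDerivAt
        (fun u => (x + u) * aiMoment 0 (x + u) ^ 2 - aiMoment 1 (x + u) ^ 2)
        (Ai (x + u) * Ai (x + u)) u := by
      intro u _
      have hx : HasDerivAt (fun u : ℝ => x + u) 1 u := (hasDerivAt_id u).const_add x
      refine ((hx.mul ((hd 0 x u).pow 2)).sub ((hd 1 x u).pow 2)).congr_deriv ?_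
      rw [Ai_eq_aiMoment]
      simp only [zero_add, Nat.reduceAdd, aiMoment_two, Pi.pow_apply]
      ring
    have hlim : Tendsto (fun u => (x + u) * aiMoment 0 (x + u) ^ 2 - aiMoment 1 (x + u) ^ 2) atTop
        (nhds 0) := by
      have := (tendsto_aiMoment_mul 2 0 x x).sub (tendsto_aiMoment_mul 1 1 x x)
      simp only [aiMoment_two, sub_zero] at this
      refine this.congr fun u => by ring
    rw [integral_Ioi_of_hasDerivAt_of_tendsto' hF hint hlim, deriv_deriv_Ai, deriv_Ai,
      Ai_eq_aiMoment, aiMoment_two]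
    simp
    ring
  · have hxy : x - y ≠ 0 := sub_ne_zero.mpr h
    have hF : ∀ u ∈ Set.Ici (0 : ℝ), HasDerivAt
        (fun u => (aiMoment 0 (x + u) * aiMoment 1 (y + u) -
          aiMoment 1 (x + u) * aiMoment 0 (y + u)) / (x - y))
        (Ai (x + u) * Ai (y + u)) u := by
      intro u _
      refine ((((hd 0 x u).mul (hd 1 y u)).sub ((hd 1 x u).mul (hd 0 y u))).div_const
        (x - y)).congr_deriv ?_
      rw [Ai_eq_aiMoment]
      simp only [zero_add, Nat.reduceAdd, aiMoment_two]
      field_simp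
      ring
    have hlim : Tendsto (fun u => (aiMoment 0 (x + u) * aiMoment 1 (y + u) -
          aiMoment 1 (x + u) * aiMoment 0 (y + u)) / (x - y)) atTop (nhds 0) := by
      simpa using ((tendsto_aiMoment_mul 0 1 x y).sub
        (tendsto_aiMoment_mul 1 0 x y)).div_const (x - y)
    rw [integral_Ioi_of_hasDerivAt_of_tendsto' hF hint hlim, deriv_Ai, Ai_eq_aiMoment]
    simp
    ring

/-- The point `r * exp (I * θ)` of the circle of radius `r`. -/
noncomputable def circPt (r θ : ℝ) : ℂ := r * Complex.exp (θ * Complex.I)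

theorem circPt_ne_zero {r : ℝ} (hr : 0 < r) (θ : ℝ) : circPt r θ ≠ 0 :=
  mul_ne_zero (by exact_mod_cast hr.ne') (Complex.exp_ne_zero _)

theorem norm_circPt {r : ℝ} (hr : 0 < r) (θ : ℝ) : ‖circPt r θ‖ = r := by
  rw [circPt, norm_mul, Complex.norm_exp_ofReal_mul_I, Complex.norm_real, Real.norm_eq_abs,
    abs_of_pos hr, mul_one]

theorem continuous_circPt (r : ℝ) : Continuous (circPt r) := by
  unfold circPt; fun_prop

theorem continuous_circPt_zpow {r : ℝ} (hr : 0 < r) (m : ℤ) :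
    Continuous fun θ => circPt r θ ^ m :=
  (continuous_circPt r).zpow₀ m fun θ => Or.inl (circPt_ne_zero hr θ)

/-- The Laurent coefficient of `f` on the circle of radius `r`. -/
noncomputable def circCoef (f : ℂ → ℂ) (r : ℝ) (m : ℤ) : ℂ :=
  1 / (2 * Real.pi) * ∫ θ in -Real.pi..Real.pi, f (circPt r θ) * circPt r θ ^ (-m)

/-- The function `f` on the circle of radius `r` has the Laurent coefficients of `P`. -/
structure IsCircRep (r : ℝ) (P : PowerSeries ℝ) (f : ℂ → ℂ) : Prop where
  cont : Continuous fun θ => f (circPt r θ)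
  coef : ∀ m : ℤ, circCoef f r m = coefZ P m

theorem circCoef_one_sub_mul {f : ℂ → ℂ} {r : ℝ} (hr : 0 < r)
    (hf : Continuous fun θ => f (circPt r θ)) (c : ℂ) (m : ℤ) :
    circCoef (fun z => (1 - c * z) * f z) r m = circCoef f r m - c * circCoef f r (m - 1) := by
  have hi : ∀ m : ℤ, IntervalIntegrable (fun θ => f (circPt r θ) * circPt r θ ^ (-m)) volume
      (-Real.pi) Real.pi := fun m =>
    (hf.mul (continuous_circPt_zpow hr _)).intervalIntegrable _ _
  have hint : (∫ θ in -Real.pi..Real.pi,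
        (1 - c * circPt r θ) * f (circPt r θ) * circPt r θ ^ (-m)) =
      (∫ θ in -Real.pi..Real.pi, f (circPt r θ) * circPt r θ ^ (-m)) -
        c * ∫ θ in -Real.pi..Real.pi, f (circPt r θ) * circPt r θ ^ (-(m - 1)) := by
    rw [← intervalIntegral.integral_const_mul,
      ← intervalIntegral.integral_sub (hi m) ((hi (m - 1)).const_mul c)]
    refine intervalIntegral.integral_congr fun θ _ => ?_
    rw [show -(m - 1) = 1 + -m by ring, zpow_add₀ (circPt_ne_zero hr θ), zpow_one]
    ring
  unfold circCoef
  rw [hint]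
  ring

theorem isCircRep_one (r : ℝ) : IsCircRep r 1 fun _ => 1 := by
  refine ⟨continuous_const, fun m => ?_⟩
  have hpi : (Real.pi : ℂ) ≠ 0 := by exact_mod_cast Real.pi_ne_zero
  unfold circCoef
  rcases eq_or_ne m 0 with rfl | hm
  · have : coefZ 1 0 = 1 := by simp [coefZ]
    rw [this]
    simp
    field_simp
    ring
  · have : coefZ 1 m = 0 := by
      rcases lt_or_ge m 0 with h | h
      · exact coefZ_of_neg _ h
      · lift m to ℕ using h
        rw [coefZ_natCast, PowerSeries.coeff_one, if_neg (by exact_mod_cast hm)]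
    rw [this]
    have hc : (-m * Complex.I : ℂ) ≠ 0 := by simp [hm]
    have h1 : ∀ θ : ℝ, (1 : ℂ) * circPt r θ ^ (-m) =
        (r : ℂ) ^ (-m) * Complex.exp ((-m * Complex.I) * θ) := by
      intro θ
      rw [circPt, mul_zpow, ← Complex.exp_int_mul, one_mul]
      congr 2
      push_cast
      ring
    have h2 : Complex.exp ((-m * Complex.I) * (Real.pi : ℝ)) =
        Complex.exp ((-m * Complex.I) * ((-Real.pi : ℝ) : ℂ)) := by
      rw [Complex.exp_eq_exp_iff_exists_int]
      exact ⟨-m, by push_cast; ring⟩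
    simp only [h1]
    rw [intervalIntegral.integral_const_mul, integral_exp_mul_complex hc, h2]
    simp

theorem IsCircRep.one_sub_mul {r : ℝ} (hr : 0 < r) {P : PowerSeries ℝ} {f : ℂ → ℂ}
    (h : IsCircRep r P f) (c : ℝ) :
    IsCircRep r ((1 - PowerSeries.C c * PowerSeries.X) * P) fun z => (1 - c * z) * f z := by
  refine ⟨?_, fun m => ?_⟩
  · exact (continuous_const.sub (continuous_const.mul (continuous_circPt r))).mul h.cont
  · rw [circCoef_one_sub_mul hr h.cont, h.coef, h.coef, coefZ_one_sub_mul]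
    push_cast
    ring

theorem norm_circCoef_le {f : ℂ → ℂ} {r : ℝ} (hr : 0 < r)
    (hf : Continuous fun θ => f (circPt r θ)) : ∃ C, ∀ m : ℤ, ‖circCoef f r m‖ ≤ C * r ^ (-m) := by
  obtain ⟨B, hB⟩ := (isCompact_Icc (a := -Real.pi) (b := Real.pi)).exists_bound_of_continuousOn
    hf.continuousOn
  refine ⟨‖(1 / (2 * Real.pi) : ℂ)‖ * (B * |Real.pi - -Real.pi|), fun m => ?_⟩
  rw [circCoef, norm_mul, mul_assoc]
  refine mul_le_mul_of_nonneg_left ?_ (norm_nonneg _)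
  have hle := intervalIntegral.norm_integral_le_of_norm_le_const (C := B * r ^ (-m))
    (f := fun θ => f (circPt r θ) * circPt r θ ^ (-m)) (a := -Real.pi) (b := Real.pi) ?_
  · linarith
  · intro θ hθ
    rw [Set.uIoc_of_le (by linarith [Real.pi_pos])] at hθ
    rw [norm_mul, norm_zpow, norm_circPt hr]
    exact mul_le_mul_of_nonneg_right (hB θ ⟨hθ.1.le, hθ.2⟩) (zpow_nonneg hr.le _)

theorem IsCircRep.geomS_mul {r q : ℝ} (hr : 0 < r) (hq : 0 < q) (hqr : q * r < 1)
    {P : PowerSeries ℝ} {f : ℂ → ℂ} (h : IsCircRep r P f) :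
    IsCircRep r (geomS q * P) fun z => (1 - q * z)⁻¹ * f z := by
  have hne : ∀ θ, (1 - q * circPt r θ : ℂ) ≠ 0 := by
    intro θ h0
    have h1 : (q : ℂ) * circPt r θ = 1 := (sub_eq_zero.mp h0).symm
    have h2 := congrArg norm h1
    rw [norm_mul, norm_circPt hr, Complex.norm_real, Real.norm_eq_abs, abs_of_pos hq,
      norm_one] at h2
    linarith
  have hcont : Continuous fun θ => (1 - q * circPt r θ : ℂ)⁻¹ * f (circPt r θ) := by
    have h1 := continuous_circPt r
    exact (Continuous.inv₀ (by fun_prop) hne).mul h.cont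
  refine ⟨hcont, ?_⟩
  set F : ℂ → ℂ := fun z => (1 - q * z)⁻¹ * f z with hF
  set d : ℤ → ℂ := fun m => circCoef F r m - coefZ (geomS q * P) m with hd
  have hrec : ∀ m, d m = q * d (m - 1) := by
    intro m
    have h1 : circCoef F r m - q * circCoef F r (m - 1) = coefZ P m := by
      rw [← circCoef_one_sub_mul hr hcont, ← h.coef]
      unfold circCoef
      congr 1
      refine intervalIntegral.integral_congr fun θ _ => ?_
      simp only [hF]
      rw [mul_inv_cancel_left₀ (hne θ)]
    have h2 : coefZ (geomS q * P) m - q * coefZ (geomS q * P) (m - 1) = coefZ P m := by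
      rw [← coefZ_one_sub_mul, ← mul_assoc, one_sub_mul_geomS, one_mul]
    have h3 := congrArg (fun x : ℝ => (x : ℂ)) h2
    simp only [Complex.ofReal_sub, Complex.ofReal_mul] at h3
    simp only [hd]
    linear_combination h1 - h3
  have hpow : ∀ (k : ℕ) m, d m = q ^ k * d (m - k) := by
    intro k
    induction k with
    | zero => simp
    | succ k ih =>
      intro m
      rw [ih, hrec (m - k), pow_succ]
      push_cast
      rw [mul_assoc, sub_sub]
  obtain ⟨C, hC⟩ := norm_circCoef_le (f := F) hr hcont
  intro m
  refine sub_eq_zero.mp (norm_eq_zero.mp (le_antisymm (a := ‖d m‖) ?_ (norm_nonneg _)))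
  have hlim : Tendsto (fun k : ℕ => C * r ^ (-m) * (q * r) ^ k) atTop (nhds 0) := by
    simpa using (tendsto_pow_atTop_nhds_zero_of_lt_one (by positivity) hqr).const_mul (C * r ^ (-m))
  refine ge_of_tendsto hlim ?_
  filter_upwards [eventually_gt_atTop m.toNat] with k hk
  have hneg : m - (k : ℤ) < 0 := by omega
  have hdk : d (m - k) = circCoef F r (m - k) := by
    simp [hd, coefZ_of_neg _ hneg]
  rw [hpow k m, norm_mul, norm_pow, Complex.norm_real, Real.norm_eq_abs, abs_of_pos hq, hdk]
  calc _ ≤ q ^ k * (C * r ^ (-(m - (k : ℤ)))) := by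
        gcongr
        exact hC _
    _ = _ := by
        rw [show -(m - (k : ℤ)) = -m + k by ring, zpow_add₀ hr.ne', zpow_natCast]
        ring

theorem isCircRep_one_sub_pow_mul {r : ℝ} (hr : 0 < r) (c : ℝ) (k : ℕ) {P : PowerSeries ℝ}
    {f : ℂ → ℂ} (h : IsCircRep r P f) :
    IsCircRep r ((1 - PowerSeries.C c * PowerSeries.X) ^ k * P)
      fun z => (1 - c * z) ^ k * f z := by
  induction k with
  | zero => simpa using h
  | succ k ih =>
    have := ih.one_sub_mul hr c
    simpa only [pow_succ', mul_assoc] using this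

theorem isCircRep_geomS_pow_mul {r q : ℝ} (hr : 0 < r) (hq : 0 < q) (hqr : q * r < 1) (k : ℕ)
    {P : PowerSeries ℝ} {f : ℂ → ℂ} (h : IsCircRep r P f) :
    IsCircRep r (geomS q ^ k * P) fun z => ((1 - q * z)⁻¹) ^ k * f z := by
  induction k with
  | zero => simpa using h
  | succ k ih =>
    have := ih.geomS_mul hr hq hqr
    simpa only [pow_succ', mul_assoc] using this

theorem aCoef_eq_circCoef {r q : ℝ} (hr : 0 < r) (hq : 0 < q) (hqr : q * r < 1) (M N x : ℕ) :
    (aCoef q M N x : ℂ) = (-1) ^ N * (1 - q) ^ M *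
      circCoef (fun z => ((1 - q * z)⁻¹) ^ M * ((1 - (1 : ℝ) * z) ^ N * 1)) r (x + N) := by
  have h := isCircRep_geomS_pow_mul hr hq hqr M
    (isCircRep_one_sub_pow_mul hr 1 N (isCircRep_one r))
  rw [h.coef, aCoef, phiFun, mul_pow, ← map_pow, mul_assoc (PowerSeries.C _), coefZ_C_mul,
    mul_one]
  push_cast
  ring

theorem bCoef_eq_circCoef {r : ℝ} (hr : 0 < r) (q : ℝ) (M : ℕ) {N : ℕ} (hN : 0 < N) (y : ℕ) :
    (bCoef q M N y : ℂ) =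
      circCoef (fun z => (1 - ((-1 : ℝ) : ℂ) * z) ^ (y + N - 1) *
        ((1 - ((q / (1 - q) : ℝ) : ℂ) * z) ^ M * 1)) r (N - 1) := by
  have h := isCircRep_one_sub_pow_mul hr (-1) (y + N - 1)
    (isCircRep_one_sub_pow_mul hr (q / (1 - q)) M (isCircRep_one r))
  rw [show (N : ℤ) - 1 = ((N - 1 : ℕ) : ℤ) by omega, h.coef, bCoef, polP, coefZ_natCast,
    ← mul_assoc, ← mul_pow, mul_one, show y + 1 + (N - 1) - 1 = y + N - 1 by omega]
  simp

theorem isLittleO_sub_cube {f f' : ℂ → ℂ} {l : ℂ} (h0 : f 0 = 0)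
    (hd : ∀ᶠ z in nhds 0, HasDerivAt f (f' z) z)
    (hf' : (fun z => f' z - l * z ^ 2) =o[nhds 0] fun z => z ^ 2) :
    (fun z => f z - l / 3 * z ^ 3) =o[nhds 0] fun z => z ^ 3 := by
  rw [Asymptotics.isLittleO_iff]
  intro ε hε
  obtain ⟨r, hr, hball⟩ := Metric.eventually_nhds_iff_ball.mp
    (hd.and (Asymptotics.isLittleO_iff.mp hf' hε))
  filter_upwards [Metric.ball_mem_nhds 0 hr] with z hz
  have hsub : ∀ w ∈ Metric.closedBall (0 : ℂ) ‖z‖, w ∈ Metric.ball (0 : ℂ) r := by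
    intro w hw
    rw [mem_closedBall_zero_iff] at hw
    rw [mem_ball_zero_iff] at hz ⊢
    exact hw.trans_lt hz
  have key := (convex_closedBall (0 : ℂ) ‖z‖).norm_image_sub_le_of_norm_hasDerivWithin_le
    (f := fun z => f z - l / 3 * z ^ 3) (f' := fun z => f' z - l * z ^ 2) (C := ε * ‖z‖ ^ 2)
    (x := 0) (y := z) ?_ ?_ (by simp) (by simp)
  · simp only [h0] at key
    rw [norm_pow]
    calc _ ≤ _ := by simpa using key
      _ = _ := by ring
  · intro w hw
    have h1 := (hball w (hsub w hw)).1.sub ((hasDerivAt_pow 3 w).const_mul (l / 3))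
    refine HasDerivAt.hasDerivWithinAt (h1.congr_deriv ?_)
    push_cast
    ring
  · intro w hw
    refine ((hball w (hsub w hw)).2).trans ?_
    rw [mem_closedBall_zero_iff] at hw
    rw [norm_pow]
    gcongr

theorem tendsto_mul_of_sub_cube {f : ℂ → ℂ} {c : ℝ} {δ : ℕ → ℝ}
    (hf : (fun z => f z - c / 3 * z ^ 3) =o[nhds 0] fun z => z ^ 3)
    (hδ : Tendsto δ atTop (nhds 0)) (hN : ∀ᶠ N : ℕ in atTop, c * (N * δ N ^ 3) = 1) (p : ℂ) :
    Tendsto (fun N : ℕ => (N : ℂ) * f (δ N * p)) atTop (nhds (p ^ 3 / 3)) := by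
  have hz : Tendsto (fun N : ℕ => (δ N : ℂ) * p) atTop (nhds 0) := by
    have : Tendsto (fun N : ℕ => (δ N : ℂ)) atTop (nhds 0) := by
      have h := (Complex.continuous_ofReal.tendsto 0).comp hδ
      rw [Complex.ofReal_zero] at h
      exact h
    simpa using this.mul_const p
  have h1 := hf.comp_tendsto hz
  have hc : (c : ℂ) ≠ 0 := by
    obtain ⟨N, hN⟩ := hN.exists
    intro h
    rw [Complex.ofReal_eq_zero] at h
    simp [h] at hN
  have hb : (fun N : ℕ => (N : ℂ) * ((δ N : ℂ) * p) ^ 3) =O[atTop] fun _ => (1 : ℝ) := by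
    refine Asymptotics.IsBigO.of_bound ‖p ^ 3 / c‖ ?_
    filter_upwards [hN] with N hN
    have : (c : ℂ) * (N * (δ N : ℂ) ^ 3) = 1 := by exact_mod_cast hN
    have : (N : ℂ) * ((δ N : ℂ) * p) ^ 3 = p ^ 3 / c := by
      field_simp
      linear_combination p ^ 3 * this
    rw [this]
    simp
  have h2 : (fun N : ℕ => (N : ℂ) * (f (δ N * p) - c / 3 * (δ N * p) ^ 3)) =o[atTop]
      fun _ => (1 : ℝ) :=
    ((Asymptotics.isBigO_refl (fun N : ℕ => (N : ℂ)) atTop).mul_isLittleO h1).trans_isBigO hb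
  rw [Asymptotics.isLittleO_one_iff] at h2
  have h3 := h2.add_const (p ^ 3 / 3)
  rw [zero_add] at h3
  refine h3.congr' ?_
  filter_upwards [hN] with N hN
  have h4 : (c : ℂ) * (N * (δ N : ℂ) ^ 3) = 1 := by exact_mod_cast hN
  linear_combination -p ^ 3 / 3 * h4

/-- The ratio `(1 - c * exp z) / (1 - c)`. -/
noncomputable def ratE (c : ℝ) (z : ℂ) : ℂ := (1 - c * Complex.exp z) / (1 - c)

theorem one_sub_ofReal_ne_zero {c : ℝ} (hc : c ≠ 1) : (1 - c : ℂ) ≠ 0 := by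
  rw [sub_ne_zero]
  exact_mod_cast hc.symm

theorem ratE_zero {c : ℝ} (hc : c ≠ 1) : ratE c 0 = 1 := by
  rw [ratE, Complex.exp_zero, mul_one, div_self (one_sub_ofReal_ne_zero hc)]

theorem continuous_ratE (c : ℝ) : Continuous (ratE c) := by
  unfold ratE; fun_prop

theorem eventually_ratE_mem_slitPlane {c : ℝ} (hc : c ≠ 1) :
    ∀ᶠ z in nhds 0, ratE c z ∈ Complex.slitPlane := by
  refine (continuous_ratE c).continuousAt.eventually
    (Complex.isOpen_slitPlane.mem_nhds ?_)
  rw [ratE_zero hc]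
  exact Complex.one_mem_slitPlane

/-- The logarithm of `ratE`. -/
noncomputable def logRat (c : ℝ) (z : ℂ) : ℂ := Complex.log (ratE c z)

theorem logRat_zero {c : ℝ} (hc : c ≠ 1) : logRat c 0 = 0 := by
  rw [logRat, ratE_zero hc, Complex.log_one]

theorem eventually_exp_logRat {c : ℝ} (hc : c ≠ 1) :
    ∀ᶠ z in nhds 0, Complex.exp (logRat c z) = ratE c z := by
  filter_upwards [eventually_ratE_mem_slitPlane hc] with z hz
  exact Complex.exp_log (Complex.slitPlane_ne_zero hz)

theorem eventually_hasDerivAt_logRat {c : ℝ} (hc : c ≠ 1) :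
    ∀ᶠ z in nhds 0,
      HasDerivAt (logRat c) (-(c * Complex.exp z) / (1 - c * Complex.exp z)) z := by
  filter_upwards [eventually_ratE_mem_slitPlane hc] with z hz
  have h1 : HasDerivAt (ratE c) (-(c * Complex.exp z) / (1 - c)) z :=
    (((Complex.hasDerivAt_exp z).const_mul (c : ℂ)).const_sub 1).div_const _
  refine (h1.clog hz).congr_deriv ?_
  have h2 := Complex.slitPlane_ne_zero hz
  have h3 := one_sub_ofReal_ne_zero hc
  rw [ratE] at h2 ⊢
  have h4 : (1 - c * Complex.exp z : ℂ) ≠ 0 := fun h => h2 (by rw [h, zero_div])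
  field_simp

theorem continuousAt_logRat {c : ℝ} (hc : c ≠ 1) : ContinuousAt (logRat c) 0 :=
  (eventually_hasDerivAt_logRat hc).self_of_nhds.continuousAt

theorem isLittleO_of_exp_sub_one_sq_mul {R : ℂ → ℂ} {l : ℂ} (hR : Tendsto R (nhds 0) (nhds l)) :
    (fun z => (Complex.exp z - 1) ^ 2 * R z - l * z ^ 2) =o[nhds 0] fun z => z ^ 2 := by
  have h1 : (fun z : ℂ => Complex.exp z - 1 - z) =o[nhds 0] fun z => z := by
    have := (Complex.hasDerivAt_exp 0).isLittleO
    simpa using this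
  have h2 : (fun z : ℂ => Complex.exp z - 1 + z) =O[nhds 0] fun z => z := by
    have := h1.isBigO.add ((Asymptotics.isBigO_refl (fun z : ℂ => z) (nhds 0)).const_mul_left 2)
    refine this.congr_left fun z => ?_
    ring
  have h3 : (fun z : ℂ => (Complex.exp z - 1) ^ 2 - z ^ 2) =o[nhds 0] fun z => z ^ 2 := by
    refine (h1.mul_isBigO h2).congr (fun z => ?_) fun z => ?_ <;> ring
  have h4 : (fun z => R z - l) =o[nhds 0] fun _ => (1 : ℂ) := by
    rw [Asymptotics.isLittleO_one_iff]
    simpa using hR.sub_const l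
  have h5 : R =O[nhds 0] fun _ => (1 : ℂ) := hR.isBigO_one ℂ
  have h6 := (h3.mul_isBigO h5).add
    ((Asymptotics.isBigO_refl (fun z : ℂ => z ^ 2) (nhds 0)).mul_isLittleO h4)
  refine h6.congr (fun z => ?_) fun z => ?_ <;> ring

/-- The double critical point of the saddle-point analysis. -/
noncomputable def zCrit (q g : ℝ) : ℝ := (1 + g) / (q + g)

/-- The dual critical point, `zCrit q g - 1`. -/
noncomputable def vCrit (q g : ℝ) : ℝ := (1 - q) / (q + g)

/-- The phase of the first family of coefficients around the critical point. -/
noncomputable def phaseA (q g : ℝ) (z : ℂ) : ℂ :=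
  -(g ^ 2 / q) * logRat (q * zCrit q g) z + logRat (zCrit q g) z - (1 + g) ^ 2 / (1 - q) * z

/-- The phase of the second family of coefficients around the critical point. -/
noncomputable def phaseB (q g : ℝ) (z : ℂ) : ℂ :=
  (1 + g) ^ 2 / (1 - q) * logRat (-vCrit q g) (-z) + g ^ 2 / q * logRat (q / (q + g)) (-z) + z

theorem zCrit_sub_one {q g : ℝ} (hq0 : 0 < q) (hg : 0 < g) : zCrit q g - 1 = vCrit q g := by
  unfold zCrit vCrit
  field_simp
  ring

theorem one_sub_mul_zCrit {q g : ℝ} (hq0 : 0 < q) (hg : 0 < g) :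
    1 - q * zCrit q g = g * vCrit q g := by
  unfold zCrit vCrit
  field_simp
  ring

theorem vCrit_pos {q g : ℝ} (hq0 : 0 < q) (hq1 : q < 1) (hg : 0 < g) : 0 < vCrit q g :=
  div_pos (sub_pos.mpr hq1) (by positivity)

theorem one_lt_zCrit {q g : ℝ} (hq0 : 0 < q) (hq1 : q < 1) (hg : 0 < g) : 1 < zCrit q g := by
  have := zCrit_sub_one hq0 hg
  have := vCrit_pos hq0 hq1 hg
  linarith

theorem mul_zCrit_lt_one {q g : ℝ} (hq0 : 0 < q) (hq1 : q < 1) (hg : 0 < g) :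
    q * zCrit q g < 1 := by
  have := one_sub_mul_zCrit hq0 hg
  have := mul_pos hg (vCrit_pos hq0 hq1 hg)
  linarith

theorem div_add_lt_one {q g : ℝ} (hq0 : 0 < q) (hg : 0 < g) : q / (q + g) < 1 := by
  rw [div_lt_one (by positivity)]
  linarith

theorem eventually_one_sub_mul_exp_ne_zero {c : ℝ} (hc : c ≠ 1) :
    ∀ᶠ z in nhds 0, (1 - c * Complex.exp z : ℂ) ≠ 0 := by
  filter_upwards [eventually_ratE_mem_slitPlane hc] with z hz h
  exact Complex.slitPlane_ne_zero hz (by rw [ratE, h, zero_div])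

theorem isLittleO_phaseA {q g : ℝ} (hq0 : 0 < q) (hq1 : q < 1) (hg : 0 < g) :
    (fun z => phaseA q g z -
      (((g + q) ^ 2 * (1 + g) ^ 2 / (g * (1 - q) ^ 3) : ℝ) : ℂ) / 3 * z ^ 3)
      =o[nhds 0] fun z => z ^ 3 := by
  have h1 := (one_lt_zCrit hq0 hq1 hg).ne'
  have h2 := (mul_zCrit_lt_one hq0 hq1 hg).ne
  have hq1' : (1 - q : ℂ) ≠ 0 := one_sub_ofReal_ne_zero hq1.ne
  have hq0' : (q : ℂ) ≠ 0 := by exact_mod_cast hq0.ne'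
  have hg' : (g : ℂ) ≠ 0 := by exact_mod_cast hg.ne'
  have hqg : (q + g : ℂ) ≠ 0 := by exact_mod_cast (add_pos hq0 hg).ne'
  have hlog : ∀ᶠ z in nhds 0, HasDerivAt (phaseA q g) ((Complex.exp z - 1) ^ 2 *
      ((1 + g) ^ 2 / (1 - q) / ((1 - ((q * zCrit q g : ℝ) : ℂ) * Complex.exp z) *
        (zCrit q g * Complex.exp z - 1)))) z := by
    filter_upwards [eventually_hasDerivAt_logRat h1, eventually_hasDerivAt_logRat h2,
      eventually_one_sub_mul_exp_ne_zero h1, eventually_one_sub_mul_exp_ne_zero h2]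
      with z h3 h4 h5 h6
    refine (((h4.const_mul (-(g ^ 2 / q : ℂ))).add h3).sub
      ((hasDerivAt_id z).const_mul ((1 + g) ^ 2 / (1 - q) : ℂ))).congr_deriv ?_
    have h7 : (zCrit q g * Complex.exp z - 1 : ℂ) ≠ 0 := by
      rw [← neg_ne_zero, neg_sub]
      exact h5
    generalize Complex.exp z = w at *
    rw [show (-(zCrit q g * w) / (1 - zCrit q g * w) : ℂ) =
      zCrit q g * w / (zCrit q g * w - 1) by rw [← neg_div_neg_eq]; ring]
    have hz : ((zCrit q g : ℝ) : ℂ) = (1 + g) / (q + g) := by simp [zCrit]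
    push_cast at h6 ⊢
    rw [hz] at h6 h7 ⊢
    have h8 : (q + g - q * (1 + g) * w : ℂ) ≠ 0 := by
      intro h
      apply h6
      field_simp
      linear_combination h
    have h9 : ((1 + g) * w - (q + g) : ℂ) ≠ 0 := by
      intro h
      apply h7
      field_simp
      linear_combination h
    rw [show (1 - q * ((1 + g) / (q + g)) * w : ℂ) = (q + g - q * (1 + g) * w) / (q + g) by
      field_simp, show ((1 + g) / (q + g) * w - 1 : ℂ) = ((1 + g) * w - (q + g)) / (q + g) by
      field_simp]
    field_simp
    ring
  refine isLittleO_sub_cube ?_ hlog (isLittleO_of_exp_sub_one_sq_mul ?_)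
  · simp [phaseA, logRat_zero h1, logRat_zero h2]
  · have hd : ((1 - ((q * zCrit q g : ℝ) : ℂ) * Complex.exp 0) *
        (zCrit q g * Complex.exp 0 - 1)) = ((g * vCrit q g ^ 2 : ℝ) : ℂ) := by
      rw [Complex.exp_zero, mul_one, mul_one]
      have h3 : ((1 - q * zCrit q g : ℝ) : ℂ) = (g * vCrit q g : ℝ) := by
        rw [one_sub_mul_zCrit hq0 hg]
      have h4 : ((zCrit q g - 1 : ℝ) : ℂ) = (vCrit q g : ℝ) := by
        rw [zCrit_sub_one hq0 hg]
      push_cast at h3 h4 ⊢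
      rw [h3, h4]
      ring
    have hv : (vCrit q g : ℂ) ≠ 0 := by exact_mod_cast (vCrit_pos hq0 hq1 hg).ne'
    have hlim : (((g + q) ^ 2 * (1 + g) ^ 2 / (g * (1 - q) ^ 3) : ℝ) : ℂ) =
        (1 + g) ^ 2 / (1 - q) / ((1 - ((q * zCrit q g : ℝ) : ℂ) * Complex.exp 0) *
        (zCrit q g * Complex.exp 0 - 1)) := by
      rw [hd, vCrit]
      push_cast
      field_simp
      ring
    rw [hlim]
    refine ContinuousAt.tendsto (x := (0 : ℂ)) (f := fun z : ℂ => ((1 + g) ^ 2 / (1 - q) /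
      ((1 - ((q * zCrit q g : ℝ) : ℂ) * Complex.exp z) * (zCrit q g * Complex.exp z - 1)) : ℂ)) ?_
    refine continuousAt_const.div (by fun_prop) ?_
    rw [hd]
    push_cast
    exact mul_ne_zero hg' (pow_ne_zero _ hv)

theorem isLittleO_phaseB {q g : ℝ} (hq0 : 0 < q) (hq1 : q < 1) (hg : 0 < g) :
    (fun z => phaseB q g z - (((g + q) ^ 2 / (g * (1 + g)) : ℝ) : ℂ) / 3 * z ^ 3)
      =o[nhds 0] fun z => z ^ 3 := by
  have h1 : -vCrit q g ≠ 1 := by linarith [vCrit_pos hq0 hq1 hg]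
  have h2 := (div_add_lt_one hq0 hg).ne
  have hq1' : (1 - q : ℂ) ≠ 0 := one_sub_ofReal_ne_zero hq1.ne
  have hq0' : (q : ℂ) ≠ 0 := by exact_mod_cast hq0.ne'
  have hg' : (g : ℂ) ≠ 0 := by exact_mod_cast hg.ne'
  have hqg : (q + g : ℂ) ≠ 0 := by exact_mod_cast (add_pos hq0 hg).ne'
  have hg1 : (1 + g : ℂ) ≠ 0 := by exact_mod_cast (add_pos one_pos hg).ne'
  have hneg : Tendsto (fun z : ℂ => -z) (nhds 0) (nhds 0) := by
    simpa using (continuous_neg (G := ℂ)).tendsto 0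
  have hlog : ∀ᶠ z in nhds 0, HasDerivAt (phaseB q g) ((Complex.exp z - 1) ^ 2 *
      (Complex.exp (-z) ^ 2 / ((1 - ((-vCrit q g : ℝ) : ℂ) * Complex.exp (-z)) *
        (1 - ((q / (q + g) : ℝ) : ℂ) * Complex.exp (-z))))) z := by
    filter_upwards [hneg.eventually (eventually_hasDerivAt_logRat h1),
      hneg.eventually (eventually_hasDerivAt_logRat h2),
      hneg.eventually (eventually_one_sub_mul_exp_ne_zero h1),
      hneg.eventually (eventually_one_sub_mul_exp_ne_zero h2)]
      with z h3 h4 h5 h6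
    have h3' := h3.scomp z (hasDerivAt_neg z)
    have h4' := h4.scomp z (hasDerivAt_neg z)
    refine (((h3'.const_mul ((1 + g) ^ 2 / (1 - q) : ℂ)).add
      (h4'.const_mul (g ^ 2 / q : ℂ))).add (hasDerivAt_id z)).congr_deriv ?_
    have hew : Complex.exp z * Complex.exp (-z) = 1 := by
      rw [← Complex.exp_add, add_neg_cancel, Complex.exp_zero]
    generalize Complex.exp (-z) = w at *
    generalize Complex.exp z = w' at *
    rw [← mul_div_assoc, ← mul_pow, sub_mul, hew, one_mul]
    have hv : ((vCrit q g : ℝ) : ℂ) = (1 - q) / (q + g) := by simp [vCrit]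
    push_cast at h5 h6 ⊢
    rw [hv] at h5 ⊢
    have h8 : (q + g + (1 - q) * w : ℂ) ≠ 0 := by
      intro h
      apply h5
      field_simp
      linear_combination h
    have h9 : (q + g - q * w : ℂ) ≠ 0 := by
      intro h
      apply h6
      field_simp
      linear_combination h
    rw [show (1 - -((1 - q) / (q + g)) * w : ℂ) = (q + g + (1 - q) * w) / (q + g) by
      field_simp; ring, show (1 - q / (q + g) * w : ℂ) = (q + g - q * w) / (q + g) by
      field_simp]
    simp only [smul_eq_mul]
    field_simp
    ring
  refine isLittleO_sub_cube ?_ hlog (isLittleO_of_exp_sub_one_sq_mul ?_)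
  · simp only [phaseB, neg_zero, logRat_zero h1, logRat_zero h2]
    simp
  · have hd : ((1 - ((-vCrit q g : ℝ) : ℂ) * Complex.exp (-0)) *
        (1 - ((q / (q + g) : ℝ) : ℂ) * Complex.exp (-0))) =
          (1 + g) / (q + g) * (g / (q + g)) := by
      rw [neg_zero, Complex.exp_zero, mul_one, mul_one, vCrit]
      push_cast
      field_simp
      ring
    have hlim : (((g + q) ^ 2 / (g * (1 + g)) : ℝ) : ℂ) =
        Complex.exp (-0) ^ 2 / ((1 - ((-vCrit q g : ℝ) : ℂ) * Complex.exp (-0)) *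
        (1 - ((q / (q + g) : ℝ) : ℂ) * Complex.exp (-0))) := by
      rw [hd, neg_zero, Complex.exp_zero]
      push_cast
      field_simp
      ring
    rw [hlim]
    refine ContinuousAt.tendsto (x := (0 : ℂ)) (f := fun z : ℂ =>
      (Complex.exp (-z) ^ 2 / ((1 - ((-vCrit q g : ℝ) : ℂ) * Complex.exp (-z)) *
        (1 - ((q / (q + g) : ℝ) : ℂ) * Complex.exp (-z))) : ℂ)) ?_
    refine ContinuousAt.div (by fun_prop) (by fun_prop) ?_
    rw [hd]
    exact mul_ne_zero (div_ne_zero hg1 hqg) (div_ne_zero hg' hqg)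

/-- The normalized integrand for the first family of coefficients. -/
noncomputable def sadA (q g : ℝ) (M N X : ℕ) (z : ℂ) : ℂ :=
  (ratE (q * zCrit q g) z)⁻¹ ^ M * ratE (zCrit q g) z ^ N * Complex.exp (-(z * (X + N)))

/-- The normalized integrand for the second family of coefficients. -/
noncomputable def sadB (q g : ℝ) (M N y : ℕ) (z : ℂ) : ℂ :=
  ratE (-vCrit q g) (-z) ^ (y + N - 1) * ratE (q / (q + g)) (-z) ^ M *
    Complex.exp (z * (N - 1))

/-- The admissible scalings: `δ N` is of order `N ^ (-1/3)` with the critical constant and `M N`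
is within distance one of `g ^ 2 / q * N`. -/
structure IsScaling (q g : ℝ) (δ : ℕ → ℝ) (M : ℕ → ℕ) : Prop where
  hq0 : 0 < q
  hq1 : q < 1
  hg : 0 < g
  hqg : q ≤ g ^ 2
  pos : ∀ᶠ N in atTop, 0 < δ N
  lim : Tendsto δ atTop (nhds 0)
  cube : ∀ᶠ N : ℕ in atTop,
    (g + q) ^ 2 * (1 + g) ^ 2 / (g * (1 - q) ^ 3) * (N * δ N ^ 3) = 1
  le : ∀ N, (M N : ℝ) ≤ g ^ 2 / q * N
  ge : ∀ N, g ^ 2 / q * N ≤ M N + 1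

/-- The centred and scaled lattice coordinate. -/
noncomputable def scaledPos (q g δ : ℝ) (N X : ℕ) : ℝ :=
  δ * (X + N - (1 + g) ^ 2 / (1 - q) * N)

theorem sadA_eq_exp {q g : ℝ} {z : ℂ} (M N X : ℕ)
    (h1 : Complex.exp (logRat (q * zCrit q g) z) = ratE (q * zCrit q g) z)
    (h2 : Complex.exp (logRat (zCrit q g) z) = ratE (zCrit q g) z) :
    sadA q g M N X z = Complex.exp (N * phaseA q g z +
      (g ^ 2 / q * N - M) * logRat (q * zCrit q g) z -
        z * (X + N - (1 + g) ^ 2 / (1 - q) * N)) := by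
  rw [sadA, ← h1, ← h2, ← Complex.exp_neg, ← Complex.exp_nat_mul, ← Complex.exp_nat_mul,
    ← Complex.exp_add, ← Complex.exp_add, phaseA]
  congr 1
  ring

theorem sadB_eq_exp {q g : ℝ} {z : ℂ} (M : ℕ) {N : ℕ} (hN : 0 < N) (y : ℕ)
    (h1 : Complex.exp (logRat (-vCrit q g) (-z)) = ratE (-vCrit q g) (-z))
    (h2 : Complex.exp (logRat (q / (q + g)) (-z)) = ratE (q / (q + g)) (-z)) :
    sadB q g M N y z = Complex.exp (N * phaseB q g z -
      (g ^ 2 / q * N - M) * logRat (q / (q + g)) (-z) - logRat (-vCrit q g) (-z) - z +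
        (y + N - (1 + g) ^ 2 / (1 - q) * N) * logRat (-vCrit q g) (-z)) := by
  rw [sadB, ← h1, ← h2, ← Complex.exp_nat_mul, ← Complex.exp_nat_mul,
    ← Complex.exp_add, ← Complex.exp_add, phaseB]
  congr 1
  rw [Nat.cast_sub (by omega)]
  push_cast
  ring

namespace IsScaling

variable {q g : ℝ} {δ : ℕ → ℝ} {M : ℕ → ℕ}

theorem ratio_pos (h : IsScaling q g δ M) : 0 < zCrit q g / vCrit q g :=
  div_pos (one_pos.trans (one_lt_zCrit h.hq0 h.hq1 h.hg)) (vCrit_pos h.hq0 h.hq1 h.hg)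

theorem tendsto_mul_const (h : IsScaling q g δ M) (p : ℂ) :
    Tendsto (fun N => (δ N : ℂ) * p) atTop (nhds 0) := by
  have h1 := (Complex.continuous_ofReal.tendsto 0).comp h.lim
  rw [Complex.ofReal_zero] at h1
  simpa using Tendsto.mul_const p h1

theorem lim' (h : IsScaling q g δ M) :
    Tendsto (fun N => δ N * (zCrit q g / vCrit q g)) atTop (nhds 0) := by
  simpa using h.lim.mul_const (zCrit q g / vCrit q g)

theorem tendsto_mul_const' (h : IsScaling q g δ M) (p : ℂ) :
    Tendsto (fun N => ((δ N * (zCrit q g / vCrit q g) : ℝ) : ℂ) * p) atTop (nhds 0) := by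
  have h1 := (Complex.continuous_ofReal.tendsto 0).comp h.lim'
  rw [Complex.ofReal_zero] at h1
  simpa using Tendsto.mul_const p h1

theorem cube' (h : IsScaling q g δ M) : ∀ᶠ N : ℕ in atTop,
    (g + q) ^ 2 / (g * (1 + g)) * (N * (δ N * (zCrit q g / vCrit q g)) ^ 3) = 1 := by
  filter_upwards [h.cube] with N hN
  refine Eq.trans ?_ hN
  rw [zCrit, vCrit]
  have := h.hq0
  have := h.hg
  have : 1 - q ≠ 0 := (sub_pos.mpr h.hq1).ne'
  field_simp

theorem tendsto_frac_mul (h : IsScaling q g δ M) {F : ℕ → ℂ} (hF : Tendsto F atTop (nhds 0)) :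
    Tendsto (fun N : ℕ => (g ^ 2 / q * N - M N : ℂ) * F N) atTop (nhds 0) := by
  refine squeeze_zero_norm (fun N => ?_) (tendsto_zero_iff_norm_tendsto_zero.mp hF)
  rw [norm_mul]
  refine mul_le_of_le_one_left (norm_nonneg _) ?_
  have h1 := h.le N
  have h2 := h.ge N
  rw [show (g ^ 2 / q * N - M N : ℂ) = ((g ^ 2 / q * N - M N : ℝ) : ℂ) by push_cast; rfl,
    Complex.norm_real, Real.norm_eq_abs, abs_le]
  constructor <;> linarith

/-- The part of the exponent of `sadA` which does not depend on the position. -/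
theorem tendsto_exponentA (h : IsScaling q g δ M) (p : ℂ) :
    Tendsto (fun N : ℕ => N * phaseA q g (δ N * p) +
      (g ^ 2 / q * N - M N) * logRat (q * zCrit q g) (δ N * p)) atTop (nhds (p ^ 3 / 3)) := by
  have h1 := tendsto_mul_of_sub_cube (isLittleO_phaseA h.hq0 h.hq1 h.hg) h.lim h.cube p
  have hne := (mul_zCrit_lt_one h.hq0 h.hq1 h.hg).ne
  have h2 := (continuousAt_logRat hne).tendsto.comp (h.tendsto_mul_const p)
  rw [logRat_zero hne] at h2
  simpa using h1.add (h.tendsto_frac_mul h2)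

/-- The part of the exponent of `sadB` which does not depend on the position. -/
theorem tendsto_exponentB (h : IsScaling q g δ M) (p : ℂ) :
    Tendsto (fun N : ℕ =>
      N * phaseB q g ((δ N * (zCrit q g / vCrit q g) : ℝ) * p) -
      (g ^ 2 / q * N - M N) *
        logRat (q / (q + g)) (-((δ N * (zCrit q g / vCrit q g) : ℝ) * p)) -
      logRat (-vCrit q g) (-((δ N * (zCrit q g / vCrit q g) : ℝ) * p)) -
      (δ N * (zCrit q g / vCrit q g) : ℝ) * p) atTop (nhds (p ^ 3 / 3)) := by
  have h1 := tendsto_mul_of_sub_cube (isLittleO_phaseB h.hq0 h.hq1 h.hg) h.lim' h.cube' p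
  have hne := (div_add_lt_one h.hq0 h.hg).ne
  have hne' : -vCrit q g ≠ 1 := by linarith [vCrit_pos h.hq0 h.hq1 h.hg]
  have h0 := (h.tendsto_mul_const' p).neg
  rw [neg_zero] at h0
  have h2 := (continuousAt_logRat hne).tendsto.comp h0
  have h3 := (continuousAt_logRat hne').tendsto.comp h0
  rw [logRat_zero hne] at h2
  rw [logRat_zero hne'] at h3
  simpa using ((h1.sub (h.tendsto_frac_mul h2)).sub h3).sub (h.tendsto_mul_const' p)

theorem tendsto_logRat_div (h : IsScaling q g δ M) (p : ℂ) :
    Tendsto (fun N : ℕ => (δ N : ℂ)⁻¹ *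
      logRat (-vCrit q g) (-((δ N * (zCrit q g / vCrit q g) : ℝ) * p))) atTop (nhds (-p)) := by
  have hv := vCrit_pos h.hq0 h.hq1 h.hg
  have hz := one_lt_zCrit h.hq0 h.hq1 h.hg
  have hne' : -vCrit q g ≠ 1 := by linarith
  have hd := (eventually_hasDerivAt_logRat hne').self_of_nhds
  have hlin : HasDerivAt (fun t : ℝ => -(((t * (zCrit q g / vCrit q g) : ℝ) : ℂ) * p))
      (-(((zCrit q g / vCrit q g : ℝ) : ℂ) * p)) 0 := by
    have h1 := ((hasDerivAt_id (0 : ℝ)).mul_const (zCrit q g / vCrit q g)).ofReal_comp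
    simpa using (h1.mul_const p).fun_neg
  have hlin0 : -(((0 * (zCrit q g / vCrit q g) : ℝ) : ℂ) * p) = 0 := by simp
  have hcomp := HasDerivAt.scomp (0 : ℝ) (hlin0.symm ▸ hd) hlin
  rw [hasDerivAt_iff_tendsto_slope_zero] at hcomp
  have hδ : Tendsto δ atTop (nhdsWithin 0 {0}ᶜ) := by
    rw [tendsto_nhdsWithin_iff]
    refine ⟨h.lim, ?_⟩
    filter_upwards [h.pos] with N hN using hN.ne'
  have h2 := hcomp.comp hδ
  have hval : (-(((zCrit q g / vCrit q g : ℝ) : ℂ) * p)) •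
      (-(((-vCrit q g : ℝ) : ℂ) * Complex.exp 0) / (1 - ((-vCrit q g : ℝ) : ℂ) * Complex.exp 0)) =
      -p := by
    have h3 : (1 - ((-vCrit q g : ℝ) : ℂ) * Complex.exp 0) = (zCrit q g : ℂ) := by
      rw [Complex.exp_zero, mul_one, ← Complex.ofReal_one, ← Complex.ofReal_sub,
        ← zCrit_sub_one h.hq0 h.hg]
      congr 1
      ring
    have h4 : (zCrit q g : ℂ) ≠ 0 := by exact_mod_cast (one_pos.trans hz).ne'
    have h5 : (vCrit q g : ℂ) ≠ 0 := by exact_mod_cast hv.ne'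
    rw [h3, Complex.exp_zero, smul_eq_mul]
    push_cast
    field_simp
  rw [hlin0, hval] at h2
  refine h2.congr fun N => ?_
  simp [logRat_zero hne']

theorem tendsto_sadA (h : IsScaling q g δ M) {X : ℕ → ℕ} {ξ : ℝ}
    (hX : Tendsto (fun N => scaledPos q g (δ N) N (X N)) atTop (nhds ξ)) (p : ℂ) :
    Tendsto (fun N => sadA q g (M N) N (X N) (δ N * p)) atTop
      (nhds (Complex.exp (p ^ 3 / 3 - ξ * p))) := by
  have h1 := (Complex.continuous_ofReal.tendsto ξ).comp hX
  have h2 := (h.tendsto_exponentA p).sub (h1.mul_const p)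
  refine ((Complex.continuous_exp.tendsto _).comp h2).congr' ?_
  filter_upwards [(h.tendsto_mul_const p).eventually
      (eventually_exp_logRat (mul_zCrit_lt_one h.hq0 h.hq1 h.hg).ne),
    (h.tendsto_mul_const p).eventually
      (eventually_exp_logRat (one_lt_zCrit h.hq0 h.hq1 h.hg).ne')] with N h3 h4
  rw [sadA_eq_exp _ _ _ h3 h4]
  simp only [Function.comp_apply, scaledPos]
  congr 1
  push_cast
  ring

theorem eventually_exp_logRat_neg (h : IsScaling q g δ M) (p : ℂ) {c : ℝ} (hc : c ≠ 1) :
    ∀ᶠ N in atTop, Complex.exp (logRat c (-((δ N * (zCrit q g / vCrit q g) : ℝ) * p))) =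
      ratE c (-((δ N * (zCrit q g / vCrit q g) : ℝ) * p)) := by
  have h0 := (h.tendsto_mul_const' p).neg
  rw [neg_zero] at h0
  exact h0.eventually (eventually_exp_logRat hc)

theorem tendsto_sadB (h : IsScaling q g δ M) {y : ℕ → ℕ} {ξ : ℝ}
    (hy : Tendsto (fun N => scaledPos q g (δ N) N (y N)) atTop (nhds ξ)) (p : ℂ) :
    Tendsto (fun N => sadB q g (M N) N (y N) ((δ N * (zCrit q g / vCrit q g) : ℝ) * p)) atTop
      (nhds (Complex.exp (p ^ 3 / 3 - ξ * p))) := by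
  have h1 := (Complex.continuous_ofReal.tendsto ξ).comp hy
  have h2 := (h.tendsto_exponentB p).add (h1.mul (h.tendsto_logRat_div p))
  rw [mul_neg, ← sub_eq_add_neg] at h2
  refine ((Complex.continuous_exp.tendsto _).comp h2).congr' ?_
  filter_upwards [h.eventually_exp_logRat_neg p (c := -vCrit q g)
      (by linarith [vCrit_pos h.hq0 h.hq1 h.hg]),
    h.eventually_exp_logRat_neg p (div_add_lt_one h.hq0 h.hg).ne, h.pos,
    eventually_gt_atTop 0] with N h3 h4 h5 h6
  rw [sadB_eq_exp _ h6 _ h3 h4]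
  have h7 : (δ N : ℂ) ≠ 0 := by exact_mod_cast h5.ne'
  simp only [Function.comp_apply, scaledPos]
  congr 2
  push_cast
  field_simp

theorem norm_sadA_le (h : IsScaling q g δ M) : ∀ᶠ N in atTop, ∀ X : ℕ,
    ‖sadA q g (M N) N X (δ N)‖ ≤ Real.exp (1 - scaledPos q g (δ N) N X) := by
  have h0 := (Complex.continuous_re.tendsto _).comp (h.tendsto_exponentA 1)
  have h0' := h0.eventually_lt_const (u := 1) (by norm_num)
  filter_upwards [(h.tendsto_mul_const 1).eventually
      (eventually_exp_logRat (mul_zCrit_lt_one h.hq0 h.hq1 h.hg).ne),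
    (h.tendsto_mul_const 1).eventually
      (eventually_exp_logRat (one_lt_zCrit h.hq0 h.hq1 h.hg).ne'), h0'] with N h3 h4 h5 X
  simp only [mul_one, Function.comp_apply] at h3 h4 h5
  rw [sadA_eq_exp _ _ _ h3 h4, Complex.norm_exp, Complex.sub_re,
    show (δ N * (X + N - (1 + g) ^ 2 / (1 - q) * N) : ℂ) = (scaledPos q g (δ N) N X : ℝ) by
      rw [scaledPos]; push_cast; rfl, Complex.ofReal_re]
  gcongr

theorem norm_sadB_le (h : IsScaling q g δ M) (s : ℝ) : ∀ᶠ N in atTop, ∀ y : ℕ,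
    s ≤ scaledPos q g (δ N) N y →
    ‖sadB q g (M N) N y (δ N * (zCrit q g / vCrit q g) : ℝ)‖ ≤
      Real.exp (1 + 3 * |s| - scaledPos q g (δ N) N y / 2) := by
  have h0 := (Complex.continuous_re.tendsto _).comp (h.tendsto_exponentB 1)
  have h0' := h0.eventually_lt_const (u := 1) (by norm_num)
  have h1 := (Complex.continuous_re.tendsto _).comp (h.tendsto_logRat_div 1)
  have h1' := h1.eventually_lt_const (u := -(1 / 2)) (by norm_num)
  have h1'' := h1.eventually_const_lt (u := -2) (by norm_num)
  filter_upwards [h.eventually_exp_logRat_neg 1 (c := -vCrit q g)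
      (by linarith [vCrit_pos h.hq0 h.hq1 h.hg]),
    h.eventually_exp_logRat_neg 1 (div_add_lt_one h.hq0 h.hg).ne, h.pos,
    eventually_gt_atTop 0, h0', h1', h1''] with N h3 h4 h5 h6 h7 h8 h9 y hy
  simp only [mul_one, Function.comp_apply] at h3 h4 h7 h8 h9
  have h10 : (δ N : ℂ) ≠ 0 := by exact_mod_cast h5.ne'
  set r := (δ N : ℂ)⁻¹ * logRat (-vCrit q g) (-(δ N * (zCrit q g / vCrit q g) : ℝ)) with hr
  rw [sadB_eq_exp _ h6 _ h3 h4, Complex.norm_exp, Complex.add_re,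
    show (y + N - (1 + g) ^ 2 / (1 - q) * N : ℂ) *
      logRat (-vCrit q g) (-(δ N * (zCrit q g / vCrit q g) : ℝ)) =
      (scaledPos q g (δ N) N y : ℝ) * r by
      rw [scaledPos, hr]; push_cast; field_simp, Complex.re_ofReal_mul]
  refine Real.exp_le_exp.mpr ?_
  generalize scaledPos q g (δ N) N y = x at *
  have h11 : x * r.re ≤ 3 * |s| - x / 2 := by
    rcases le_total 0 x with hx | hx
    · nlinarith [abs_nonneg s]
    · nlinarith [neg_abs_le s]
  linarith

end IsScaling

theorem norm_one_sub_mul_exp_sq (a θ : ℝ) :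
    ‖(1 - a * Complex.exp (θ * Complex.I) : ℂ)‖ ^ 2 = (1 - a) ^ 2 + 2 * a * (1 - Real.cos θ) := by
  rw [← Complex.normSq_eq_norm_sq, Complex.exp_mul_I, ← Complex.ofReal_cos, ← Complex.ofReal_sin,
    Complex.normSq_apply]
  simp only [Complex.sub_re, Complex.sub_im, Complex.mul_re, Complex.mul_im, Complex.add_re,
    Complex.add_im, Complex.ofReal_re, Complex.ofReal_im, Complex.I_re, Complex.I_im,
    Complex.one_re, Complex.one_im]
  linear_combination a ^ 2 * Real.sin_sq_add_cos_sq θ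

theorem norm_ratE_sq {c x : ℝ} (h : 1 - c * Real.exp x ≠ 0) (θ : ℝ) :
    ‖ratE c (x + θ * Complex.I)‖ ^ 2 = ‖ratE c x‖ ^ 2 *
      (1 + 2 * (c * Real.exp x) / (1 - c * Real.exp x) ^ 2 * (1 - Real.cos θ)) := by
  have h1 : (c * Complex.exp (x + θ * Complex.I) : ℂ) =
      ((c * Real.exp x : ℝ) : ℂ) * Complex.exp (θ * Complex.I) := by
    rw [Complex.exp_add]
    push_cast
    ring
  have h2 : (1 - c * Complex.exp x : ℂ) = ((1 - c * Real.exp x : ℝ) : ℂ) := by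
    push_cast
    rfl
  rw [ratE, ratE, norm_div, norm_div, div_pow, div_pow, h1, norm_one_sub_mul_exp_sq, h2,
    Complex.norm_real, Real.norm_eq_abs, sq_abs, div_mul_eq_mul_div]
  congr 1
  field_simp

theorem pow_le_pow_mul_exp {γ X₁ X₂ s : ℝ} (hγ : 1 ≤ γ) (hX₂ : 0 ≤ X₂) (hX₁ : 0 ≤ X₁)
    (hs : 0 ≤ s) (hs2 : s ≤ 2) (hX : X₁ ≤ γ * X₂) {M N : ℕ} (hM : γ * N ≤ M + 1) :
    (1 + X₁ * s) ^ N ≤ (1 + X₂ * s) ^ M *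
      ((1 + 2 * X₂) * Real.exp (-(N * ((γ * X₂ - X₁) * s / (1 + 2 * (γ * X₂)))))) := by
  have hγX : 0 ≤ γ * X₂ := by positivity
  have hb : (1 : ℝ) ≤ 1 + X₂ * s := by nlinarith [mul_nonneg hX₂ hs]
  set u := (γ * X₂ - X₁) * s / (1 + 2 * (γ * X₂)) with hu
  have h1 : 1 + X₁ * s ≤ (1 + γ * X₂ * s) * Real.exp (-u) := by
    have h2 : u * (1 + 2 * (γ * X₂)) = (γ * X₂ - X₁) * s := by rw [hu]; field_simp
    have h3 : 0 ≤ u := by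
      have := mul_nonneg (sub_nonneg.mpr hX) hs
      positivity
    have h4 := Real.add_one_le_exp (-u)
    have h5 : γ * X₂ * s ≤ 2 * (γ * X₂) := by nlinarith
    calc 1 + X₁ * s ≤ (1 + γ * X₂ * s) * (-u + 1) := by nlinarith
      _ ≤ _ := by gcongr
  have h6 : (1 + γ * X₂ * s) ^ N ≤ (1 + X₂ * s) ^ (M + 1) := by
    have h7 : 1 + γ * X₂ * s ≤ (1 + X₂ * s) ^ γ := by
      have := one_add_mul_self_le_rpow_one_add (s := X₂ * s) (by linarith) hγ
      linarith
    calc (1 + γ * X₂ * s) ^ N ≤ ((1 + X₂ * s) ^ γ) ^ N := by gcongr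
      _ = (1 + X₂ * s) ^ (γ * N) := by
        rw [← Real.rpow_natCast, ← Real.rpow_mul (by linarith)]
      _ ≤ (1 + X₂ * s) ^ ((M : ℝ) + 1) := Real.rpow_le_rpow_of_exponent_le hb hM
      _ = _ := by exact_mod_cast Real.rpow_natCast _ (M + 1)
  calc (1 + X₁ * s) ^ N ≤ ((1 + γ * X₂ * s) * Real.exp (-u)) ^ N := by gcongr
    _ = (1 + γ * X₂ * s) ^ N * Real.exp (-(N * u)) := by
      rw [mul_pow, ← Real.exp_nat_mul, mul_neg]
    _ ≤ (1 + X₂ * s) ^ (M + 1) * Real.exp (-(N * u)) := by gcongr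
    _ = (1 + X₂ * s) ^ M * ((1 + X₂ * s) * Real.exp (-(N * u))) := by ring
    _ ≤ _ := by
      have : 1 + X₂ * s ≤ 1 + 2 * X₂ := by nlinarith
      gcongr

theorem le_curvatureA {q g a : ℝ} (hq0 : 0 < q) (hq1 : q < 1) (hg : 0 < g)
    (ha : zCrit q g ≤ a) (ha' : q * a < 1) (ha2 : a ≤ 2 * zCrit q g) :
    g * vCrit q g / (2 * zCrit q g ^ 2) * ((g + q) * a - (1 + g)) ≤
      g ^ 2 / q * (2 * (q * a) / (1 - q * a) ^ 2) - 2 * a / (1 - a) ^ 2 := by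
  have hz := one_lt_zCrit hq0 hq1 hg
  have hv := vCrit_pos hq0 hq1 hg
  have hzv := zCrit_sub_one hq0 hg
  have h1 : 0 < 1 - q * a := by linarith
  have h2 : 0 < a - 1 := by linarith
  have h3 : 0 ≤ (g + q) * a - (1 + g) := by
    have : (g + q) * zCrit q g = 1 + g := by unfold zCrit; field_simp; ring
    nlinarith [mul_le_mul_of_nonneg_left ha (add_pos hg hq0).le]
  have h4 : g ^ 2 / q * (2 * (q * a) / (1 - q * a) ^ 2) - 2 * a / (1 - a) ^ 2 =
      2 * a * (g * (a - 1) + (1 - q * a)) / ((1 - q * a) ^ 2 * (a - 1) ^ 2) *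
        ((g + q) * a - (1 + g)) := by
    rw [show (1 - a) ^ 2 = (a - 1) ^ 2 by ring]
    field_simp
    ring
  rw [h4]
  refine mul_le_mul_of_nonneg_right ?_ h3
  rw [div_le_div_iff₀ (by positivity) (by positivity)]
  have h5 : (1 - q * a) ^ 2 * (a - 1) ^ 2 ≤ 1 * (2 * zCrit q g) ^ 2 := by
    have h6 : 0 < q * a := by have := one_pos.trans hz; have := this.trans_le ha; positivity
    gcongr
    · exact pow_le_one₀ h1.le (by linarith)
    · linarith
  have h7 : g * vCrit q g ≤ a * (g * (a - 1) + (1 - q * a)) := by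
    have h8 : g * vCrit q g ≤ g * (a - 1) + (1 - q * a) := by nlinarith
    have h9 : 0 < g * vCrit q g := mul_pos hg hv
    nlinarith
  calc _ ≤ g * vCrit q g * (1 * (2 * zCrit q g) ^ 2) := by
        have := (mul_pos hg hv).le
        gcongr
    _ ≤ a * (g * (a - 1) + (1 - q * a)) * (1 * (2 * zCrit q g) ^ 2) := by gcongr
    _ = _ := by ring

theorem le_curvatureB {q g w : ℝ} (hq0 : 0 < q) (hq1 : q < 1) (hg : 0 < g)
    (hw : 1 / 2 ≤ w) (hw1 : w ≤ 1) :
    g / ((q + g) * zCrit q g ^ 2) * (1 - w) ≤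
      (1 + g) ^ 2 / (1 - q) * (2 * (vCrit q g * w) / (1 + vCrit q g * w) ^ 2) -
        g ^ 2 / q * (2 * (q / (q + g) * w) / (1 - q / (q + g) * w) ^ 2) := by
  have hz := one_lt_zCrit hq0 hq1 hg
  have hv := vCrit_pos hq0 hq1 hg
  have hzv := zCrit_sub_one hq0 hg
  have hq1' : 0 < 1 - q := sub_pos.mpr hq1
  have hc := div_add_lt_one hq0 hg
  have hc0 : 0 < q / (q + g) := by positivity
  have h1 : 0 < 1 - q / (q + g) * w := by nlinarith
  have h2 : 0 < 1 + vCrit q g * w := by nlinarith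
  have h4 : (1 + g) ^ 2 / (1 - q) * (2 * (vCrit q g * w) / (1 + vCrit q g * w) ^ 2) -
        g ^ 2 / q * (2 * (q / (q + g) * w) / (1 - q / (q + g) * w) ^ 2) =
      2 * w / (q + g) * ((1 + g) * (1 - q / (q + g) * w) + g * (1 + vCrit q g * w)) /
        ((1 - q / (q + g) * w) ^ 2 * (1 + vCrit q g * w) ^ 2) * (1 - w) := by
    have h5 : (1 + g) * (1 - q / (q + g) * w) - g * (1 + vCrit q g * w) = 1 - w := by
      unfold vCrit
      field_simp
      ring
    rw [← h5]
    have h6 : (1 + g) ^ 2 / (1 - q) * (2 * (vCrit q g * w) / (1 + vCrit q g * w) ^ 2) =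
        (1 + g) ^ 2 * (2 * w) / ((q + g) * (1 + vCrit q g * w) ^ 2) := by
      rw [show 2 * (vCrit q g * w) = (1 - q) * (2 * w) / (q + g) by unfold vCrit; ring]
      field_simp
    have h7 : g ^ 2 / q * (2 * (q / (q + g) * w) / (1 - q / (q + g) * w) ^ 2) =
        g ^ 2 * (2 * w) / ((q + g) * (1 - q / (q + g) * w) ^ 2) := by
      generalize 1 - q / (q + g) * w = d at *
      field_simp
    rw [h6, h7]
    generalize 1 - q / (q + g) * w = d at *
    generalize 1 + vCrit q g * w = e at *
    field_simp
    ring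
  rw [h4]
  refine mul_le_mul_of_nonneg_right ?_ (by linarith)
  have h8 : g ≤ 2 * w * ((1 + g) * (1 - q / (q + g) * w) + g * (1 + vCrit q g * w)) := by
    have h9 : g ≤ (1 + g) * (1 - q / (q + g) * w) + g * (1 + vCrit q g * w) := by
      have hw0 : 0 < w := by linarith
      linarith [mul_pos (add_pos one_pos hg) h1, mul_pos hg (mul_pos hv hw0)]
    nlinarith
  have h9 : (1 - q / (q + g) * w) ^ 2 * (1 + vCrit q g * w) ^ 2 ≤ 1 * zCrit q g ^ 2 := by
    gcongr
    · exact pow_le_one₀ h1.le (by nlinarith)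
    · nlinarith
  rw [div_mul_eq_mul_div, div_div, div_le_div_iff₀ (by positivity) (by positivity)]
  calc _ ≤ 2 * w * ((1 + g) * (1 - q / (q + g) * w) + g * (1 + vCrit q g * w)) *
        ((q + g) * (1 * zCrit q g ^ 2)) := by gcongr
    _ = _ := by ring

theorem pow_mul_pow_le_exp {X Y s : ℝ} (hs : 0 ≤ s) (hX : 0 ≤ X) (hY : Y * s ≤ 1) (K M : ℕ) :
    (1 - Y * s) ^ K * (1 + X * s) ^ M ≤ Real.exp (-((Y * K - X * M) * s)) := by
  have h1 : 1 - Y * s ≤ Real.exp (-(Y * s)) := by linarith [Real.add_one_le_exp (-(Y * s))]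
  have h2 : 1 + X * s ≤ Real.exp (X * s) := by linarith [Real.add_one_le_exp (X * s)]
  calc _ ≤ Real.exp (-(Y * s)) ^ K * Real.exp (X * s) ^ M := by
        gcongr
    _ = _ := by
        rw [← Real.exp_nat_mul, ← Real.exp_nat_mul, ← Real.exp_add]
        congr 1
        ring

theorem le_one_sub_cos {θ : ℝ} (h : |θ| ≤ Real.pi) :
    2 / Real.pi ^ 2 * θ ^ 2 ≤ 1 - Real.cos θ := by
  linarith [Real.cos_le_one_sub_mul_cos_sq h]

theorem norm_sadA_sq_eq {q g δ : ℝ} (hz : 1 < zCrit q g) (hq0 : 0 < q) (hδ : 0 ≤ δ)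
    (hδ' : q * zCrit q g * Real.exp δ < 1) (M N X : ℕ) (t : ℝ) :
    ‖sadA q g M N X (δ * (1 - Complex.I * t))‖ ^ 2 *
      (1 + 2 * (q * zCrit q g * Real.exp δ) / (1 - q * zCrit q g * Real.exp δ) ^ 2 *
        (1 - Real.cos (δ * t))) ^ M =
    ‖sadA q g M N X δ‖ ^ 2 *
      (1 + 2 * (zCrit q g * Real.exp δ) / (1 - zCrit q g * Real.exp δ) ^ 2 *
        (1 - Real.cos (δ * t))) ^ N := by
  have hexp := Real.one_le_exp hδ
  have hne : 1 - q * zCrit q g * Real.exp δ ≠ 0 := by linarith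
  have hne' : 1 - zCrit q g * Real.exp δ ≠ 0 := by nlinarith
  have harg : (δ * (1 - Complex.I * t) : ℂ) = δ + ((-(δ * t) : ℝ) : ℂ) * Complex.I := by
    push_cast
    ring
  have hpow : ∀ z : ℂ, ‖sadA q g M N X z‖ ^ 2 = (‖ratE (q * zCrit q g) z‖ ^ 2)⁻¹ ^ M *
      (‖ratE (zCrit q g) z‖ ^ 2) ^ N * ‖Complex.exp (-(z * (X + N)))‖ ^ 2 := by
    intro z
    rw [sadA, norm_mul, norm_mul, norm_pow, norm_pow, norm_inv]
    ring
  have hexpo : ‖Complex.exp (-((δ + ((-(δ * t) : ℝ) : ℂ) * Complex.I) * (X + N)))‖ =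
      ‖Complex.exp (-((δ : ℂ) * (X + N)))‖ := by
    simp [Complex.norm_exp]
  have hs : 0 ≤ 1 - Real.cos (δ * t) := by linarith [Real.cos_le_one (δ * t)]
  have hz0 : 0 < zCrit q g := one_pos.trans hz
  rw [harg, hpow, hpow, hexpo, norm_ratE_sq hne, norm_ratE_sq hne', Real.cos_neg]
  set u := 1 + 2 * (q * zCrit q g * Real.exp δ) / (1 - q * zCrit q g * Real.exp δ) ^ 2 *
        (1 - Real.cos (δ * t)) with hu
  have hu0 : u ^ M ≠ 0 := by positivity
  rw [mul_inv, mul_pow, mul_pow, inv_pow u]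
  field_simp

theorem norm_sadB_sq_eq {q g δ : ℝ} (hv : 0 < vCrit q g) (hq0 : 0 < q) (hg : 0 < g) (hδ : 0 ≤ δ)
    (M N y : ℕ) (t : ℝ) :
    ‖sadB q g M N y (δ * (1 - Complex.I * t))‖ ^ 2 =
    ‖sadB q g M N y δ‖ ^ 2 *
      ((1 - 2 * (vCrit q g * Real.exp (-δ)) / (1 + vCrit q g * Real.exp (-δ)) ^ 2 *
        (1 - Real.cos (δ * t))) ^ (y + N - 1) *
      (1 + 2 * (q / (q + g) * Real.exp (-δ)) / (1 - q / (q + g) * Real.exp (-δ)) ^ 2 *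
        (1 - Real.cos (δ * t))) ^ M) := by
  have hexp : Real.exp (-δ) ≤ 1 := Real.exp_le_one_iff.mpr (by linarith)
  have hexp0 := Real.exp_pos (-δ)
  have hc := div_add_lt_one hq0 hg
  have hc0 : 0 < q / (q + g) := by positivity
  have hne : 1 - q / (q + g) * Real.exp (-δ) ≠ 0 := by nlinarith
  have hne' : 1 - -vCrit q g * Real.exp (-δ) ≠ 0 := by nlinarith
  have harg : (-(δ * (1 - Complex.I * t)) : ℂ) =
      ((-δ : ℝ) : ℂ) + ((δ * t : ℝ) : ℂ) * Complex.I := by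
    push_cast
    ring
  have hpow : ∀ z : ℂ, ‖sadB q g M N y z‖ ^ 2 = (‖ratE (-vCrit q g) (-z)‖ ^ 2) ^ (y + N - 1) *
      (‖ratE (q / (q + g)) (-z)‖ ^ 2) ^ M * ‖Complex.exp (z * (N - 1))‖ ^ 2 := by
    intro z
    rw [sadB, norm_mul, norm_mul, norm_pow, norm_pow]
    ring
  have hexpo : ‖Complex.exp (δ * (1 - Complex.I * t) * (N - 1))‖ =
      ‖Complex.exp ((δ : ℂ) * (N - 1))‖ := by
    simp [Complex.norm_exp]
  rw [hpow, hpow, hexpo, harg, norm_ratE_sq hne, norm_ratE_sq hne', mul_pow, mul_pow,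
    Complex.ofReal_neg]
  rw [show 1 - -vCrit q g * Real.exp (-δ) = 1 + vCrit q g * Real.exp (-δ) by ring,
    show 2 * (-vCrit q g * Real.exp (-δ)) / (1 + vCrit q g * Real.exp (-δ)) ^ 2 =
      -(2 * (vCrit q g * Real.exp (-δ)) / (1 + vCrit q g * Real.exp (-δ)) ^ 2) by ring]
  ring

namespace IsScaling

variable {q g : ℝ} {δ : ℕ → ℝ} {M : ℕ → ℕ}

theorem exists_norm_sadA_sq_le (h : IsScaling q g δ M) :
    ∃ c > 0, ∃ C, ∀ᶠ N in atTop, ∀ (X : ℕ) (t : ℝ), |δ N * t| ≤ Real.pi →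
      ‖sadA q g (M N) N X (δ N * (1 - Complex.I * t))‖ ^ 2 ≤
        ‖sadA q g (M N) N X (δ N)‖ ^ 2 * (C * Real.exp (-(c * t ^ 2))) := by
  have hq0 := h.hq0
  have hg := h.hg
  have hz := one_lt_zCrit hq0 h.hq1 hg
  have hz0 : 0 < zCrit q g := one_pos.trans hz
  have hv := vCrit_pos hq0 h.hq1 hg
  have hqz := mul_zCrit_lt_one hq0 h.hq1 hg
  have hγ : 1 ≤ g ^ 2 / q := (one_le_div hq0).mpr h.hqg
  set G := fun x : ℝ => 2 * (q * zCrit q g * Real.exp x) / (1 - q * zCrit q g * Real.exp x) ^ 2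
    with hG
  have hG0 : ContinuousAt G 0 := by
    refine ContinuousAt.div (by fun_prop) (by fun_prop) ?_
    rw [Real.exp_zero, mul_one]
    have : 0 < 1 - q * zCrit q g := by linarith
    positivity
  set B := G 0 + 1 with hB
  have hG0' : 0 ≤ G 0 := by positivity
  have hev1 := (hG0.tendsto.comp h.lim).eventually_lt_const (lt_add_one (G 0))
  have hev2 : ∀ᶠ N in atTop, q * zCrit q g * Real.exp (δ N) < 1 := by
    have h1 : ContinuousAt (fun x => q * zCrit q g * Real.exp x) 0 := by fun_prop
    refine (h1.tendsto.comp h.lim).eventually_lt_const ?_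
    rwa [Real.exp_zero, mul_one]
  have hev3 : ∀ᶠ N in atTop, Real.exp (δ N) < 2 := by
    refine ((Real.continuous_exp.tendsto 0).comp h.lim).eventually_lt_const ?_
    rw [Real.exp_zero]
    norm_num
  set κ := (g + q) ^ 2 * (1 + g) ^ 2 / (g * (1 - q) ^ 3) with hκ
  have hκ0 : 0 < κ := by have := sub_pos.mpr h.hq1; positivity
  set c₀ := g * vCrit q g / (2 * zCrit q g ^ 2) * (1 + g) with hc₀
  have hc₀0 : 0 < c₀ := by positivity
  refine ⟨c₀ * (2 / Real.pi ^ 2) / κ / (1 + 2 * (g ^ 2 / q * B)), by positivity,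
    1 + 2 * B, ?_⟩
  filter_upwards [hev1, hev2, hev3, h.cube, h.pos] with N h1 h2 h3 h4 h5 X t ht
  have hG1 : G (δ N) ≤ B := h1.le
  have hGp : 0 ≤ G (δ N) := by positivity
  have hs0 : 0 ≤ 1 - Real.cos (δ N * t) := by linarith [Real.cos_le_one (δ N * t)]
  have hs2 : 1 - Real.cos (δ N * t) ≤ 2 := by linarith [Real.neg_one_le_cos (δ N * t)]
  have hexp := Real.add_one_le_exp (δ N)
  have hcurv := le_curvatureA hq0 h.hq1 hg (a := zCrit q g * Real.exp (δ N)) (by nlinarith)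
    (by linarith) (by nlinarith)
  rw [← mul_assoc q] at hcurv
  have hlin : (g + q) * (zCrit q g * Real.exp (δ N)) - (1 + g) =
      (1 + g) * (Real.exp (δ N) - 1) := by
    unfold zCrit
    field_simp
    ring
  have hD : c₀ * δ N ≤ g ^ 2 / q * G (δ N) -
      2 * (zCrit q g * Real.exp (δ N)) / (1 - zCrit q g * Real.exp (δ N)) ^ 2 := by
    refine le_trans ?_ hcurv
    rw [hlin, hc₀, mul_assoc]
    gcongr
    linarith
  have hkey := pow_le_pow_mul_exp hγ hGp (X₁ := 2 * (zCrit q g * Real.exp (δ N)) /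
    (1 - zCrit q g * Real.exp (δ N)) ^ 2) (by positivity) hs0 hs2
    (by nlinarith [mul_pos hc₀0 h5]) (h.ge N)
  have heq := norm_sadA_sq_eq hz hq0 h5.le h2 (M N) N X t
  have hpos : 0 < (1 + G (δ N) * (1 - Real.cos (δ N * t))) ^ M N := by positivity
  rw [← mul_le_mul_iff_left₀ hpos, heq, mul_assoc]
  refine mul_le_mul_of_nonneg_left (hkey.trans ?_) (sq_nonneg _)
  rw [mul_comm]
  refine mul_le_mul_of_nonneg_right ?_ hpos.le
  have hexpo : c₀ * (2 / Real.pi ^ 2) / κ / (1 + 2 * (g ^ 2 / q * B)) * t ^ 2 ≤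
      N * ((g ^ 2 / q * G (δ N) - 2 * (zCrit q g * Real.exp (δ N)) /
        (1 - zCrit q g * Real.exp (δ N)) ^ 2) * (1 - Real.cos (δ N * t)) /
        (1 + 2 * (g ^ 2 / q * G (δ N)))) := by
    have hNδ : N * δ N ^ 3 = 1 / κ := by
      field_simp
      linarith
    calc _ = (N * (c₀ * δ N * (2 / Real.pi ^ 2 * (δ N * t) ^ 2))) /
          (1 + 2 * (g ^ 2 / q * B)) := by
          rw [show (N * (c₀ * δ N * (2 / Real.pi ^ 2 * (δ N * t) ^ 2)) : ℝ) =
            c₀ * (2 / Real.pi ^ 2) * (N * δ N ^ 3) * t ^ 2 by ring, hNδ]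
          ring
      _ ≤ (N * ((g ^ 2 / q * G (δ N) - 2 * (zCrit q g * Real.exp (δ N)) /
        (1 - zCrit q g * Real.exp (δ N)) ^ 2) * (1 - Real.cos (δ N * t)))) /
        (1 + 2 * (g ^ 2 / q * G (δ N))) := by
          have := le_one_sub_cos ht
          have h0 : 0 ≤ c₀ * δ N := by positivity
          gcongr
          · exact mul_nonneg (Nat.cast_nonneg N) (mul_nonneg (h0.trans hD) hs0)
          · exact h0.trans hD
      _ = _ := by rw [mul_div_assoc]
  gcongr

theorem exists_norm_sadB_sq_le (h : IsScaling q g δ M) (s : ℝ) :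
    ∃ c > 0, ∀ᶠ N in atTop, ∀ (y : ℕ) (t : ℝ), s ≤ scaledPos q g (δ N) N y →
      |δ N * (zCrit q g / vCrit q g) * t| ≤ Real.pi →
      ‖sadB q g (M N) N y ((δ N * (zCrit q g / vCrit q g) : ℝ) * (1 - Complex.I * t))‖ ^ 2 ≤
        ‖sadB q g (M N) N y (δ N * (zCrit q g / vCrit q g) : ℝ)‖ ^ 2 *
          Real.exp (-(c * t ^ 2)) := by
  have hq0 := h.hq0
  have hg := h.hg
  have hz := one_lt_zCrit hq0 h.hq1 hg
  have hz0 : 0 < zCrit q g := one_pos.trans hz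
  have hv := vCrit_pos hq0 h.hq1 hg
  have hq1' := sub_pos.mpr h.hq1
  have hr := h.ratio_pos
  have hc1 := div_add_lt_one hq0 hg
  set κ := (g + q) ^ 2 / (g * (1 + g)) with hκ
  have hκ0 : 0 < κ := by positivity
  set r := zCrit q g / vCrit q g with hrdef
  set c₀ := g / ((q + g) * zCrit q g ^ 2) * (1 / 2) with hc₀
  have hc₀0 : 0 < c₀ := by positivity
  have hev1 : ∀ᶠ N in atTop, δ N * r < 1 / 2 := h.lim'.eventually_lt_const (by norm_num)
  have hev2 : ∀ᶠ N in atTop, δ N < 1 := h.lim.eventually_lt_const (by norm_num)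
  have hev3 : ∀ᶠ N in atTop, κ * (|s| + 1) * δ N * r ^ 2 < c₀ / 2 := by
    have := (h.lim.const_mul (κ * (|s| + 1))).mul_const (r ^ 2)
    rw [mul_zero, zero_mul] at this
    exact this.eventually_lt_const (by positivity)
  refine ⟨c₀ / 2 * (2 / Real.pi ^ 2) / κ, by positivity, ?_⟩
  filter_upwards [hev1, hev2, hev3, h.cube', h.pos, eventually_gt_atTop 0]
    with N h1 h2 h3 h4 h5 h6 y t hy ht
  set d := δ N * r with hd
  have hd0 : 0 < d := by positivity
  rw [norm_sadB_sq_eq hv hq0 hg hd0.le]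
  refine mul_le_mul_of_nonneg_left ?_ (sq_nonneg _)
  have hs0 : 0 ≤ 1 - Real.cos (d * t) := by linarith [Real.cos_le_one (d * t)]
  have hs2 : 1 - Real.cos (d * t) ≤ 2 := by linarith [Real.neg_one_le_cos (d * t)]
  have hw1 : Real.exp (-d) ≤ 1 := Real.exp_le_one_iff.mpr (by linarith)
  have hw0 := Real.add_one_le_exp (-d)
  have hw2 : 1 - Real.exp (-d) ≥ 1 / 2 * d := by
    have h7 := Real.add_one_le_exp d
    have h8 : Real.exp (-d) * Real.exp d = 1 := by rw [← Real.exp_add]; simp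
    nlinarith [Real.exp_pos (-d)]
  have hcurv := le_curvatureB hq0 h.hq1 hg (w := Real.exp (-d)) (by linarith) hw1
  set Y := 2 * (vCrit q g * Real.exp (-d)) / (1 + vCrit q g * Real.exp (-d)) ^ 2 with hY
  set Z := 2 * (q / (q + g) * Real.exp (-d)) / (1 - q / (q + g) * Real.exp (-d)) ^ 2 with hZ
  have hY0 : 0 ≤ Y := by positivity
  have hZ0 : 0 ≤ Z := by positivity
  have hY1 : Y ≤ 1 / 2 := by
    rw [hY, div_le_div_iff₀ (by positivity) (by norm_num)]
    nlinarith [sq_nonneg (1 - vCrit q g * Real.exp (-d))]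
  refine (pow_mul_pow_le_exp hs0 hZ0 (by nlinarith) _ _).trans (Real.exp_le_exp.mpr ?_)
  rw [neg_le_neg_iff]
  have hD : c₀ * d ≤ (1 + g) ^ 2 / (1 - q) * Y - g ^ 2 / q * Z := by
    refine le_trans ?_ hcurv
    rw [hc₀, mul_assoc]
    gcongr
  have hK : ((y + N - 1 : ℕ) : ℝ) ≥ (1 + g) ^ 2 / (1 - q) * N - (|s| + 1) / δ N := by
    rw [Nat.cast_sub (by omega)]
    push_cast
    rw [scaledPos] at hy
    have h7 : s / δ N ≤ y + N - (1 + g) ^ 2 / (1 - q) * N := by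
      rw [div_le_iff₀ h5]
      linarith
    have h8 : -(|s|) / δ N ≤ s / δ N := by
      gcongr
      exact neg_abs_le s
    have h9 : 1 ≤ 1 / δ N := by rw [le_div_iff₀ h5]; linarith
    rw [add_div]
    rw [neg_div] at h8
    linarith
  have hNd : N * d ^ 3 = 1 / κ := by
    field_simp
    linarith
  have hsmall : (|s| + 1) / δ N ≤ c₀ / 2 * (N * d) := by
    rw [div_le_iff₀ h5]
    have h7 : (N * d : ℝ) = 1 / (κ * d ^ 2) := by
      rw [← div_div, ← hNd]
      field_simp
    rw [h7, mul_assoc, one_div_mul_eq_div, ← mul_div_assoc, le_div_iff₀ (by positivity)]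
    have h8 : (|s| + 1) * (κ * d ^ 2) = κ * (|s| + 1) * δ N * r ^ 2 * δ N := by
      rw [hd]; ring
    rw [h8]
    exact mul_le_mul_of_nonneg_right h3.le h5.le
  have hfin : c₀ / 2 * (N * d) ≤ Y * ((y + N - 1 : ℕ) : ℝ) - Z * M N := by
    have h7 : Y * ((1 + g) ^ 2 / (1 - q) * N - (|s| + 1) / δ N) ≤ Y * ((y + N - 1 : ℕ) : ℝ) :=
      mul_le_mul_of_nonneg_left hK hY0
    have h8 : Z * M N ≤ Z * (g ^ 2 / q * N) := mul_le_mul_of_nonneg_left (h.le N) hZ0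
    have h9 : Y * ((|s| + 1) / δ N) ≤ 1 * (c₀ / 2 * (N * d)) := by gcongr; linarith
    have h10 : N * (c₀ * d) ≤ N * ((1 + g) ^ 2 / (1 - q) * Y - g ^ 2 / q * Z) := by gcongr
    linarith
  calc _ = c₀ / 2 * (N * d) * (2 / Real.pi ^ 2 * (d * t) ^ 2) := by
        rw [show c₀ / 2 * (N * d) * (2 / Real.pi ^ 2 * (d * t) ^ 2) =
          c₀ / 2 * (2 / Real.pi ^ 2) * (N * d ^ 3) * t ^ 2 by ring, hNd]
        ring
    _ ≤ _ := by
        have h7 := le_one_sub_cos ht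
        have h8 : 0 ≤ c₀ / 2 * (N * d) := by positivity
        gcongr
        linarith

end IsScaling

theorem circCoef_eq_integral {ρ d : ℝ} (hd : d ≠ 0) (f : ℂ → ℂ) (m : ℤ) :
    circCoef f (ρ * Real.exp d) m = d / (2 * Real.pi) * ∫ t in -(Real.pi / d)..(Real.pi / d),
      f (ρ * Complex.exp (d * (1 - Complex.I * t))) *
        (ρ * Complex.exp (d * (1 - Complex.I * t))) ^ (-m) := by
  have hpt : ∀ t : ℝ, (ρ * Complex.exp (d * (1 - Complex.I * t)) : ℂ) =
      circPt (ρ * Real.exp d) (-d * t) := by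
    intro t
    rw [circPt, Complex.ofReal_mul, mul_assoc, Complex.ofReal_exp, ← Complex.exp_add]
    congr 2
    push_cast
    ring
  simp only [hpt]
  rw [intervalIntegral.integral_comp_mul_left
    (fun θ => f (circPt (ρ * Real.exp d) θ) * circPt (ρ * Real.exp d) θ ^ (-m)) (neg_ne_zero.mpr hd),
    circCoef, intervalIntegral.integral_symm]
  have h1 : -d * (Real.pi / d) = -Real.pi := by field_simp
  have h2 : -d * -(Real.pi / d) = Real.pi := by field_simp
  have hd' : (d : ℂ) ≠ 0 := by exact_mod_cast hd
  rw [h1, h2, Complex.real_smul]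
  push_cast
  field_simp

/-- The normalizing constant relating the two families of coefficients. -/
noncomputable def critConst (q g : ℝ) (M N : ℕ) : ℝ :=
  ((1 - q * zCrit q g) / (1 - q)) ^ M * (zCrit q g / vCrit q g) ^ N

/-- The rescaled first family of coefficients. -/
noncomputable def normA (q g δ : ℝ) (M N X : ℕ) : ℝ :=
  δ⁻¹ * critConst q g M N * zCrit q g ^ X * aCoef q M N X

/-- The rescaled second family of coefficients. -/
noncomputable def normB (q g δ : ℝ) (M N y : ℕ) : ℝ :=
  δ⁻¹ * (critConst q g M N)⁻¹ * (zCrit q g ^ y)⁻¹ * bCoef q M N y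

theorem critConst_pos {q g : ℝ} (hq0 : 0 < q) (hq1 : q < 1) (hg : 0 < g) (M N : ℕ) :
    0 < critConst q g M N := by
  have h1 := mul_zCrit_lt_one hq0 hq1 hg
  have h2 := one_lt_zCrit hq0 hq1 hg
  have h3 := vCrit_pos hq0 hq1 hg
  have h4 : 0 < 1 - q * zCrit q g := by linarith
  have h5 : 0 < 1 - q := by linarith
  unfold critConst
  positivity

theorem normA_mul_normB {q g δ : ℝ} (hq0 : 0 < q) (hq1 : q < 1) (hg : 0 < g) (M N X y : ℕ) :
    normA q g δ M N X * normB q g δ M N y =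
      δ⁻¹ ^ 2 * (zCrit q g ^ X * (zCrit q g ^ y)⁻¹) * (aCoef q M N X * bCoef q M N y) := by
  have h := (critConst_pos hq0 hq1 hg M N).ne'
  unfold normA normB
  field_simp

theorem normA_eq_integral {q g δ : ℝ} (hq0 : 0 < q) (hq1 : q < 1) (hg : 0 < g) (hδ : 0 < δ)
    (hsmall : q * zCrit q g * Real.exp δ < 1) (M N X : ℕ) :
    (normA q g δ M N X : ℂ) = 1 / (2 * Real.pi) * ∫ t in -(Real.pi / δ)..(Real.pi / δ),
      sadA q g M N X (δ * (1 - Complex.I * t)) := by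
  have hz : 0 < zCrit q g := one_pos.trans (one_lt_zCrit hq0 hq1 hg)
  have hv := vCrit_pos hq0 hq1 hg
  have hvz := zCrit_sub_one hq0 hg
  have hu : 0 < 1 - q * zCrit q g := by linarith [mul_zCrit_lt_one hq0 hq1 hg]
  have hq1' : 0 < 1 - q := by linarith
  rw [normA, Complex.ofReal_mul, aCoef_eq_circCoef (r := zCrit q g * Real.exp δ) (by positivity)
    hq0 (by linarith), circCoef_eq_integral hδ.ne']
  have hzC : (zCrit q g : ℂ) ≠ 0 := by exact_mod_cast hz.ne'
  have hvC : (vCrit q g : ℂ) ≠ 0 := by exact_mod_cast hv.ne'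
  have huC : (1 - q * zCrit q g : ℂ) ≠ 0 := by exact_mod_cast hu.ne'
  have hqC : (1 - q : ℂ) ≠ 0 := by exact_mod_cast hq1'.ne'
  have hδC : (δ : ℂ) ≠ 0 := by exact_mod_cast hδ.ne'
  have hzv : (1 - zCrit q g : ℂ) = -vCrit q g := by
    rw [← hvz]; push_cast; ring
  have hint : ∀ t : ℝ,
      ((1 - q * (zCrit q g * Complex.exp (δ * (1 - Complex.I * t))))⁻¹ ^ M *
        ((1 - (1 : ℝ) * (zCrit q g * Complex.exp (δ * (1 - Complex.I * t)))) ^ N * 1)) *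
        (zCrit q g * Complex.exp (δ * (1 - Complex.I * t))) ^ (-((X : ℤ) + N)) =
      ((1 - q * zCrit q g : ℂ)⁻¹ ^ M * (-vCrit q g) ^ N * ((zCrit q g : ℂ) ^ (X + N))⁻¹) *
        sadA q g M N X (δ * (1 - Complex.I * t)) := by
    intro t
    rw [sadA]
    set z : ℂ := δ * (1 - Complex.I * t) with hzdef
    have h1 : (1 - q * (zCrit q g * Complex.exp z) : ℂ) =
        (1 - q * zCrit q g) * ratE (q * zCrit q g) z := by
      rw [ratE]; push_cast; field_simp
    have h2 : (1 - (1 : ℝ) * (zCrit q g * Complex.exp z) : ℂ) =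
        -vCrit q g * ratE (zCrit q g) z := by
      rw [ratE, hzv]; push_cast; field_simp
    have h3 : (zCrit q g * Complex.exp z) ^ (-((X : ℤ) + N)) =
        ((zCrit q g : ℂ) ^ (X + N))⁻¹ * Complex.exp (-(z * (X + N))) := by
      rw [zpow_neg, ← Nat.cast_add, zpow_natCast, mul_pow, mul_inv, ← Complex.exp_nat_mul,
        ← Complex.exp_neg]
      push_cast
      rw [mul_comm z]
    rw [h1, h2, h3, mul_inv]
    ring
  simp only [hint]
  rw [intervalIntegral.integral_const_mul]
  unfold critConst
  push_cast
  rw [neg_pow (vCrit q g : ℂ)]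
  generalize ∫ t in -(Real.pi / δ)..(Real.pi / δ), sadA q g M N X (δ * (1 - Complex.I * t)) = J
  have hs : ((-1 : ℂ) ^ N) * (-1) ^ N = 1 := by rw [← mul_pow]; simp
  rw [show ∀ a b c d e f k l m n o: ℂ, a * (b * c) * d * (e * f * (k * (l * (m * n) * o * J))) =
    (e * m) * (a * (b * c) * d * (f * (k * (l * n * o * J)))) by intros; ring, hs]
  rw [div_pow, div_pow, inv_pow, pow_add]
  field_simp

theorem normB_eq_integral {q g δ : ℝ} (hq0 : 0 < q) (hq1 : q < 1) (hg : 0 < g) (hδ : 0 < δ)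
    (M : ℕ) {N : ℕ} (hN : 0 < N) (y : ℕ) :
    (normB q g δ M N y : ℂ) = 1 / (2 * Real.pi) *
      ∫ t in -(Real.pi / (δ * (zCrit q g / vCrit q g)))..(Real.pi / (δ * (zCrit q g / vCrit q g))),
      sadB q g M N y ((δ * (zCrit q g / vCrit q g) : ℝ) * (1 - Complex.I * t)) := by
  have hz : 0 < zCrit q g := one_pos.trans (one_lt_zCrit hq0 hq1 hg)
  have hv := vCrit_pos hq0 hq1 hg
  have hvz := zCrit_sub_one hq0 hg
  have hu : 0 < 1 - q * zCrit q g := by linarith [mul_zCrit_lt_one hq0 hq1 hg]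
  have hq1' : 0 < 1 - q := by linarith
  have hqv : q / (1 - q) * vCrit q g = q / (q + g) := by
    have : 0 < q + g := by positivity
    rw [vCrit]; field_simp
  have hqg : 1 - q / (q + g) = (1 - q * zCrit q g) / (1 - q) := by
    have : 0 < q + g := by positivity
    rw [one_sub_mul_zCrit hq0 hg, vCrit]; field_simp; ring
  set d := δ * (zCrit q g / vCrit q g) with hd
  have hd0 : 0 < d := by positivity
  rw [normB, Complex.ofReal_mul, bCoef_eq_circCoef (r := vCrit q g * Real.exp (-d)) (by positivity)
    q M hN, circCoef_eq_integral (neg_ne_zero.mpr hd0.ne')]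
  have hzC : (zCrit q g : ℂ) ≠ 0 := by exact_mod_cast hz.ne'
  have hvC : (vCrit q g : ℂ) ≠ 0 := by exact_mod_cast hv.ne'
  have huC : (1 - q * zCrit q g : ℂ) ≠ 0 := by exact_mod_cast hu.ne'
  have hqC : (1 - q : ℂ) ≠ 0 := by exact_mod_cast hq1'.ne'
  have hδC : (δ : ℂ) ≠ 0 := by exact_mod_cast hδ.ne'
  have hvzC : (1 + vCrit q g : ℂ) = zCrit q g := by
    rw [← hvz]; push_cast; ring
  have hint : ∀ t : ℝ,
      ((1 - ((-1 : ℝ) : ℂ) * (vCrit q g * Complex.exp ((-d : ℝ) * (1 - Complex.I * t)))) ^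
          (y + N - 1) *
        ((1 - ((q / (1 - q) : ℝ) : ℂ) *
          (vCrit q g * Complex.exp ((-d : ℝ) * (1 - Complex.I * t)))) ^ M * 1)) *
        (vCrit q g * Complex.exp ((-d : ℝ) * (1 - Complex.I * t))) ^ (-((N : ℤ) - 1)) =
      ((zCrit q g : ℂ) ^ (y + N - 1) * ((1 - q * zCrit q g) / (1 - q)) ^ M *
        ((vCrit q g : ℂ) ^ (N - 1))⁻¹) * sadB q g M N y (d * (1 - Complex.I * t)) := by
    intro t
    rw [sadB]
    rw [show ((-d : ℝ) * (1 - Complex.I * t) : ℂ) = -(d * (1 - Complex.I * t)) by push_cast; ring]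
    set z : ℂ := d * (1 - Complex.I * t) with hzdef
    have h1 : (1 - ((-1 : ℝ) : ℂ) * (vCrit q g * Complex.exp (-z))) =
        zCrit q g * ratE (-vCrit q g) (-z) := by
      rw [ratE]; push_cast; rw [sub_neg_eq_add, hvzC]; field_simp
    have h2 : (1 - ((q / (1 - q) : ℝ) : ℂ) * (vCrit q g * Complex.exp (-z))) =
        ((1 - q * zCrit q g) / (1 - q)) * ratE (q / (q + g)) (-z) := by
      have e1 : ((1 - q * zCrit q g) / (1 - q) : ℂ) = 1 - (q / (q + g) : ℝ) := by
        exact_mod_cast hqg.symm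
      have e2 : (1 - (q / (q + g) : ℝ) : ℂ) ≠ 0 := by
        rw [← e1]; exact div_ne_zero huC hqC
      rw [ratE, e1, ← mul_assoc, ← Complex.ofReal_mul, hqv]
      field_simp
    have h3 : (vCrit q g * Complex.exp (-z)) ^ (-((N : ℤ) - 1)) =
        ((vCrit q g : ℂ) ^ (N - 1))⁻¹ * Complex.exp (z * (N - 1)) := by
      rw [zpow_neg, show (N : ℤ) - 1 = ((N - 1 : ℕ) : ℤ) by omega, zpow_natCast, mul_pow, mul_inv,
        ← Complex.exp_nat_mul, ← Complex.exp_neg]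
      congr 2
      rw [Nat.cast_sub (by omega)]
      push_cast
      ring
    rw [h1, h2, h3, mul_pow, mul_pow]
    ring
  simp only [hint]
  rw [intervalIntegral.integral_const_mul, div_neg, neg_neg, intervalIntegral.integral_symm]
  unfold critConst
  push_cast
  generalize ∫ t in -(Real.pi / d)..(Real.pi / d), sadB q g M N y (d * (1 - Complex.I * t)) = J
  obtain ⟨n, rfl⟩ : ∃ n, N = n + 1 := ⟨N - 1, by omega⟩
  rw [show y + (n + 1) - 1 = y + n by omega, show n + 1 - 1 = n by omega, hd]
  push_cast
  rw [div_pow (zCrit q g : ℂ), pow_succ, pow_succ, pow_add]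
  have hw : ((1 - q * zCrit q g) / (1 - q) : ℂ) ^ M ≠ 0 := pow_ne_zero _ (div_ne_zero huC hqC)
  generalize ((1 - q * zCrit q g) / (1 - q) : ℂ) ^ M = w at *
  field_simp

theorem integral_exp_neg_mul_sq_bound {f : ℝ → ℂ} {T c K : ℝ} (hT : 0 ≤ T) (hc : 0 < c) (hK : 0 ≤ K)
    (hf : ∀ t, |t| ≤ T → ‖f t‖ ≤ K * Real.exp (-c * t ^ 2)) :
    ‖∫ t in -T..T, f t‖ ≤ K * Real.sqrt (Real.pi / c) := by
  have hi := (integrable_exp_neg_mul_sq hc).const_mul K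
  calc _ ≤ ∫ t in -T..T, K * Real.exp (-c * t ^ 2) := by
        refine intervalIntegral.norm_integral_le_of_norm_le (by linarith)
          (ae_of_all _ fun t ht => hf t (abs_le.mpr ⟨ht.1.le, ht.2⟩)) hi.intervalIntegrable
    _ ≤ ∫ t, K * Real.exp (-c * t ^ 2) := by
        rw [intervalIntegral.integral_of_le (by linarith)]
        exact setIntegral_le_integral hi (ae_of_all _ fun t => by positivity)
    _ = _ := by rw [integral_const_mul, integral_gaussian]

theorem tendsto_intervalIntegral_of_gaussian_bound {φ : ℕ → ℝ → ℂ} {f : ℝ → ℂ} {T : ℕ → ℝ}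
    {c K : ℝ} (hc : 0 < c) (hT : Tendsto T atTop atTop) (hφ : ∀ N, Continuous (φ N))
    (hb : ∀ᶠ N in atTop, ∀ t, |t| ≤ T N → ‖φ N t‖ ≤ K * Real.exp (-c * t ^ 2))
    (hlim : ∀ t, Tendsto (fun N => φ N t) atTop (nhds (f t))) :
    Tendsto (fun N => ∫ t in -(T N)..T N, φ N t) atTop (nhds (∫ t, f t)) := by
  have hev : ∀ᶠ N in atTop, ∫ t, (Set.Ioc (-(T N)) (T N)).indicator (φ N) t =
      ∫ t in -(T N)..T N, φ N t := by
    filter_upwards [hT.eventually_ge_atTop 0] with N hN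
    rw [integral_indicator measurableSet_Ioc, intervalIntegral.integral_of_le (by linarith)]
  refine Tendsto.congr' hev ?_
  refine tendsto_integral_filter_of_dominated_convergence (fun t => |K| * Real.exp (-c * t ^ 2))
    (Eventually.of_forall fun N =>
      ((hφ N).measurable.indicator measurableSet_Ioc).aestronglyMeasurable) ?_
    ((integrable_exp_neg_mul_sq hc).const_mul _) (ae_of_all _ fun t => ?_)
  · filter_upwards [hb] with N hN
    refine ae_of_all _ fun t => ?_
    by_cases ht : t ∈ Set.Ioc (-(T N)) (T N)
    · rw [Set.indicator_of_mem ht]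
      exact (hN t (abs_le.mpr ⟨ht.1.le, ht.2⟩)).trans
        (mul_le_mul_of_nonneg_right (le_abs_self K) (Real.exp_pos _).le)
    · rw [Set.indicator_of_notMem ht, norm_zero]
      positivity
  · refine (hlim t).congr' ?_
    filter_upwards [hT.eventually_gt_atTop |t|] with N hN
    rw [Set.indicator_of_mem]
    have := abs_lt.mp hN
    exact ⟨this.1, this.2.le⟩

theorem ratE_ne_zero {c : ℝ} {z : ℂ} (h : |c| * Real.exp z.re < 1) (hc : c ≠ 1) : ratE c z ≠ 0 := by
  refine div_ne_zero (fun h0 => ?_) (one_sub_ofReal_ne_zero hc)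
  have h1 := congrArg norm (sub_eq_zero.mp h0)
  rw [norm_one, norm_mul, Complex.norm_exp, Complex.norm_real, Real.norm_eq_abs] at h1
  linarith

theorem continuous_sadA {q g d : ℝ} (hq0 : 0 < q) (hq1 : q < 1) (hg : 0 < g)
    (hd : q * zCrit q g * Real.exp d < 1) (M N X : ℕ) :
    Continuous fun t : ℝ => sadA q g M N X (d * (1 - Complex.I * t)) := by
  have hz : 0 < zCrit q g := one_pos.trans (one_lt_zCrit hq0 hq1 hg)
  have h1 : Continuous fun t : ℝ => ratE (q * zCrit q g) (d * (1 - Complex.I * t)) :=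
    (continuous_ratE _).comp (by fun_prop)
  have h2 : Continuous fun t : ℝ => ratE (zCrit q g) (d * (1 - Complex.I * t)) :=
    (continuous_ratE _).comp (by fun_prop)
  have h3 := h1.inv₀ fun t => ratE_ne_zero
    (by simpa [abs_of_pos hq0, abs_of_pos hz] using hd) (mul_zCrit_lt_one hq0 hq1 hg).ne
  unfold sadA
  exact ((h3.pow M).mul (h2.pow N)).mul (by fun_prop)

theorem continuous_sadB (q g d : ℝ) (M N y : ℕ) :
    Continuous fun t : ℝ => sadB q g M N y (d * (1 - Complex.I * t)) := by
  have h1 : Continuous fun t : ℝ => ratE (-vCrit q g) (-(d * (1 - Complex.I * t))) :=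
    (continuous_ratE _).comp (by fun_prop)
  have h2 : Continuous fun t : ℝ => ratE (q / (q + g)) (-(d * (1 - Complex.I * t))) :=
    (continuous_ratE _).comp (by fun_prop)
  unfold sadB
  fun_prop

theorem Ai_eq_of_ofReal_tendsto {a : ℕ → ℝ} {ξ : ℝ}
    (h : Tendsto (fun N => (a N : ℂ)) atTop
      (nhds (1 / (2 * Real.pi) * ∫ t : ℝ, Complex.exp ((1 - Complex.I * t) ^ 3 / 3 -
        ξ * (1 - Complex.I * t))))) :
    Tendsto a atTop (nhds (Ai ξ)) := by
  have h1 := (Complex.continuous_re.tendsto _).comp h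
  have h2 : (1 / (2 * Real.pi) : ℂ) = ((1 / (2 * Real.pi) : ℝ) : ℂ) := by push_cast; rfl
  rw [h2, Complex.re_ofReal_mul] at h1
  rw [Ai_eq, airyMoment]
  simpa [airyIntegrand, Function.comp_def] using h1

theorem le_of_sq_le_mul_exp {a b e C : ℝ} (hb : 0 ≤ b) (hC : 0 ≤ C)
    (h : a ^ 2 ≤ b ^ 2 * (C * Real.exp (-e))) :
    a ≤ b * (Real.sqrt C * Real.exp (-(e / 2))) := by
  refine abs_le_of_sq_le_sq' ?_ (by positivity) |>.2
  rw [mul_pow, mul_pow, Real.sq_sqrt hC, ← Real.exp_nat_mul]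
  rw [show ((2 : ℕ) : ℝ) * -(e / 2) = -e by push_cast; ring]
  exact h

namespace IsScaling

variable {q g : ℝ} {δ : ℕ → ℝ} {M : ℕ → ℕ}

theorem eventually_lt_one (h : IsScaling q g δ M) :
    ∀ᶠ N in atTop, q * zCrit q g * Real.exp (δ N) < 1 := by
  have h1 : Tendsto (fun N => q * zCrit q g * Real.exp (δ N)) atTop
      (nhds (q * zCrit q g * Real.exp 0)) :=
    ((Real.continuous_exp.tendsto 0).comp h.lim).const_mul _
  rw [Real.exp_zero, mul_one] at h1
  exact h1.eventually_lt_const (mul_zCrit_lt_one h.hq0 h.hq1 h.hg)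

theorem exists_norm_sadA_le (h : IsScaling q g δ M) : ∃ c > 0, ∃ C, 0 ≤ C ∧ ∀ᶠ N in atTop,
    ∀ (X : ℕ) (t : ℝ), |t| ≤ Real.pi / δ N →
      ‖sadA q g (M N) N X (δ N * (1 - Complex.I * t))‖ ≤
        C * Real.exp (-scaledPos q g (δ N) N X) * Real.exp (-c * t ^ 2) := by
  obtain ⟨c, hc, C, hC⟩ := h.exists_norm_sadA_sq_le
  refine ⟨c / 2, by positivity, Real.exp 1 * Real.sqrt (max C 0), by positivity, ?_⟩
  filter_upwards [hC, h.norm_sadA_le, h.pos] with N h1 h2 h3 X t ht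
  rw [le_div_iff₀ h3, ← abs_of_pos h3, ← abs_mul, mul_comm] at ht
  have h4 : ‖sadA q g (M N) N X (δ N * (1 - Complex.I * t))‖ ^ 2 ≤
      ‖sadA q g (M N) N X (δ N)‖ ^ 2 * (max C 0 * Real.exp (-(c * t ^ 2))) := by
    refine (h1 X t ht).trans ?_
    gcongr
    exact le_max_left _ _
  refine (le_of_sq_le_mul_exp (norm_nonneg _) (le_max_right _ _) h4).trans ?_
  calc _ ≤ Real.exp (1 - scaledPos q g (δ N) N X) *
        (Real.sqrt (max C 0) * Real.exp (-(c * t ^ 2 / 2))) := by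
        gcongr
        exact h2 X
    _ = _ := by
        rw [sub_eq_add_neg, Real.exp_add, show -(c / 2) * t ^ 2 = -(c * t ^ 2 / 2) by ring]
        ring

theorem exists_norm_sadB_le (h : IsScaling q g δ M) (s : ℝ) : ∃ c > 0, ∃ C, 0 ≤ C ∧
    ∀ᶠ N in atTop, ∀ (y : ℕ) (t : ℝ), s ≤ scaledPos q g (δ N) N y →
      |t| ≤ Real.pi / (δ N * (zCrit q g / vCrit q g)) →
      ‖sadB q g (M N) N y ((δ N * (zCrit q g / vCrit q g) : ℝ) * (1 - Complex.I * t))‖ ≤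
        C * Real.exp (-(scaledPos q g (δ N) N y / 2)) * Real.exp (-c * t ^ 2) := by
  obtain ⟨c, hc, hC⟩ := h.exists_norm_sadB_sq_le s
  refine ⟨c / 2, by positivity, Real.exp (1 + 3 * |s|), by positivity, ?_⟩
  filter_upwards [hC, h.norm_sadB_le s, h.pos] with N h1 h2 h3 y t hs ht
  have h5 : 0 < δ N * (zCrit q g / vCrit q g) := mul_pos h3 h.ratio_pos
  rw [le_div_iff₀ h5, ← abs_of_pos h5, ← abs_mul, mul_comm] at ht
  have h4 := h1 y t hs ht
  rw [← one_mul (Real.exp (-(c * t ^ 2)))] at h4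
  refine (le_of_sq_le_mul_exp (norm_nonneg _) zero_le_one h4).trans ?_
  calc _ ≤ Real.exp (1 + 3 * |s| - scaledPos q g (δ N) N y / 2) *
        (Real.sqrt 1 * Real.exp (-(c * t ^ 2 / 2))) := by
        gcongr
        exact h2 y hs
    _ = _ := by
        rw [sub_eq_add_neg, Real.exp_add, show -(c / 2) * t ^ 2 = -(c * t ^ 2 / 2) by ring,
          Real.sqrt_one]
        ring

theorem exists_abs_normA_le (h : IsScaling q g δ M) : ∃ C, 0 ≤ C ∧ ∀ᶠ N in atTop, ∀ X,
    |normA q g (δ N) (M N) N X| ≤ C * Real.exp (-scaledPos q g (δ N) N X) := by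
  obtain ⟨c, hc, C, hC0, hC⟩ := h.exists_norm_sadA_le
  refine ⟨1 / (2 * Real.pi) * (C * Real.sqrt (Real.pi / c)), by positivity, ?_⟩
  filter_upwards [hC, h.pos, h.eventually_lt_one] with N h1 h2 h3 X
  have h4 := integral_exp_neg_mul_sq_bound (by positivity) hc (by positivity) (h1 X)
  rw [← Real.norm_eq_abs, ← Complex.norm_real, normA_eq_integral h.hq0 h.hq1 h.hg h2 h3, norm_mul,
    show ‖(1 / (2 * Real.pi) : ℂ)‖ = 1 / (2 * Real.pi) by
      simp [abs_of_pos Real.pi_pos]]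
  refine (mul_le_mul_of_nonneg_left h4 (by positivity)).trans_eq ?_
  ring

theorem exists_abs_normB_le (h : IsScaling q g δ M) (s : ℝ) : ∃ C, 0 ≤ C ∧ ∀ᶠ N in atTop, ∀ y,
    s ≤ scaledPos q g (δ N) N y →
    |normB q g (δ N) (M N) N y| ≤ C * Real.exp (-(scaledPos q g (δ N) N y / 2)) := by
  obtain ⟨c, hc, C, hC0, hC⟩ := h.exists_norm_sadB_le s
  refine ⟨1 / (2 * Real.pi) * (C * Real.sqrt (Real.pi / c)), by positivity, ?_⟩
  filter_upwards [hC, h.pos, eventually_gt_atTop 0] with N h1 h2 hN y hs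
  have h5 : 0 < δ N * (zCrit q g / vCrit q g) := mul_pos h2 h.ratio_pos
  have h4 := integral_exp_neg_mul_sq_bound (by positivity) hc (by positivity) fun t => h1 y t hs
  rw [← Real.norm_eq_abs, ← Complex.norm_real, normB_eq_integral h.hq0 h.hq1 h.hg h2 _ hN, norm_mul,
    show ‖(1 / (2 * Real.pi) : ℂ)‖ = 1 / (2 * Real.pi) by
      simp [abs_of_pos Real.pi_pos]]
  refine (mul_le_mul_of_nonneg_left h4 (by positivity)).trans_eq ?_
  ring

theorem tendsto_pi_div (h : IsScaling q g δ M) {r : ℝ} (hr : 0 < r) :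
    Tendsto (fun N => Real.pi / (δ N * r)) atTop atTop := by
  have h1 : Tendsto (fun N => δ N * r) atTop (nhdsWithin 0 (Set.Ioi 0)) := by
    refine tendsto_nhdsWithin_iff.mpr ⟨by simpa using h.lim.mul_const r, ?_⟩
    filter_upwards [h.pos] with N hN
    exact mul_pos hN hr
  exact (tendsto_inv_nhdsGT_zero.comp h1).const_mul_atTop Real.pi_pos

theorem tendsto_normA (h : IsScaling q g δ M) {ξ : ℝ} {X : ℕ → ℕ}
    (hX : Tendsto (fun N => scaledPos q g (δ N) N (X N)) atTop (nhds ξ)) :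
    Tendsto (fun N => normA q g (δ N) (M N) N (X N)) atTop (nhds (Ai ξ)) := by
  obtain ⟨c, hc, C, hC0, hC⟩ := h.exists_norm_sadA_le
  obtain ⟨N₀, hN₀⟩ := eventually_atTop.mp h.eventually_lt_one
  refine Ai_eq_of_ofReal_tendsto ?_
  have hT := h.tendsto_pi_div one_pos
  simp only [mul_one] at hT
  have key := tendsto_intervalIntegral_of_gaussian_bound
    (φ := fun N t => if N₀ ≤ N then sadA q g (M N) N (X N) (δ N * (1 - Complex.I * t)) else 0)
    (K := C * Real.exp (-(ξ - 1))) hc hT ?_ ?_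
    (fun t => (h.tendsto_sadA hX (1 - Complex.I * t)).congr' ?_)
  · refine (key.const_mul (1 / (2 * Real.pi) : ℂ)).congr' ?_
    filter_upwards [h.pos, eventually_ge_atTop N₀] with N h1 h2
    rw [normA_eq_integral h.hq0 h.hq1 h.hg h1 (hN₀ N h2)]
    simp only [h2, if_true]
  · intro N
    by_cases hN : N₀ ≤ N
    · simp only [hN, if_true]
      exact continuous_sadA h.hq0 h.hq1 h.hg (hN₀ N hN) _ _ _
    · simp only [hN, if_false]
      exact continuous_const
  · filter_upwards [hC, hX.eventually_const_lt (u := ξ - 1) (by linarith),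
      eventually_ge_atTop N₀] with N h1 h2 h3 t ht
    simp only [h3, if_true]
    refine (h1 (X N) t ht).trans ?_
    gcongr
  · filter_upwards [eventually_ge_atTop N₀] with N h3
    simp only [h3, if_true]

theorem tendsto_normB (h : IsScaling q g δ M) {ξ : ℝ} {X : ℕ → ℕ}
    (hX : Tendsto (fun N => scaledPos q g (δ N) N (X N)) atTop (nhds ξ)) :
    Tendsto (fun N => normB q g (δ N) (M N) N (X N)) atTop (nhds (Ai ξ)) := by
  obtain ⟨c, hc, C, hC0, hC⟩ := h.exists_norm_sadB_le (ξ - 1)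
  refine Ai_eq_of_ofReal_tendsto ?_
  have key := tendsto_intervalIntegral_of_gaussian_bound
    (φ := fun N t => sadB q g (M N) N (X N)
      ((δ N * (zCrit q g / vCrit q g) : ℝ) * (1 - Complex.I * t)))
    (K := C * Real.exp (-((ξ - 1) / 2))) hc (h.tendsto_pi_div h.ratio_pos)
    (fun N => continuous_sadB _ _ _ _ _ _) ?_
    (fun t => h.tendsto_sadB hX (1 - Complex.I * t))
  · refine (key.const_mul (1 / (2 * Real.pi) : ℂ)).congr' ?_
    filter_upwards [h.pos, eventually_gt_atTop 0] with N h1 h2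
    rw [normB_eq_integral h.hq0 h.hq1 h.hg h1 _ h2]
  · filter_upwards [hC, hX.eventually_const_lt (u := ξ - 1) (by linarith)] with N h1 h2 t ht
    refine (h1 (X N) t h2.le ht).trans ?_
    gcongr

end IsScaling

theorem nat_floor_div_eq_iff {δ u : ℝ} (hδ : 0 < δ) (l : ℕ) (hu : 0 ≤ u) :
    ⌊u / δ⌋₊ = l ↔ u ∈ Set.Ico (δ * l) (δ * (l + 1)) := by
  rw [Nat.floor_eq_iff (by positivity), le_div_iff₀ hδ, div_lt_iff₀ hδ, Set.mem_Ico, mul_comm δ,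
    mul_comm δ]

theorem hasSum_setIntegral_floor {δ : ℝ} (hδ : 0 < δ) {f : ℕ → ℝ}
    (hf : IntegrableOn (fun t : ℝ => f ⌊t / δ⌋₊) (Set.Ici 0)) :
    HasSum (fun l => δ * f l) (∫ t in Set.Ici (0 : ℝ), f ⌊t / δ⌋₊) := by
  have hmem : ∀ (l : ℕ) (t : ℝ), t ∈ Set.Ico (δ * l) (δ * (l + 1)) → 0 ≤ t := fun l t ht =>
    le_trans (by positivity) ht.1
  have hU : ⋃ l : ℕ, Set.Ico (δ * l) (δ * (l + 1)) = Set.Ici (0 : ℝ) := by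
    ext t
    rw [Set.mem_iUnion]
    refine ⟨fun ⟨l, hl⟩ => hmem l t hl, fun ht => ⟨⌊t / δ⌋₊, ?_⟩⟩
    exact (nat_floor_div_eq_iff hδ _ ht).mp rfl
  have hd : Pairwise (Function.onFun Disjoint fun l : ℕ => Set.Ico (δ * l) (δ * (l + 1))) := by
    intro l m hlm
    refine Set.disjoint_left.mpr fun t ht ht' => hlm ?_
    rw [← (nat_floor_div_eq_iff hδ l (hmem l t ht)).mpr ht,
      (nat_floor_div_eq_iff hδ m (hmem m t ht')).mpr ht']
  have h := hasSum_integral_iUnion (fun l : ℕ => measurableSet_Ico) hd (by rwa [hU])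
  rw [hU] at h
  have hterm : ∀ l : ℕ, ∫ t in Set.Ico (δ * l) (δ * (l + 1)), f ⌊t / δ⌋₊ = δ * f l := by
    intro l
    rw [setIntegral_congr_fun measurableSet_Ico (g := fun _ => f l) fun t ht => by
      simp only [(nat_floor_div_eq_iff hδ l (hmem l t ht)).mpr ht], setIntegral_const, Measure.real,
      Real.volume_Ico, show δ * (l + 1) - δ * l = δ by ring, ENNReal.toReal_ofReal hδ.le,
      smul_eq_mul]
  simpa only [hterm] using h

theorem setIntegral_floor_eq_sum {δ : ℝ} (hδ : 0 < δ) (k L : ℕ) (F : (Fin k → ℕ) → ℝ) :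
    ∫ u : Fin k → ℝ in {u | ∀ i, 0 ≤ u i},
      (if ∀ i, ⌊u i / δ⌋₊ < L then F fun i => ⌊u i / δ⌋₊ else 0) =
    δ ^ k * ∑ f : Fin k → Fin L, F fun i => f i := by
  have hmeas : MeasurableSet {u : Fin k → ℝ | ∀ i, 0 ≤ u i} := by measurability
  have hbox : ∀ u ∈ {u : Fin k → ℝ | ∀ i, 0 ≤ u i},
      (if ∀ i, ⌊u i / δ⌋₊ < L then F fun i => ⌊u i / δ⌋₊ else 0) =
      ∑ f : Fin k → Fin L, (Set.univ.pi fun i => Set.Ico (δ * (f i : ℕ)) (δ * ((f i : ℕ) + 1))).indicator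
        (fun _ => F fun i => f i) u := by
    intro u hu
    have hiff : ∀ f : Fin k → Fin L,
        (u ∈ Set.univ.pi fun i => Set.Ico (δ * (f i : ℕ)) (δ * ((f i : ℕ) + 1))) ↔
          ∀ i, ⌊u i / δ⌋₊ = f i := by
      intro f
      rw [Set.mem_univ_pi]
      exact forall_congr' fun i => (nat_floor_div_eq_iff hδ _ (hu i)).symm
    split_ifs with h
    · rw [Finset.sum_eq_single (fun i => ⟨⌊u i / δ⌋₊, h i⟩)]
      · rw [Set.indicator_of_mem ((hiff _).mpr fun i => rfl)]
      · intro f _ hf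
        refine Set.indicator_of_notMem (fun hm => hf ?_) _
        funext i
        exact Fin.ext ((hiff f).mp hm i).symm
      · simp
    · refine (Finset.sum_eq_zero fun f _ => Set.indicator_of_notMem (fun hm => h fun i => ?_) _).symm
      rw [(hiff f).mp hm i]
      exact (f i).2
  have hvol : ∀ f : Fin k → Fin L,
      volume (Set.univ.pi fun i => Set.Ico (δ * (f i : ℕ)) (δ * ((f i : ℕ) + 1))) =
        ENNReal.ofReal (δ ^ k) := by
    intro f
    rw [volume_pi_pi]
    simp only [Real.volume_Ico]
    rw [← ENNReal.ofReal_prod_of_nonneg]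
    · congr 1
      rw [Finset.prod_congr rfl (fun i _ => show δ * ((f i : ℕ) + 1) - δ * (f i : ℕ) = δ by ring)]
      simp
    · intro i _
      linarith
  have hsub : ∀ f : Fin k → Fin L, (Set.univ.pi fun i => Set.Ico (δ * (f i : ℕ)) (δ * ((f i : ℕ) + 1))) ⊆
      {u : Fin k → ℝ | ∀ i, 0 ≤ u i} := fun f u hu i =>
    le_trans (by positivity) (Set.mem_univ_pi.mp hu i).1
  have hms : ∀ f : Fin k → Fin L, MeasurableSet
      (Set.univ.pi fun i => Set.Ico (δ * (f i : ℕ)) (δ * ((f i : ℕ) + 1))) := fun f =>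
    MeasurableSet.univ_pi fun i => measurableSet_Ico
  rw [setIntegral_congr_fun hmeas hbox, integral_finsetSum, Finset.mul_sum]
  · refine Finset.sum_congr rfl fun f _ => ?_
    rw [setIntegral_indicator (hms f), Set.inter_eq_right.mpr (hsub f), setIntegral_const,
      Measure.real, hvol, ENNReal.toReal_ofReal (by positivity), smul_eq_mul]
  · intro f _
    refine (integrable_indicator_iff (hms f)).mpr ?_ |>.integrableOn
    exact integrableOn_const (by rw [hvol]; exact ENNReal.ofReal_ne_top)

theorem pow_self_le_factorial_mul_exp (k : ℕ) : (k : ℝ) ^ k ≤ k.factorial * Real.exp 1 ^ k := by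
  have h := Real.pow_div_factorial_le_exp (x := k) (Nat.cast_nonneg k) k
  rw [div_le_iff₀ (by positivity)] at h
  rw [← Real.exp_nat_mul, mul_one, mul_comm]
  exact h

theorem summable_sqrt_pow_div_factorial (c : ℝ) :
    Summable fun k : ℕ => Real.sqrt (((k : ℝ) * c ^ 2) ^ k) / k.factorial := by
  have h1 := Real.summable_pow_div_factorial (4 * Real.exp 1 * c ^ 2)
  have h2 : Summable fun k : ℕ => (1 / 4 : ℝ) ^ k :=
    summable_geometric_of_lt_one (by norm_num) (by norm_num)
  refine Summable.of_nonneg_of_le (fun k => by positivity) (fun k => ?_) (h1.add h2)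
  have hf : (0 : ℝ) < k.factorial := by positivity
  rw [div_le_iff₀ hf]
  refine Real.sqrt_le_iff.mpr ⟨by positivity, ?_⟩
  have h4 : (1 / 4 : ℝ) ^ k * 4 ^ k = 1 := by rw [← mul_pow]; norm_num
  have h5 : (4 * Real.exp 1 * c ^ 2) ^ k = 4 ^ k * (Real.exp 1 ^ k * (c ^ 2) ^ k) := by
    rw [mul_pow, mul_pow]; ring
  have h6 : ((k : ℝ) * c ^ 2) ^ k ≤ k.factorial * (Real.exp 1 ^ k * (c ^ 2) ^ k) := by
    rw [mul_pow, ← mul_assoc]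
    exact mul_le_mul_of_nonneg_right (pow_self_le_factorial_mul_exp k) (by positivity)
  set p := (4 * Real.exp 1 * c ^ 2) ^ k / k.factorial with hp
  have hp0 : 0 ≤ p := by positivity
  have h7 : k.factorial * (Real.exp 1 ^ k * (c ^ 2) ^ k) =
      p * (1 / 4) ^ k * (k.factorial : ℝ) ^ 2 := by
    have h8 : p * k.factorial = 4 ^ k * (Real.exp 1 ^ k * (c ^ 2) ^ k) := by
      rw [hp, h5, div_mul_cancel₀ _ hf.ne']
    linear_combination -((1 / 4) ^ k * (k.factorial : ℝ)) * h8 -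
      k.factorial * (Real.exp 1 ^ k * (c ^ 2) ^ k) * h4
  rw [h7] at h6
  refine h6.trans ?_
  rw [mul_pow]
  refine mul_le_mul_of_nonneg_right ?_ (by positivity)
  have h8 : 0 ≤ (1 / 4 : ℝ) ^ k := by positivity
  nlinarith [mul_nonneg hp0 h8, sq_nonneg p, sq_nonneg ((1 / 4 : ℝ) ^ k)]

theorem abs_det_le_of_abs_entry_le_mul {k : ℕ} (A : Matrix (Fin k) (Fin k) ℝ) {c : ℝ} {e : Fin k → ℝ}
    (he : ∀ i, 0 < e i) (hA : ∀ i j, |A i j| ≤ c * (e i * e j)) :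
    |A.det| ≤ Real.sqrt (((k : ℝ) * c ^ 2) ^ k) * ∏ i, e i ^ 2 := by
  set B : Matrix (Fin k) (Fin k) ℝ := Matrix.of fun i j => A i j / (e i * e j) with hB
  have hAB : A = Matrix.diagonal e * B * Matrix.diagonal e := by
    ext i j
    rw [Matrix.mul_diagonal, Matrix.diagonal_mul, hB, Matrix.of_apply]
    have := he i; have := he j
    field_simp
  have hBc : ∀ i j, |B i j| ≤ c := by
    intro i j
    have h1 : 0 < e i * e j := mul_pos (he i) (he j)
    rw [hB, Matrix.of_apply, abs_div, abs_of_pos h1, div_le_iff₀ h1]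
    exact hA i j
  have h := det_sq_le_of_abs_entry_le B hBc
  have h2 : |B.det| ≤ Real.sqrt (((k : ℝ) * c ^ 2) ^ k) := by
    rw [← Real.sqrt_sq_eq_abs]; exact Real.sqrt_le_sqrt h
  rw [hAB, Matrix.det_mul, Matrix.det_mul, Matrix.det_diagonal, Finset.prod_pow, abs_mul, abs_mul,
    abs_of_pos (Finset.prod_pos fun i _ => he i)]
  have h3 : 0 < ∏ i, e i := Finset.prod_pos fun i _ => he i
  nlinarith [mul_le_mul_of_nonneg_right h2 (sq_nonneg (∏ i, e i))]

/-- The correlation kernel at the sites above `n`, conjugated and rescaled. -/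
noncomputable def scaledK (q g δ : ℝ) (M N n a b : ℕ) : ℝ :=
  δ⁻¹ * (zCrit q g ^ (n + 1 + a) * (zCrit q g ^ (n + 1 + b))⁻¹) *
    corK q M N (n + 1 + a) (n + 1 + b)

theorem hasSum_scaledK {q g δ : ℝ} (hq0 : 0 < q) (hq1 : q < 1) (hg : 0 < g) (hδ : 0 < δ)
    (M : ℕ) {N : ℕ} (hN : 0 < N) (n a b : ℕ) :
    HasSum (fun l => δ * (normA q g δ M N (n + 1 + a + l) * normB q g δ M N (n + 1 + b + l)))
      (scaledK q g δ M N n a b) := by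
  have hz : zCrit q g ≠ 0 := (one_pos.trans (one_lt_zCrit hq0 hq1 hg)).ne'
  have hterm : ∀ l, δ * (normA q g δ M N (n + 1 + a + l) * normB q g δ M N (n + 1 + b + l)) =
      δ⁻¹ * (zCrit q g ^ (n + 1 + a) * (zCrit q g ^ (n + 1 + b))⁻¹) *
        (aCoef q M N (n + 1 + a + l) * bCoef q M N (n + 1 + b + l)) := by
    intro l
    rw [normA_mul_normB hq0 hq1 hg, pow_add _ (n + 1 + a), pow_add _ (n + 1 + b)]
    field_simp
  simp only [hterm]
  exact (hasSum_corK hq0 hq1 M hN (n + 1 + a) (n + 1 + b)).mul_left _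

theorem integrableOn_exp_neg_Ici : IntegrableOn (fun t : ℝ => Real.exp (-t)) (Set.Ici 0) :=
  Iff.mpr integrableOn_Ici_iff_integrableOn_Ioi (integrableOn_exp_neg_Ioi 0)

theorem scaledPos_add (q g δ : ℝ) (N X l : ℕ) :
    scaledPos q g δ N (X + l) = scaledPos q g δ N X + δ * l := by
  unfold scaledPos
  push_cast
  ring

theorem mul_nat_floor_div_le {δ u : ℝ} (hδ : 0 < δ) (hu : 0 ≤ u) : δ * ⌊u / δ⌋₊ ≤ u := by
  have := Nat.floor_le (div_nonneg hu hδ.le)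
  rwa [le_div_iff₀ hδ, mul_comm] at this

theorem sub_le_mul_nat_floor_div {δ u : ℝ} (hδ : 0 < δ) : u - δ ≤ δ * ⌊u / δ⌋₊ := by
  have := (Nat.lt_floor_add_one (u / δ)).le
  rw [div_le_iff₀ hδ] at this
  linarith

namespace IsScaling

variable {q g : ℝ} {δ : ℕ → ℝ} {M : ℕ → ℕ}

theorem tendsto_mul_nat_floor_div (h : IsScaling q g δ M) {u : ℝ} (hu : 0 ≤ u) :
    Tendsto (fun N => δ N * ⌊u / δ N⌋₊) atTop (nhds u) := by
  have h1 : Tendsto (fun N => u - δ N) atTop (nhds u) := by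
    simpa using h.lim.const_sub u
  refine tendsto_of_tendsto_of_tendsto_of_le_of_le' h1 tendsto_const_nhds ?_ ?_
  · filter_upwards [h.pos] with N hN using sub_le_mul_nat_floor_div hN
  · filter_upwards [h.pos] with N hN using mul_nat_floor_div_le hN hu

theorem exists_abs_normA_mul_normB_le (h : IsScaling q g δ M) {s : ℝ} {n : ℕ → ℕ}
    (hs : ∀ᶠ N in atTop, s ≤ scaledPos q g (δ N) N (n N + 1)) :
    ∃ C, 0 ≤ C ∧ ∀ᶠ N in atTop, ∀ u v t : ℝ, 0 ≤ u → 0 ≤ v → 0 ≤ t →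
      |normA q g (δ N) (M N) N (n N + 1 + ⌊u / δ N⌋₊ + ⌊t / δ N⌋₊) *
        normB q g (δ N) (M N) N (n N + 1 + ⌊v / δ N⌋₊ + ⌊t / δ N⌋₊)| ≤
      C * (Real.exp (-(u / 2)) * Real.exp (-(v / 2))) * Real.exp (-t) := by
  obtain ⟨C₁, hC₁, hA⟩ := h.exists_abs_normA_le
  obtain ⟨C₂, hC₂, hB⟩ := h.exists_abs_normB_le s
  refine ⟨C₁ * Real.exp (2 - s) * (C₂ * Real.exp (1 - s / 2)), by positivity, ?_⟩
  filter_upwards [hA, hB, hs, h.pos, h.lim.eventually_lt_const (u := 1) one_pos]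
    with N h1 h2 h3 h4 h5 u v t hu hv ht
  have hpos : ∀ w, 0 ≤ w → s + w + t - 2 ≤
      scaledPos q g (δ N) N (n N + 1 + ⌊w / δ N⌋₊ + ⌊t / δ N⌋₊) := by
    intro w hw
    rw [scaledPos_add, scaledPos_add]
    have := sub_le_mul_nat_floor_div (u := w) h4
    have := sub_le_mul_nat_floor_div (u := t) h4
    linarith
  have hge : s ≤ scaledPos q g (δ N) N (n N + 1 + ⌊v / δ N⌋₊ + ⌊t / δ N⌋₊) := by
    rw [scaledPos_add, scaledPos_add]
    have h6 : 0 ≤ δ N * ⌊v / δ N⌋₊ := by positivity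
    have h7 : 0 ≤ δ N * ⌊t / δ N⌋₊ := by positivity
    linarith
  rw [abs_mul]
  calc _ ≤ (C₁ * Real.exp (-(s + u + t - 2))) * (C₂ * Real.exp (-((s + v + t - 2) / 2))) := by
        refine mul_le_mul ((h1 _).trans ?_) ((h2 _ hge).trans ?_) (abs_nonneg _) (by positivity)
        · gcongr
          exact hpos u hu
        · gcongr
          exact hpos v hv
    _ = C₁ * C₂ * Real.exp (-(s + u + t - 2) + -((s + v + t - 2) / 2)) := by
        rw [Real.exp_add]; ring
    _ ≤ C₁ * C₂ * Real.exp ((2 - s) + (1 - s / 2) + -(u / 2) + -(v / 2) + -t) := by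
        exact mul_le_mul_of_nonneg_left (Real.exp_le_exp.mpr (by linarith)) (by positivity)
    _ = _ := by
        rw [Real.exp_add, Real.exp_add, Real.exp_add, Real.exp_add]; ring

theorem eventually_scaledK_eq (h : IsScaling q g δ M) {s : ℝ} {n : ℕ → ℕ}
    (hs : ∀ᶠ N in atTop, s ≤ scaledPos q g (δ N) N (n N + 1)) :
    ∀ᶠ N in atTop, ∀ u v : ℝ, 0 ≤ u → 0 ≤ v →
      scaledK q g (δ N) (M N) N (n N) ⌊u / δ N⌋₊ ⌊v / δ N⌋₊ =
      ∫ t in Set.Ici 0, normA q g (δ N) (M N) N (n N + 1 + ⌊u / δ N⌋₊ + ⌊t / δ N⌋₊) *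
        normB q g (δ N) (M N) N (n N + 1 + ⌊v / δ N⌋₊ + ⌊t / δ N⌋₊) := by
  obtain ⟨C, hC, hb⟩ := h.exists_abs_normA_mul_normB_le hs
  filter_upwards [hb, h.pos, eventually_gt_atTop 0] with N h1 h2 h3 u v hu hv
  have hi : IntegrableOn (fun t : ℝ => (fun l : ℕ =>
      normA q g (δ N) (M N) N (n N + 1 + ⌊u / δ N⌋₊ + l) *
        normB q g (δ N) (M N) N (n N + 1 + ⌊v / δ N⌋₊ + l)) ⌊t / δ N⌋₊) (Set.Ici 0) := by
    refine Integrable.mono' (integrableOn_exp_neg_Ici.const_mul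
      (C * (Real.exp (-(u / 2)) * Real.exp (-(v / 2))))) ?_ ?_
    · have hm : Measurable fun l : ℕ => normA q g (δ N) (M N) N (n N + 1 + ⌊u / δ N⌋₊ + l) *
          normB q g (δ N) (M N) N (n N + 1 + ⌊v / δ N⌋₊ + l) := measurable_from_nat
      exact (hm.comp (Nat.measurable_floor.comp (measurable_id.div_const _))).aestronglyMeasurable
    · refine (ae_restrict_iff' measurableSet_Ici).mpr (ae_of_all _ fun t ht => ?_)
      exact h1 u v t hu hv ht
  exact (hasSum_scaledK h.hq0 h.hq1 h.hg h2 _ h3 _ _ _).unique (hasSum_setIntegral_floor h2 hi)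

theorem exists_abs_scaledK_le (h : IsScaling q g δ M) {s : ℝ} {n : ℕ → ℕ}
    (hs : ∀ᶠ N in atTop, s ≤ scaledPos q g (δ N) N (n N + 1)) :
    ∃ C, 0 ≤ C ∧ ∀ᶠ N in atTop, ∀ u v : ℝ, 0 ≤ u → 0 ≤ v →
      |scaledK q g (δ N) (M N) N (n N) ⌊u / δ N⌋₊ ⌊v / δ N⌋₊| ≤
        C * (Real.exp (-(u / 2)) * Real.exp (-(v / 2))) := by
  obtain ⟨C, hC, hb⟩ := h.exists_abs_normA_mul_normB_le hs
  refine ⟨C, hC, ?_⟩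
  filter_upwards [hb, h.eventually_scaledK_eq hs] with N h1 h2 u v hu hv
  rw [h2 u v hu hv, ← Real.norm_eq_abs]
  refine (norm_integral_le_of_norm_le (integrableOn_exp_neg_Ici.const_mul (C * (Real.exp (-(u / 2)) * Real.exp (-(v / 2)))))
    ((ae_restrict_iff' measurableSet_Ici).mpr (ae_of_all _ fun t ht => h1 u v t hu hv ht))).trans_eq ?_
  rw [integral_const_mul, integral_Ici_eq_integral_Ioi, integral_exp_neg_Ioi_zero, mul_one]

theorem tendsto_scaledK (h : IsScaling q g δ M) {s : ℝ} {n : ℕ → ℕ}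
    (hs : ∀ᶠ N in atTop, s ≤ scaledPos q g (δ N) N (n N + 1))
    (hlim : Tendsto (fun N => scaledPos q g (δ N) N (n N + 1)) atTop (nhds s))
    {u v : ℝ} (hu : 0 ≤ u) (hv : 0 ≤ v) :
    Tendsto (fun N => scaledK q g (δ N) (M N) N (n N) ⌊u / δ N⌋₊ ⌊v / δ N⌋₊) atTop
      (nhds (airyKernel (s + u) (s + v))) := by
  obtain ⟨C, hC, hb⟩ := h.exists_abs_normA_mul_normB_le hs
  rw [airyKernel_eq_integral, ← integral_Ici_eq_integral_Ioi]
  have hpos : ∀ w t, 0 ≤ w → 0 ≤ t → Tendsto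
      (fun N => scaledPos q g (δ N) N (n N + 1 + ⌊w / δ N⌋₊ + ⌊t / δ N⌋₊)) atTop
      (nhds (s + w + t)) := by
    intro w t hw ht
    simp only [scaledPos_add _ _ _ _ (n _ + 1 + _), scaledPos_add _ _ _ _ (n _ + 1)]
    exact (hlim.add (h.tendsto_mul_nat_floor_div hw)).add (h.tendsto_mul_nat_floor_div ht)
  have key := tendsto_integral_filter_of_dominated_convergence
    (μ := volume.restrict (Set.Ici (0 : ℝ))) (l := atTop)
    (F := fun N t => normA q g (δ N) (M N) N (n N + 1 + ⌊u / δ N⌋₊ + ⌊t / δ N⌋₊) *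
        normB q g (δ N) (M N) N (n N + 1 + ⌊v / δ N⌋₊ + ⌊t / δ N⌋₊))
    (f := fun t => Ai (s + u + t) * Ai (s + v + t))
    (fun t => C * (Real.exp (-(u / 2)) * Real.exp (-(v / 2))) * Real.exp (-t)) ?_ ?_
    (integrableOn_exp_neg_Ici.const_mul _) ?_
  · refine key.congr' ?_
    filter_upwards [h.eventually_scaledK_eq hs] with N hN
    exact (hN u v hu hv).symm
  · refine Eventually.of_forall fun N => ?_
    have hm : Measurable fun l : ℕ => normA q g (δ N) (M N) N (n N + 1 + ⌊u / δ N⌋₊ + l) *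
        normB q g (δ N) (M N) N (n N + 1 + ⌊v / δ N⌋₊ + l) := measurable_from_nat
    exact (hm.comp (Nat.measurable_floor.comp (measurable_id.div_const _))).aestronglyMeasurable
  · filter_upwards [hb] with N hN
    exact (ae_restrict_iff' measurableSet_Ici).mpr (ae_of_all _ fun t ht => hN u v t hu hv ht)
  · refine (ae_restrict_iff' measurableSet_Ici).mpr (ae_of_all _ fun t ht => ?_)
    exact (h.tendsto_normA (hpos u t hu ht)).mul (h.tendsto_normB (hpos v t hv ht))

end IsScaling

theorem det_scaledK {q g δ : ℝ} (hq0 : 0 < q) (hq1 : q < 1) (hg : 0 < g) (hδ : 0 < δ)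
    (M N n : ℕ) {k : ℕ} (f : Fin k → ℕ) :
    δ ^ k * (Matrix.of fun i j => scaledK q g δ M N n (f i) (f j)).det =
      (Matrix.of fun i j => corK q M N (n + 1 + f i) (n + 1 + f j)).det := by
  have hz : zCrit q g ≠ 0 := (one_pos.trans (one_lt_zCrit hq0 hq1 hg)).ne'
  set e : Fin k → ℝ := fun i => zCrit q g ^ (n + 1 + f i) with he
  have he0 : ∀ i, e i ≠ 0 := fun i => pow_ne_zero _ hz
  have h : δ • (Matrix.of fun i j => scaledK q g δ M N n (f i) (f j)) =
      Matrix.diagonal e * (Matrix.of fun i j => corK q M N (n + 1 + f i) (n + 1 + f j)) *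
        Matrix.diagonal fun i => (e i)⁻¹ := by
    ext i j
    rw [Matrix.mul_diagonal, Matrix.diagonal_mul, Matrix.smul_apply, Matrix.of_apply,
      Matrix.of_apply, scaledK, smul_eq_mul]
    simp only [he]
    field_simp
  have h2 := congrArg Matrix.det h
  rw [Matrix.det_smul, Fintype.card_fin, Matrix.det_mul, Matrix.det_mul, Matrix.det_diagonal,
    Matrix.det_diagonal] at h2
  rw [h2, mul_right_comm, ← Finset.prod_mul_distrib,
    Finset.prod_congr rfl fun i _ => mul_inv_cancel₀ (he0 i)]
  simp

theorem det_one_sub_corK_eq_tsum {q g δ : ℝ} (hq0 : 0 < q) (hq1 : q < 1) (hg : 0 < g) (hδ : 0 < δ)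
    (M N n L : ℕ) :
    (1 - Matrix.of fun a b : Fin L => corK q M N (n + 1 + a) (n + 1 + b)).det =
      ∑' k : ℕ, ((-1 : ℝ) ^ k / k.factorial) * ∫ u : Fin k → ℝ in {u | ∀ i, 0 ≤ u i},
        (if ∀ i, ⌊u i / δ⌋₊ < L then
          (Matrix.of fun i j => scaledK q g δ M N n ⌊u i / δ⌋₊ ⌊u j / δ⌋₊).det else 0) := by
  rw [det_one_sub_eq_tsum]
  refine tsum_congr fun k => ?_
  congr 1
  rw [setIntegral_floor_eq_sum hδ k L
    (fun f => (Matrix.of fun i j => scaledK q g δ M N n (f i) (f j)).det), Finset.mul_sum]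
  refine Finset.sum_congr rfl fun f _ => ?_
  rw [det_scaledK hq0 hq1 hg hδ]
  rfl

theorem integrable_prod_exp_neg (k : ℕ) :
    IntegrableOn (fun u : Fin k → ℝ => ∏ i, Real.exp (-(u i))) {u | ∀ i, 0 ≤ u i} ∧
      ∫ u : Fin k → ℝ in {u | ∀ i, 0 ≤ u i}, ∏ i, Real.exp (-(u i)) = 1 := by
  have hset : {u : Fin k → ℝ | ∀ i, 0 ≤ u i} = Set.univ.pi fun _ => Set.Ici 0 := by
    ext u; simp [Pi.le_def]
  rw [IntegrableOn, hset, volume_pi, Measure.restrict_pi_pi]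
  refine ⟨Integrable.fintype_prod fun i => integrableOn_exp_neg_Ici, ?_⟩
  rw [integral_fintype_prod_eq_prod (f := fun _ t => Real.exp (-t))]
  simp only [integral_Ici_eq_integral_Ioi, integral_exp_neg_Ioi_zero, Finset.prod_const_one]

theorem TW_eq (s : ℝ) : TW s = ∑' k : ℕ, ((-1 : ℝ) ^ k / k.factorial) *
    ∫ u : Fin k → ℝ in {u | ∀ i, 0 ≤ u i},
      (Matrix.of fun i j => airyKernel (s + u i) (s + u j)).det := by
  refine tsum_congr fun k => ?_
  congr 1
  have h := (measurePreserving_add_left (volume : Measure (Fin k → ℝ)) fun _ => s).setIntegral_preimage_emb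
    (MeasurableEquiv.addLeft (fun _ => s : Fin k → ℝ)).measurableEmbedding
    (fun ξ => (Matrix.of fun i j => airyKernel (ξ i) (ξ j)).det) {ξ | ∀ i, s ≤ ξ i}
  rw [← h]
  congr 2
  ext u
  simp

namespace IsScaling

variable {q g : ℝ} {δ : ℕ → ℝ} {M : ℕ → ℕ}

theorem exists_abs_det_scaledK_le (h : IsScaling q g δ M) {s : ℝ} {n : ℕ → ℕ}
    (hs : ∀ᶠ N in atTop, s ≤ scaledPos q g (δ N) N (n N + 1)) :
    ∃ C, ∀ᶠ N in atTop, ∀ (k : ℕ) (u : Fin k → ℝ), (∀ i, 0 ≤ u i) →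
      |(Matrix.of fun i j =>
        scaledK q g (δ N) (M N) N (n N) ⌊u i / δ N⌋₊ ⌊u j / δ N⌋₊).det| ≤
        Real.sqrt (((k : ℝ) * C ^ 2) ^ k) * ∏ i, Real.exp (-(u i)) := by
  obtain ⟨C, hC, hb⟩ := h.exists_abs_scaledK_le hs
  refine ⟨C, ?_⟩
  filter_upwards [hb] with N h1 k u hu
  have h2 := abs_det_le_of_abs_entry_le_mul (c := C) (e := fun i => Real.exp (-(u i / 2)))
    (Matrix.of fun i j => scaledK q g (δ N) (M N) N (n N) ⌊u i / δ N⌋₊ ⌊u j / δ N⌋₊)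
    (fun i => Real.exp_pos _) (fun i j => h1 _ _ (hu i) (hu j))
  refine h2.trans_eq ?_
  congr 1
  refine Finset.prod_congr rfl fun i _ => ?_
  rw [← Real.exp_nat_mul]
  congr 1
  push_cast
  ring

theorem tendsto_integral_det_scaledK (h : IsScaling q g δ M) {s : ℝ} {n L : ℕ → ℕ}
    (hs : ∀ᶠ N in atTop, s ≤ scaledPos q g (δ N) N (n N + 1))
    (hlim : Tendsto (fun N => scaledPos q g (δ N) N (n N + 1)) atTop (nhds s))
    (hL : Tendsto (fun N => δ N * L N) atTop atTop) (k : ℕ) :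
    Tendsto (fun N => ∫ u : Fin k → ℝ in {u | ∀ i, 0 ≤ u i},
        (if ∀ i, ⌊u i / δ N⌋₊ < L N then (Matrix.of fun i j =>
          scaledK q g (δ N) (M N) N (n N) ⌊u i / δ N⌋₊ ⌊u j / δ N⌋₊).det else 0)) atTop
      (nhds (∫ u : Fin k → ℝ in {u | ∀ i, 0 ≤ u i},
        (Matrix.of fun i j => airyKernel (s + u i) (s + u j)).det)) := by
  obtain ⟨C, hb⟩ := h.exists_abs_det_scaledK_le hs
  have hset : MeasurableSet {u : Fin k → ℝ | ∀ i, 0 ≤ u i} := by measurability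
  refine tendsto_integral_filter_of_dominated_convergence
    (fun u => Real.sqrt (((k : ℝ) * C ^ 2) ^ k) * ∏ i, Real.exp (-(u i))) ?_ ?_
    ((integrable_prod_exp_neg k).1.const_mul _) ?_
  · refine Eventually.of_forall fun N => ?_
    have hm : Measurable fun f : Fin k → ℕ => if ∀ i, f i < L N then (Matrix.of fun i j =>
          scaledK q g (δ N) (M N) N (n N) (f i) (f j)).det else 0 := measurable_of_countable _
    refine (hm.comp (measurable_pi_lambda (fun (u : Fin k → ℝ) i => ⌊u i / δ N⌋₊) fun i =>
      Nat.measurable_floor.comp ((measurable_pi_apply i).div_const _))).aestronglyMeasurable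
  · filter_upwards [hb] with N hN
    refine (ae_restrict_iff' hset).mpr (ae_of_all _ fun u hu => ?_)
    split_ifs
    · exact hN k u hu
    · rw [norm_zero]
      positivity
  · refine (ae_restrict_iff' hset).mpr (ae_of_all _ fun u hu => ?_)
    have hdet : Tendsto (fun N => (Matrix.of fun i j =>
        scaledK q g (δ N) (M N) N (n N) ⌊u i / δ N⌋₊ ⌊u j / δ N⌋₊).det) atTop
        (nhds (Matrix.of fun i j => airyKernel (s + u i) (s + u j)).det) := by
      refine ((continuous_id.matrix_det).tendsto _).comp ?_
      refine tendsto_pi_nhds.mpr fun i => tendsto_pi_nhds.mpr fun j => ?_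
      exact h.tendsto_scaledK hs hlim (hu i) (hu j)
    refine hdet.congr' ?_
    have hev : ∀ᶠ N in atTop, ∀ i, ⌊u i / δ N⌋₊ < L N := by
      refine eventually_all.mpr fun i => ?_
      filter_upwards [hL.eventually_gt_atTop (u i), h.pos] with N h1 h2
      rw [Nat.floor_lt (div_nonneg (hu i) h2.le), div_lt_iff₀ h2, mul_comm]
      exact h1
    filter_upwards [hev] with N hN
    rw [if_pos hN]

theorem tendsto_det_one_sub_corK (h : IsScaling q g δ M) {s : ℝ} {n L : ℕ → ℕ}
    (hs : ∀ᶠ N in atTop, s ≤ scaledPos q g (δ N) N (n N + 1))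
    (hlim : Tendsto (fun N => scaledPos q g (δ N) N (n N + 1)) atTop (nhds s))
    (hL : Tendsto (fun N => δ N * L N) atTop atTop) :
    Tendsto (fun N => (1 - Matrix.of fun a b : Fin (L N) =>
      corK q (M N) N (n N + 1 + a) (n N + 1 + b)).det) atTop (nhds (TW s)) := by
  obtain ⟨C, hb⟩ := h.exists_abs_det_scaledK_le hs
  rw [TW_eq]
  have key := tendsto_tsum_of_dominated_convergence (𝓕 := atTop)
    (f := fun N k => ((-1 : ℝ) ^ k / (k : ℕ).factorial) *
      ∫ u : Fin k → ℝ in {u | ∀ i, 0 ≤ u i},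
        (if ∀ i, ⌊u i / δ N⌋₊ < L N then (Matrix.of fun i j =>
          scaledK q g (δ N) (M N) N (n N) ⌊u i / δ N⌋₊ ⌊u j / δ N⌋₊).det else 0))
    (summable_sqrt_pow_div_factorial C)
    (fun k => (h.tendsto_integral_det_scaledK hs hlim hL k).const_mul _) ?_
  · refine key.congr' ?_
    filter_upwards [h.pos] with N hN
    exact (det_one_sub_corK_eq_tsum h.hq0 h.hq1 h.hg hN _ _ _ _).symm
  · filter_upwards [hb] with N hN k
    have hset : MeasurableSet {u : Fin k → ℝ | ∀ i, 0 ≤ u i} := by measurability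
    rw [norm_mul, norm_div, norm_pow, norm_neg, norm_one, one_pow, Real.norm_natCast,
      one_div_mul_eq_div]
    gcongr
    refine (norm_integral_le_of_norm_le ((integrable_prod_exp_neg k).1.const_mul _)
      ((ae_restrict_iff' hset).mpr (ae_of_all _ fun u hu => ?_))).trans_eq
      (by rw [integral_const_mul, (integrable_prod_exp_neg k).2, mul_one])
    split_ifs
    · exact hN k u hu
    · rw [norm_zero]
      positivity

end IsScaling

theorem IsScaling.tendsto_measureReal_lppSup_le {q g : ℝ} {δ : ℕ → ℝ} {M : ℕ → ℕ}
    (h : IsScaling q g δ M) {Ω : Type*} [MeasurableSpace Ω] (ℙ : Measure Ω) [IsProbabilityMeasure ℙ]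
    (w : ℕ × ℕ → Ω → ℕ) (hmeas : ∀ p, Measurable (w p))
    (hindep : ProbabilityTheory.iIndepFun w ℙ)
    (hgeom : ∀ p k, ℙ {ω | w p ω = k} = ENNReal.ofReal ((1 - q) * q ^ k))
    (hM : ∀ᶠ N in atTop, 0 < M N) {s : ℝ} {n : ℕ → ℕ}
    (hs : ∀ᶠ N in atTop, s ≤ scaledPos q g (δ N) N (n N + 1))
    (hlim : Tendsto (fun N => scaledPos q g (δ N) N (n N + 1)) atTop (nhds s)) :
    Tendsto (fun N => ℙ.real {ω | lppSup (fun p => w p ω) (M N) N ≤ n N}) atTop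
      (nhds (TW s)) := by
  set P : ℕ → ℝ := fun N => (Matrix.of fun i j : Fin N => cdfEntry q (M N) i j (n N)).det with hP
  have hL : ∀ N, ∃ L : ℕ, N / δ N ≤ L ∧
      |(1 - Matrix.of fun a b : Fin L =>
        corK q (M N) N (n N + 1 + a) (n N + 1 + b)).det - P N| < 1 / ((N : ℝ) + 1) := by
    intro N
    have h1 := _root_.tendsto_det_one_sub_corK h.hq0 h.hq1 (M N) N (n N)
    have h2 := (Metric.tendsto_nhds.mp h1) (1 / ((N : ℝ) + 1)) (by positivity)
    obtain ⟨L, hL1, hL2⟩ := (h2.and (eventually_ge_atTop ⌈N / δ N⌉₊)).exists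
    exact ⟨L, (Nat.le_ceil _).trans (by exact_mod_cast hL2), hL1⟩
  choose L hL1 hL2 using hL
  have hLδ : Tendsto (fun N => δ N * L N) atTop atTop := by
    refine tendsto_atTop_mono' _ ?_ tendsto_natCast_atTop_atTop
    filter_upwards [h.pos] with N hN
    have := hL1 N
    rwa [div_le_iff₀ hN, mul_comm] at this
  have hdet := h.tendsto_det_one_sub_corK hs hlim hLδ
  have hdiff : Tendsto (fun N => (1 - Matrix.of fun a b : Fin (L N) =>
      corK q (M N) N (n N + 1 + a) (n N + 1 + b)).det - P N) atTop (nhds 0) :=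
    squeeze_zero_norm (fun N => (hL2 N).le) tendsto_one_div_add_atTop_nhds_zero_nat
  have hPlim : Tendsto P atTop (nhds (TW s)) := by simpa using hdet.sub hdiff
  refine hPlim.congr' ?_
  filter_upwards [hM, eventually_gt_atTop 0] with N h1 h2
  change (Matrix.of fun i j : Fin N => cdfEntry q (M N) i j (n N)).det = _
  rw [← measureReal_lppSup_le h.hq0 h.hq1 hmeas hindep hgeom h1 h2 (n N)]
  simp only [Nat.cast_le]

/-- The constant in the fluctuation scale. -/
noncomputable def scaleConst (q γ : ℝ) : ℝ :=
  q ^ ((1 : ℝ) / 6) * γ ^ (-(1 : ℝ) / 6) / (1 - q) *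
    (Real.sqrt γ + Real.sqrt q) ^ ((2 : ℝ) / 3) * (1 + Real.sqrt (q * γ)) ^ ((2 : ℝ) / 3)

theorem scaleConst_pos {q γ : ℝ} (hq0 : 0 < q) (hq1 : q < 1) (hγ : 0 < γ) : 0 < scaleConst q γ := by
  have h1 : 0 < 1 - q := by linarith
  unfold scaleConst
  positivity

theorem scaleConst_pow_three {q γ : ℝ} (hq0 : 0 < q) (hq1 : q < 1) (hγ : 0 < γ) :
    scaleConst q γ ^ 3 = (Real.sqrt (q * γ) + q) ^ 2 * (1 + Real.sqrt (q * γ)) ^ 2 /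
      (Real.sqrt (q * γ) * (1 - q) ^ 3) := by
  have h1 : 0 < 1 - q := by linarith
  have hp : ∀ {x : ℝ} (_ : 0 ≤ x) (e : ℝ), (x ^ e) ^ 3 = x ^ (e * 3) := by
    intro x hx e
    rw [← Real.rpow_natCast, ← Real.rpow_mul hx]
    norm_num
  have e1 : (q ^ ((1 : ℝ) / 6)) ^ 3 = Real.sqrt q := by
    rw [hp hq0.le, Real.sqrt_eq_rpow]; norm_num
  have e2 : (γ ^ (-(1 : ℝ) / 6)) ^ 3 = (Real.sqrt γ)⁻¹ := by
    rw [hp hγ.le, Real.sqrt_eq_rpow, ← Real.rpow_neg hγ.le]; norm_num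
  have e3 : ∀ {x : ℝ}, 0 ≤ x → (x ^ ((2 : ℝ) / 3)) ^ 3 = x ^ 2 := by
    intro x hx
    rw [hp hx, ← Real.rpow_natCast]; norm_num
  rw [scaleConst, mul_pow, mul_pow, div_pow, mul_pow, e1, e2, e3 (by positivity), e3 (by positivity),
    Real.sqrt_mul hq0.le]
  have hsq : q = Real.sqrt q ^ 2 := (Real.sq_sqrt hq0.le).symm
  have ha : 0 < Real.sqrt q := Real.sqrt_pos.mpr hq0
  have hb : 0 < Real.sqrt γ := Real.sqrt_pos.mpr hγ
  rw [show Real.sqrt q * Real.sqrt γ + q = Real.sqrt q * (Real.sqrt γ + Real.sqrt q) by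
    linear_combination hsq]
  field_simp

theorem isScaling_scaleConst {q γ : ℝ} (hq0 : 0 < q) (hq1 : q < 1) (hγ : 1 ≤ γ) :
    IsScaling q (Real.sqrt (q * γ)) (fun N => 1 / (scaleConst q γ * (N : ℝ) ^ ((1 : ℝ) / 3)))
      fun N => ⌊γ * N⌋₊ := by
  have hγ0 : 0 < γ := by linarith
  have hσ := scaleConst_pos hq0 hq1 hγ0
  have hg : 0 < Real.sqrt (q * γ) := Real.sqrt_pos.mpr (by positivity)
  have hg2 : Real.sqrt (q * γ) ^ 2 = q * γ := Real.sq_sqrt (by positivity)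
  have hgγ : Real.sqrt (q * γ) ^ 2 / q = γ := by rw [hg2]; field_simp
  refine ⟨hq0, hq1, hg, by rw [hg2]; nlinarith, ?_, ?_, ?_, ?_, ?_⟩
  · filter_upwards [eventually_gt_atTop 0] with N hN
    have : (0 : ℝ) < N := by exact_mod_cast hN
    positivity
  · have h1 : Tendsto (fun N : ℕ => scaleConst q γ * (N : ℝ) ^ ((1 : ℝ) / 3)) atTop atTop :=
      ((tendsto_rpow_atTop (by norm_num)).comp tendsto_natCast_atTop_atTop).const_mul_atTop hσ
    simpa only [one_div, Function.comp_def] using tendsto_inv_atTop_zero.comp h1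
  · filter_upwards [eventually_gt_atTop 0] with N hN
    have hN' : (0 : ℝ) < N := by exact_mod_cast hN
    have h3 : ((N : ℝ) ^ ((1 : ℝ) / 3)) ^ 3 = N := by
      rw [← Real.rpow_natCast, ← Real.rpow_mul hN'.le]
      norm_num
    rw [← scaleConst_pow_three hq0 hq1 hγ0, div_pow, mul_pow, h3]
    field_simp
  · intro N
    rw [hgγ]
    exact Nat.floor_le (by positivity)
  · intro N
    rw [hgγ]
    exact (Nat.lt_floor_add_one _).le

theorem IsScaling.tendsto_mul_natCast {q g : ℝ} {δ : ℕ → ℝ} {M : ℕ → ℕ} (h : IsScaling q g δ M) :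
    Tendsto (fun N => δ N * N) atTop atTop := by
  have hq1 : 0 < 1 - q := by linarith [h.hq1]
  have hq0 := h.hq0
  have hg := h.hg
  set κ := (g + q) ^ 2 * (1 + g) ^ 2 / (g * (1 - q) ^ 3) with hκ
  have hκ0 : 0 < κ := by positivity
  have h1 : Tendsto (fun N => κ * δ N ^ 2) atTop (nhdsWithin 0 (Set.Ioi 0)) := by
    refine tendsto_nhdsWithin_iff.mpr ⟨by simpa using (h.lim.pow 2).const_mul κ, ?_⟩
    filter_upwards [h.pos] with N hN
    exact mul_pos hκ0 (pow_pos hN 2)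
  refine (tendsto_inv_nhdsGT_zero.comp h1).congr' ?_
  filter_upwards [h.pos, h.cube] with N h2 h3
  rw [Function.comp_apply, inv_eq_iff_eq_inv]
  refine eq_inv_of_mul_eq_one_left ?_
  linear_combination h3

/-- Shape-fluctuation theorem: for each `q ∈ (0,1)`, `γ ≥ 1`, `s ∈ ℝ`,
`ℙ[(G(⌊γN⌋,N) − Nω(γ,q))/(σ(γ,q)N^{1/3}) ≤ s] → F(s)`, the Tracy–Widom distribution. -/
theorem stmt3
    {Ω : Type*} [MeasurableSpace Ω] (ℙ : Measure Ω) [IsProbabilityMeasure ℙ]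
    (q : ℝ) (hq0 : 0 < q) (hq1 : q < 1)
    (w : ℕ × ℕ → Ω → ℕ)
    (hmeas : ∀ p, Measurable (w p))
    (hindep : ProbabilityTheory.iIndepFun w ℙ)
    (hgeom : ∀ p k, ℙ {ω | w p ω = k} = ENNReal.ofReal ((1 - q) * q ^ k))
    (γ : ℝ) (hγ : 1 ≤ γ) (s : ℝ) :
    Tendsto
      (fun N : ℕ =>
        (ℙ {ω | ((lppSup (fun p => w p ω) ⌊γ * N⌋₊ N : ℝ)
              - N * ((1 + Real.sqrt (q * γ)) ^ 2 / (1 - q) - 1)) /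
            ((q ^ ((1 : ℝ) / 6) * γ ^ (-(1 : ℝ) / 6) / (1 - q)
                * (Real.sqrt γ + Real.sqrt q) ^ ((2 : ℝ) / 3)
                * (1 + Real.sqrt (q * γ)) ^ ((2 : ℝ) / 3))
              * (N : ℝ) ^ ((1 : ℝ) / 3)) ≤ s}).toReal)
      atTop (nhds (TW s)) := by
  have h := isScaling_scaleConst hq0 hq1 hγ
  set δ : ℕ → ℝ := fun N => 1 / (scaleConst q γ * (N : ℝ) ^ ((1 : ℝ) / 3)) with hδ
  set c := (1 + Real.sqrt (q * γ)) ^ 2 / (1 - q) - 1 with hc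
  have hc0 : 0 < c := by
    rw [hc, sub_pos, lt_div_iff₀ (by linarith)]
    nlinarith [h.hg]
  set n : ℕ → ℕ := fun N => ⌊N * c + s / δ N⌋₊ with hn
  have hnn : ∀ᶠ N in atTop, 0 ≤ N * c + s / δ N := by
    filter_upwards [h.pos, h.tendsto_mul_natCast.eventually_ge_atTop (-s / c)] with N h1 h2
    rw [div_le_iff₀ hc0] at h2
    have h3 : N * c + s / δ N = (δ N * N * c + s) / δ N := by field_simp
    rw [h3]
    exact div_nonneg (by linarith) h1.le
  have hpos : ∀ N, scaledPos q (Real.sqrt (q * γ)) (δ N) N (n N + 1) =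
      δ N * (n N + 1 - N * c) := by
    intro N
    rw [scaledPos, hc]
    push_cast
    ring
  have hge : ∀ᶠ N in atTop, s ≤ scaledPos q (Real.sqrt (q * γ)) (δ N) N (n N + 1) := by
    filter_upwards [h.pos] with N h1
    have h2 := (Nat.lt_floor_add_one (N * c + s / δ N)).le
    rw [hpos, ← div_le_iff₀' h1]
    linarith
  have hle : ∀ᶠ N in atTop, scaledPos q (Real.sqrt (q * γ)) (δ N) N (n N + 1) ≤ s + δ N := by
    filter_upwards [h.pos, hnn] with N h1 h2
    have h3 := Nat.floor_le h2
    have h4 : δ N * (n N + 1 - N * c) ≤ δ N * (s / δ N + 1) :=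
      mul_le_mul_of_nonneg_left (by linarith) h1.le
    rw [hpos]
    refine h4.trans_eq ?_
    field_simp
  have hlim : Tendsto (fun N => scaledPos q (Real.sqrt (q * γ)) (δ N) N (n N + 1)) atTop
      (nhds s) :=
    tendsto_of_tendsto_of_tendsto_of_le_of_le' tendsto_const_nhds
      (by simpa using h.lim.const_add s) hge hle
  have hM : ∀ᶠ N : ℕ in atTop, 0 < ⌊γ * N⌋₊ := by
    filter_upwards [eventually_gt_atTop 0] with N hN
    have : (1 : ℝ) ≤ N := by exact_mod_cast hN
    exact Nat.floor_pos.mpr (by nlinarith)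
  refine (h.tendsto_measureReal_lppSup_le ℙ w hmeas hindep hgeom hM hge hlim).congr' ?_
  filter_upwards [h.pos, hnn] with N h1 h2
  rw [Measure.real]
  congr 2
  ext ω
  have h3 : scaleConst q γ * (N : ℝ) ^ ((1 : ℝ) / 3) = 1 / δ N := by rw [hδ, one_div_one_div]
  change lppSup (fun p => w p ω) ⌊γ * N⌋₊ N ≤ ⌊N * c + s / δ N⌋₊ ↔
    ((lppSup (fun p => w p ω) ⌊γ * N⌋₊ N : ℝ) - N * c) /
      (scaleConst q γ * (N : ℝ) ^ ((1 : ℝ) / 3)) ≤ s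
  rw [Nat.le_floor_iff h2, h3, div_le_iff₀ (by positivity), mul_one_div, sub_le_iff_le_add']
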